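/- Let a, b, c, d be positive integers, let X = {x ∈ ℝ³ : a x₁² + b x₂² + c x₃² = d}, let p be a prime, and assume X(ℤ[1/p]) = X ∩ ℤ[1/p]³ is not a discrete subset of X. Then for almost every x ∈ X with respect to the 2-dimensional Hausdorff measure on X, and for every κ > 2, there exists ε₀ = ε₀(x,κ) > 0 such that for all ε ∈ (0,ε₀) the system of inequalities ‖x − r‖ ≤ ε and D(r) ≤ ε^{−κ} has a solution r ∈ X(ℤ[1/p]). -/

import Mathlib

open MeasureTheory Filter

noncomputable section

/-- The rational ellipsoid X = {x ∈ ℝ³ : a x₁² + b x₂² + c x₃² = d}.  (The space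
`Fin 3 → ℝ` carries the maximum norm.) -/
def ellipsoid (a b c d : ℕ) : Set (Fin 3 → ℝ) :=
  {x | (a : ℝ) * x 0 ^ 2 + (b : ℝ) * x 1 ^ 2 + (c : ℝ) * x 2 ^ 2 = (d : ℝ)}

/-- The set X(ℤ[1/p]) of points of the ellipsoid all of whose coordinates lie in
ℤ[1/p] = {m/pᵏ : m ∈ ℤ, k ∈ ℕ}. -/
def ellipsoidZinvp (a b c d p : ℕ) : Set (Fin 3 → ℝ) :=
  {x ∈ ellipsoid a b c d | ∀ i : Fin 3, ∃ (z : ℤ) (k : ℕ), x i = (z : ℝ) / (p : ℝ) ^ k}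

/-- `DenomLe r R` : the denominator D(r) of the rational point r (the least positive
integer N with N·r ∈ ℤ³) satisfies D(r) ≤ R. -/
def DenomLe (r : Fin 3 → ℝ) (R : ℝ) : Prop :=
  ∃ N : ℕ, 0 < N ∧ (N : ℝ) ≤ R ∧ ∀ i : Fin 3, ∃ z : ℤ, (N : ℝ) * r i = (z : ℝ)

noncomputable section

lemma divisor_bound (δ : ℝ) (hδ : 0 < δ) :
    ∃ C : ℝ, 1 ≤ C ∧ ∀ n : ℕ, n ≠ 0 → (n.divisors.card : ℝ) ≤ C * (n : ℝ) ^ δ := by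
  obtain ⟨K, hK1, hK⟩ : ∃ K : ℝ, 1 ≤ K ∧ ∀ a : ℕ, (a + 1 : ℝ) ≤ K * (2 : ℝ) ^ (δ * a) := by
    have hl : 0 < Real.log 2 := Real.log_pos (by norm_num)
    refine ⟨1 + 1 / (δ * Real.log 2), by have : 0 < 1 / (δ * Real.log 2) := by positivity
                                         linarith, fun a => ?_⟩
    have h1 : (1 : ℝ) + δ * a * Real.log 2 ≤ (2 : ℝ) ^ (δ * a) := by
      rw [Real.rpow_def_of_pos (by norm_num)]
      have := Real.add_one_le_exp (Real.log 2 * (δ * a))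
      linarith
    have hpos : 0 < δ * Real.log 2 := by positivity
    calc (a + 1 : ℝ) ≤ (1 + 1 / (δ * Real.log 2)) * (1 + δ * a * Real.log 2) := by
          have : (1 + 1 / (δ * Real.log 2)) * (1 + δ * a * Real.log 2)
            = (a + 1) + δ * a * Real.log 2 + 1 / (δ * Real.log 2) := by field_simp; ring
          rw [this]
          have : 0 < 1 / (δ * Real.log 2) := by positivity
          have : 0 ≤ δ * a * Real.log 2 := by positivity
          linarith
      _ ≤ _ := by gcongr
  obtain ⟨P, hP⟩ := exists_nat_ge ((2 : ℝ) ^ (1 / δ))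
  refine ⟨K ^ P, one_le_pow₀ hK1, fun n hn => ?_⟩
  rw [Nat.card_divisors hn]
  have hn' : (n : ℝ) ^ δ = ∏ q ∈ n.primeFactors, (((q : ℝ) ^ δ) ^ (n.factorization q)) := by
    conv_lhs => rw [← Nat.prod_factorization_pow_eq_self hn]
    rw [Finsupp.prod, Nat.support_factorization]
    push_cast
    rw [← Real.finsetProd_rpow _ _ (fun i _ => by positivity)]
    refine Finset.prod_congr rfl fun q _ => ?_
    rw [← Real.rpow_natCast, ← Real.rpow_natCast, ← Real.rpow_mul (by positivity), ← Real.rpow_mul (by positivity), mul_comm]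
  rw [hn']
  push_cast
  have step : ∀ q ∈ n.primeFactors, ((n.factorization q : ℝ) + 1) ≤
      (if q < P then K else 1) * (((q : ℝ) ^ δ) ^ (n.factorization q)) := by
    intro q hq
    have hqp := Nat.prime_of_mem_primeFactors hq
    have hq2 : (2 : ℝ) ≤ q := by exact_mod_cast hqp.two_le
    split_ifs with h
    · refine (hK _).trans ?_
      gcongr
      rw [Real.rpow_mul (by norm_num), Real.rpow_natCast]
      gcongr
    · rw [one_mul]
      have h2 : (2 : ℝ) ≤ (q : ℝ) ^ δ := by
        have : (2 : ℝ) ^ (1 / δ) ≤ q := hP.trans (by exact_mod_cast not_lt.mp h)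
        calc (2 : ℝ) = ((2 : ℝ) ^ (1 / δ)) ^ δ := by
              rw [← Real.rpow_mul (by norm_num)]; field_simp; simp
          _ ≤ _ := by gcongr
      calc ((n.factorization q : ℝ) + 1) ≤ (2 : ℝ) ^ (n.factorization q) := by
            exact_mod_cast Nat.lt_two_pow_self
        _ ≤ _ := by gcongr
  refine (Finset.prod_le_prod (fun _ _ => by positivity) step).trans ?_
  rw [Finset.prod_mul_distrib]
  gcongr
  rw [Finset.prod_ite, Finset.prod_const, Finset.prod_const_one, mul_one]
  refine pow_le_pow_right₀ hK1 ?_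
  calc _ ≤ (Finset.range P).card := Finset.card_le_card fun q hq => by simp at hq ⊢; exact hq.2
    _ = P := by simp

/-- primitive representations (coprime `y` to `n`) of `n` by `x²+Dy²`. -/
lemma binary_prim (D n : ℕ) (hD : 0 < D) (hn : n ≠ 0) (s : Finset (ℤ × ℤ))
    (hs : ∀ z ∈ s, z.1 ^ 2 + D * z.2 ^ 2 = (n : ℤ) ∧ IsCoprime z.2 (n : ℤ)) :
    s.card ≤ (2 * (4 * D + 1)) * n.divisors.card := by
  classical
  rcases s.eq_empty_or_nonempty with rfl | ⟨z0, hz0⟩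
  · simp
  obtain ⟨h0, c0⟩ := hs z0 hz0
  set x0 := z0.1; set y0 := z0.2
  let G : ℤ × ℤ → ℕ := fun z => Int.gcd n (z.1 * y0 - x0 * z.2)
  refine Finset.card_le_mul_card_image_of_maps_to (f := G) (t := n.divisors) ?_ _ ?_
  · intro z hz
    simp only [Nat.mem_divisors, G]
    refine ⟨?_, hn⟩
    exact_mod_cast Int.gcd_dvd_left (n : ℤ) _
  intro g hg
  have hgn : g ∣ n := (Nat.mem_divisors.mp hg).1
  obtain ⟨e, he⟩ := hgn
  have hg0 : g ≠ 0 := by rintro rfl; simp at he; exact hn he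
  have hnZ : (n : ℤ) = g * e := by exact_mod_cast he
  -- facts
  have F : ∀ z ∈ s.filter (fun z => G z = g), (g : ℤ) ∣ (z.1 * y0 - x0 * z.2) ∧
      (e : ℤ) ∣ (z.1 * y0 + x0 * z.2) := by
    intro z hz
    rw [Finset.mem_filter] at hz
    obtain ⟨hz, hG⟩ := hz
    obtain ⟨h1, c1⟩ := hs z hz
    have hd : (g : ℤ) ∣ (z.1 * y0 - x0 * z.2) := by rw [← hG]; exact Int.gcd_dvd_right _ _
    refine ⟨hd, ?_⟩
    obtain ⟨w, hw⟩ := hd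
    have hcop : IsCoprime (e : ℤ) w := by
      rw [Int.isCoprime_iff_gcd_eq_one]
      have : Int.gcd (g * e) (g * w) = g := by rw [← hnZ, ← hw]; exact hG
      rw [Int.gcd_mul_left] at this
      simpa [hg0] using this
    refine hcop.dvd_of_dvd_mul_left ?_
    have : (g : ℤ) * e ∣ g * (w * (z.1 * y0 + x0 * z.2)) := by
      rw [← mul_assoc, ← hw, ← hnZ]
      refine ⟨y0 ^ 2 - z.2 ^ 2, ?_⟩
      linear_combination y0 ^ 2 * h1 - z.2 ^ 2 * h0
    exact (mul_dvd_mul_iff_left (by exact_mod_cast hg0)).mp this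
  rcases (s.filter (fun z => G z = g)).eq_empty_or_nonempty with hem | ⟨z1, hz1⟩
  · rw [hem]; simp
  obtain ⟨Fg1, Fe1⟩ := F z1 hz1
  obtain ⟨h1, c1⟩ := hs z1 (Finset.mem_filter.mp hz1).1
  set h := Nat.gcd g e
  have hhg : (h : ℤ) ∣ g := by exact_mod_cast Nat.gcd_dvd_left g e
  have hhe : (h : ℤ) ∣ e := by exact_mod_cast Nat.gcd_dvd_right g e
  have hh2n : ((h : ℤ)) ^ 2 ∣ n := by rw [hnZ, sq]; exact mul_dvd_mul hhg hhe
  have hhn : (h : ℤ) ∣ n := (dvd_pow_self _ (by norm_num)).trans hh2n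
  have hh0 : h ≠ 0 := by
    intro h0'; rw [h0'] at hhn; simp at hhn; exact hn hhn
  have hh4 : ((h : ℤ)) ^ 2 ∣ 4 * D := by
    have a1 : (h : ℤ) ∣ z1.2 * (2 * x0) := by
      have := dvd_sub (hhe.trans Fe1) (hhg.trans Fg1)
      ring_nf at this ⊢; exact this
    have a2 : (h : ℤ) ∣ 2 * x0 :=
      ((c1.symm.of_isCoprime_of_dvd_left hhn)).dvd_of_dvd_mul_left a1
    have a3 : ((h : ℤ)) ^ 2 ∣ y0 ^ 2 * (4 * D) := by
      have b1 := pow_dvd_pow_of_dvd a2 2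
      have b2 := dvd_sub (hh2n.mul_left 4) b1
      have : (4 * (n : ℤ) - (2 * x0) ^ 2) = y0 ^ 2 * (4 * D) := by rw [← h0]; ring
      rwa [this] at b2
    have a4 : IsCoprime ((h : ℤ) ^ 2) (y0 ^ 2) :=
      (c0.symm.of_isCoprime_of_dvd_left hhn).pow
    exact a4.dvd_of_dvd_mul_left a3
  have hhD : h ≤ 2 * D := by
    have : ((h : ℤ)) ^ 2 ≤ 4 * D := Int.le_of_dvd (by positivity) hh4
    have hD1 : (1 : ℤ) ≤ D := by exact_mod_cast hD
    by_contra hcon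
    have : (2 * D + 1 : ℤ) ≤ h := by exact_mod_cast not_le.mp hcon
    nlinarith
  have hlcm : ∀ Δ : ℤ, (g : ℤ) ∣ Δ → (e : ℤ) ∣ Δ → (n : ℤ) ∣ h * Δ := by
    intro Δ hg' he'
    have : ((Nat.lcm g e : ℕ) : ℤ) ∣ Δ := by
      rw [Int.natCast_dvd] at *
      exact Nat.lcm_dvd hg' he'
    have e1 : (n : ℤ) = h * (Nat.lcm g e : ℕ) := by
      rw [he]; exact_mod_cast (Nat.gcd_mul_lcm g e).symm
    rw [e1]; exact mul_dvd_mul_left _ this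
  have key : ∀ z ∈ s.filter (fun z => G z = g), (n : ℤ) ∣ h * (z.1 * z1.2 - z1.1 * z.2) := by
    intro z hz
    obtain ⟨Fg, Fe⟩ := F z hz
    obtain ⟨hz', cz⟩ := hs z (Finset.mem_filter.mp hz).1
    apply hlcm
    · have : (g : ℤ) ∣ y0 * (z.1 * z1.2 - z1.1 * z.2) := by
        have := dvd_sub (Fg.mul_left z1.2) (Fg1.mul_left z.2)
        ring_nf at this ⊢; exact this
      exact (c0.symm.of_isCoprime_of_dvd_left (hnZ ▸ dvd_mul_right _ _)).dvd_of_dvd_mul_left this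
    · have : (e : ℤ) ∣ y0 * (z.1 * z1.2 - z1.1 * z.2) := by
        have := dvd_sub (Fe.mul_left z1.2) (Fe1.mul_left z.2)
        ring_nf at this ⊢; exact this
      exact (c0.symm.of_isCoprime_of_dvd_left (hnZ ▸ dvd_mul_left _ _)).dvd_of_dvd_mul_left this
  have hnpos : (0 : ℤ) < n := by exact_mod_cast Nat.pos_of_ne_zero hn
  -- the injection
  let Φ : ℤ × ℤ → ℤ × Bool := fun z => (h * (z.1 * z1.2 - z1.1 * z.2) / n,
    decide (0 ≤ z.1 * z1.1 + D * z.2 * z1.2))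
  have hcard : (s.filter (fun z => G z = g)).card ≤
      ((Finset.Icc (-(2 * D : ℤ)) (2 * D)) ×ˢ (Finset.univ : Finset Bool)).card := by
    refine Finset.card_le_card_of_injOn Φ ?_ ?_
    · intro z hz
      obtain ⟨w, hw⟩ := key z hz
      obtain ⟨hz', cz⟩ := hs z (Finset.mem_filter.mp hz).1
      simp only [Finset.coe_product, Set.mem_prod, Finset.coe_Icc, Set.mem_Icc, Finset.coe_univ, Set.mem_univ, and_true, Φ]
      rw [hw, Int.mul_ediv_cancel_left _ hnpos.ne', ← abs_le]
      have hid : (z.1 * z1.1 + D * z.2 * z1.2) ^ 2 + D * (z.1 * z1.2 - z1.1 * z.2) ^ 2 = (n : ℤ) ^ 2 := by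
        have : (n : ℤ) ^ 2 = (z.1 ^ 2 + D * z.2 ^ 2) * (z1.1 ^ 2 + D * z1.2 ^ 2) := by
          rw [hz', h1]; ring
        rw [this]; ring
      have hD1 : (1 : ℤ) ≤ D := by exact_mod_cast hD
      have hb : |z.1 * z1.2 - z1.1 * z.2| ≤ n := by
        refine abs_le_of_sq_le_sq ?_ hnpos.le
        nlinarith [sq_nonneg (z.1 * z1.1 + D * z.2 * z1.2), sq_nonneg (z.1 * z1.2 - z1.1 * z.2)]
      have : (n : ℤ) * |w| ≤ n * (2 * D) := by
        calc (n : ℤ) * |w| = |(n : ℤ) * w| := by rw [abs_mul, abs_of_pos hnpos]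
          _ = h * |z.1 * z1.2 - z1.1 * z.2| := by rw [← hw, abs_mul]; simp
          _ ≤ (2 * D) * n := by
            have : (h : ℤ) ≤ 2 * D := by exact_mod_cast hhD
            gcongr
          _ = _ := by ring
      exact le_of_mul_le_mul_left this hnpos
    · intro z hz z' hz' hΦ
      have hz := Finset.mem_coe.mp hz
      have hz' := Finset.mem_coe.mp hz'
      simp only [Φ, Prod.mk.injEq] at hΦ
      obtain ⟨p1, p2⟩ := hΦ
      have q1 := Int.ediv_mul_cancel (key z hz)
      have q2 := Int.ediv_mul_cancel (key z' hz')
      have hΔ : (z.1 * z1.2 - z1.1 * z.2) = (z'.1 * z1.2 - z1.1 * z'.2) := by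
        have : (h : ℤ) * (z.1 * z1.2 - z1.1 * z.2) = h * (z'.1 * z1.2 - z1.1 * z'.2) := by
          rw [← q1, ← q2, p1]
        exact mul_left_cancel₀ (by exact_mod_cast hh0) this
      have e1 := (hs z (Finset.mem_filter.mp hz).1).1
      have e2 := (hs z' (Finset.mem_filter.mp hz').1).1
      have hS : (z.1 * z1.1 + D * z.2 * z1.2) ^ 2 = (z'.1 * z1.1 + D * z'.2 * z1.2) ^ 2 := by
        have i1 : (z.1 * z1.1 + D * z.2 * z1.2) ^ 2 + D * (z.1 * z1.2 - z1.1 * z.2) ^ 2 =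
          (z.1 ^ 2 + D * z.2 ^ 2) * (z1.1 ^ 2 + D * z1.2 ^ 2) := by ring
        have i2 : (z'.1 * z1.1 + D * z'.2 * z1.2) ^ 2 + D * (z'.1 * z1.2 - z1.1 * z'.2) ^ 2 =
          (z'.1 ^ 2 + D * z'.2 ^ 2) * (z1.1 ^ 2 + D * z1.2 ^ 2) := by ring
        rw [e1] at i1; rw [e2] at i2; rw [hΔ] at i1; linarith
      have hS' : (z.1 * z1.1 + D * z.2 * z1.2) = (z'.1 * z1.1 + D * z'.2 * z1.2) := by
        have p2' : 0 ≤ (z.1 * z1.1 + D * z.2 * z1.2) ↔ 0 ≤ (z'.1 * z1.1 + D * z'.2 * z1.2) := by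
          simpa using p2
        rcases sq_eq_sq_iff_eq_or_eq_neg.mp hS with h | h
        · exact h
        · rcases le_total 0 (z.1 * z1.1 + D * z.2 * z1.2) with h' | h'
          · have := p2'.mp h'; linarith
          · rcases h'.lt_or_eq with h'' | h''
            · have : ¬ 0 ≤ (z'.1 * z1.1 + D * z'.2 * z1.2) := fun hh => absurd (p2'.mpr hh) (not_le.mpr h'')
              linarith
            · linarith
      have g1 : (n : ℤ) * z.1 = n * z'.1 := by
        rw [← h1]; linear_combination z1.1 * hS' + D * z1.2 * hΔ
      have g2 : (n : ℤ) * z.2 = n * z'.2 := by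
        rw [← h1]; linear_combination z1.2 * hS' - z1.1 * hΔ
      exact Prod.ext (mul_left_cancel₀ hnpos.ne' g1) (mul_left_cancel₀ hnpos.ne' g2)
  refine hcard.trans (le_of_eq ?_)
  rw [Finset.card_product]
  simp
  omega

lemma binary_aux (D n : ℕ) (hD : 0 < D) (hn : n ≠ 0) (s : Finset (ℤ × ℤ))
    (hs : ∀ z ∈ s, z.1 ^ 2 + D * z.2 ^ 2 = (n : ℤ)) :
    s.card ≤ ((2 * (4 * D + 1)) * n.divisors.card) * n.divisors.card := by
  classical
  have hfpos : ∀ z ∈ s, Int.gcd z.1 z.2 ≠ 0 := by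
    intro z hz h0
    have := hs z hz
    rw [Int.gcd_eq_zero_iff] at h0
    rw [h0.1, h0.2] at this
    simp at this; omega
  refine Finset.card_le_mul_card_image_of_maps_to (f := fun z => Int.gcd z.1 z.2) (t := n.divisors) ?_ _ ?_
  · intro z hz
    rw [Nat.mem_divisors]
    refine ⟨?_, hn⟩
    rw [← Int.natCast_dvd_natCast, ← hs z hz]
    exact dvd_add ((Int.gcd_dvd_left _ _).trans (dvd_pow_self _ two_ne_zero))
      (((Int.gcd_dvd_right _ _).trans (dvd_pow_self _ two_ne_zero)).mul_left _)
  intro f hf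
  have hfn := (Nat.mem_divisors.mp hf).1
  have hf0 : f ≠ 0 := by rintro rfl; simp at hfn; exact hn hfn
  rcases (s.filter (fun z => Int.gcd z.1 z.2 = f)).eq_empty_or_nonempty with hem | ⟨z1, hz1⟩
  · rw [hem]; simp
  have hfz : ∀ z ∈ s.filter (fun z => Int.gcd z.1 z.2 = f), (f : ℤ) * (z.1 / f) = z.1 ∧ (f : ℤ) * (z.2 / f) = z.2 := by
    intro z hz
    have := (Finset.mem_filter.mp hz).2
    constructor
    · exact Int.mul_ediv_cancel' (by rw [← this]; exact Int.gcd_dvd_left _ _)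
    · exact Int.mul_ediv_cancel' (by rw [← this]; exact Int.gcd_dvd_right _ _)
  have hsq : f ^ 2 ∣ n := by
    rw [← Int.natCast_dvd_natCast, ← hs z1 (Finset.mem_filter.mp hz1).1, ← (hfz z1 hz1).1, ← (hfz z1 hz1).2]
    push_cast
    refine ⟨(z1.1 / f) ^ 2 + D * (z1.2 / f) ^ 2, by ring⟩
  obtain ⟨n', hn'⟩ := hsq
  have hn'0 : n' ≠ 0 := by rintro rfl; simp at hn'; exact hn hn'
  have hinj : Set.InjOn (fun z : ℤ × ℤ => (z.1 / (f : ℤ), z.2 / (f : ℤ))) (s.filter (fun z => Int.gcd z.1 z.2 = f)) := by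
    intro z hz z' hz' h
    have h1 := hfz z hz
    have h2 := hfz z' hz'
    simp only [Prod.mk.injEq] at h
    exact Prod.ext (by rw [← h1.1, ← h2.1, h.1]) (by rw [← h1.2, ← h2.2, h.2])
  rw [← Finset.card_image_of_injOn hinj]
  refine (binary_prim D n' hD hn'0 _ ?_).trans ?_
  · intro w hw
    obtain ⟨z, hz, rfl⟩ := Finset.mem_image.mp hw
    have h1 := hfz z hz
    have h2 := hs z (Finset.mem_filter.mp hz).1
    have h3 := (Finset.mem_filter.mp hz).2
    have hE : (z.1 / (f : ℤ)) ^ 2 + D * (z.2 / (f : ℤ)) ^ 2 = (n' : ℤ) := by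
      have : ((f : ℤ) ^ 2) * ((z.1 / (f : ℤ)) ^ 2 + D * (z.2 / (f : ℤ)) ^ 2) = f ^ 2 * (n' : ℤ) := by
        calc _ = ((f : ℤ) * (z.1 / f)) ^ 2 + D * ((f : ℤ) * (z.2 / f)) ^ 2 := by ring
          _ = n := by rw [h1.1, h1.2, h2]
          _ = _ := by rw [hn']; push_cast; ring
      exact mul_left_cancel₀ (by positivity) this
    refine ⟨hE, ?_⟩
    have hc : IsCoprime (z.1 / (f : ℤ)) (z.2 / (f : ℤ)) := by
      rw [Int.isCoprime_iff_gcd_eq_one]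
      have : Int.gcd ((f : ℤ) * (z.1 / f)) ((f : ℤ) * (z.2 / f)) = f := by rw [h1.1, h1.2, h3]
      rw [Int.gcd_mul_left] at this
      simpa [hf0] using this
    rw [← hE]
    have := (hc.symm.pow_right (n := 2)).add_mul_left_right (D * (z.2 / (f : ℤ)))
    have e : (z.1 / (f : ℤ)) ^ 2 + D * (z.2 / (f : ℤ)) ^ 2 =
      (z.1 / (f : ℤ)) ^ 2 + z.2 / f * (D * (z.2 / f)) := by ring
    rw [e]
    exact this
  · gcongr
    · exact ⟨f ^ 2, by rw [hn']; ring⟩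

/-- number of representations by `x²+Dy²` -/
lemma binary_bound (D : ℕ) (hD : 0 < D) (δ : ℝ) (hδ : 0 < δ) :
    ∃ C : ℝ, 1 ≤ C ∧ ∀ n : ℤ, ∀ s : Finset (ℤ × ℤ),
      (∀ z ∈ s, z.1 ^ 2 + D * z.2 ^ 2 = n) → (s.card : ℝ) ≤ C * (1 + |(n : ℝ)|) ^ δ := by
  obtain ⟨C, hC1, hC⟩ := divisor_bound (δ / 2) (by positivity)
  refine ⟨(2 * (4 * D + 1)) * C ^ 2, ?_, fun n s hs => ?_⟩
  · nlinarith [one_le_pow₀ hC1 (n := 2), (Nat.cast_nonneg D : (0 : ℝ) ≤ D)]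
  have h1 : (1 : ℝ) ≤ (2 * (4 * D + 1)) * C ^ 2 := by
    nlinarith [one_le_pow₀ hC1 (n := 2), (Nat.cast_nonneg D : (0 : ℝ) ≤ D)]
  have h2 : (1 : ℝ) ≤ (1 + |(n : ℝ)|) ^ δ := Real.one_le_rpow (by linarith [abs_nonneg (n : ℝ)]) hδ.le
  rcases s.eq_empty_or_nonempty with rfl | ⟨z1, hz1⟩
  · simp; positivity
  have hn0 : 0 ≤ n := by rw [← hs z1 hz1]; positivity
  lift n to ℕ using hn0
  rcases eq_or_ne n 0 with rfl | hn
  · have : s.card ≤ 1 := by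
      rw [Finset.card_le_one_iff]
      have : ∀ z ∈ s, z = 0 := by
        intro z hz
        have := hs z hz
        have hD1 : (1 : ℤ) ≤ D := by exact_mod_cast hD
        have a1 : z.1 = 0 := by
          have : z.1 ^ 2 ≤ 0 := by push_cast at this; nlinarith [sq_nonneg z.2]
          exact pow_eq_zero_iff two_ne_zero |>.mp (le_antisymm this (sq_nonneg _))
        have a2 : z.2 = 0 := by
          have : z.2 ^ 2 ≤ 0 := by push_cast at this; nlinarith [sq_nonneg z.1, sq_nonneg z.2]
          exact pow_eq_zero_iff two_ne_zero |>.mp (le_antisymm this (sq_nonneg _))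
        exact Prod.ext a1 a2
      intro a b ha hb
      rw [this a ha, this b hb]
    calc (s.card : ℝ) ≤ 1 * 1 := by rw [one_mul]; exact_mod_cast this
      _ ≤ _ := by gcongr
  have := binary_aux D n hD hn s hs
  calc (s.card : ℝ) ≤ ((2 * (4 * D + 1)) * n.divisors.card) * n.divisors.card := by exact_mod_cast this
    _ ≤ ((2 * (4 * D + 1)) * (C * (n : ℝ) ^ (δ / 2))) * (C * (n : ℝ) ^ (δ / 2)) := by
      have := hC n hn
      gcongr
    _ = (2 * (4 * D + 1)) * C ^ 2 * ((n : ℝ) ^ (δ / 2) * (n : ℝ) ^ (δ / 2)) := by ring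
    _ = (2 * (4 * D + 1)) * C ^ 2 * ((n : ℝ) ^ δ) := by
      rw [← Real.rpow_add (by positivity)]; simp
    _ ≤ _ := by
      gcongr
      simp

end

noncomputable section

/-- The order `ℤ⟨1,i,j,ij⟩`, `i² = -α`, `j² = -β`. -/
abbrev OO (α β : ℕ) : Type := QuaternionAlgebra ℤ (-(α : ℤ)) 0 (-(β : ℤ))

namespace OO
variable {α β : ℕ}

def nm (q : OO α β) : ℤ := q.re ^ 2 + α * q.imI ^ 2 + β * q.imJ ^ 2 + α * β * q.imK ^ 2

def sc (k : ℤ) (q : OO α β) : OO α β := ⟨k * q.re, k * q.imI, k * q.imJ, k * q.imK⟩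

@[simp] lemma sc_re (k : ℤ) (q : OO α β) : (sc k q).re = k * q.re := rfl
@[simp] lemma sc_imI (k : ℤ) (q : OO α β) : (sc k q).imI = k * q.imI := rfl
@[simp] lemma sc_imJ (k : ℤ) (q : OO α β) : (sc k q).imJ = k * q.imJ := rfl
@[simp] lemma sc_imK (k : ℤ) (q : OO α β) : (sc k q).imK = k * q.imK := rfl

lemma nm_mul (q r : OO α β) : nm (q * r) = nm q * nm r := by
  simp [nm]; ring
lemma nm_star (q : OO α β) : nm (star q) = nm q := by simp [nm]
lemma nm_sc (k : ℤ) (q : OO α β) : nm (sc k q) = k ^ 2 * nm q := by simp [nm]; ring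
lemma nm_one : nm (1 : OO α β) = 1 := by simp [nm]
lemma sc_mul (k : ℤ) (q r : OO α β) : sc k q * r = sc k (q * r) := by
  ext <;> simp <;> ring
lemma mul_sc (k : ℤ) (q r : OO α β) : q * sc k r = sc k (q * r) := by
  ext <;> simp <;> ring
lemma sc_sc (k l : ℤ) (q : OO α β) : sc k (sc l q) = sc (k * l) q := by
  ext <;> simp <;> ring
lemma star_sc (k : ℤ) (q : OO α β) : star (sc k q) = sc k (star q) := by
  ext <;> simp
lemma sc_one' (q : OO α β) : sc 1 q = q := by ext <;> simp
lemma mul_star' (q : OO α β) : q * star q = sc (nm q) 1 := by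
  ext <;> simp [nm] <;> ring
lemma star_mul'' (q : OO α β) : star q * q = sc (nm q) 1 := by
  ext <;> simp [nm] <;> ring
lemma star_mul_cancel (q r : OO α β) : star q * (q * r) = sc (nm q) r := by
  rw [← mul_assoc, star_mul'', sc_mul, one_mul]
lemma mul_star_cancel (q r : OO α β) : q * (star q * r) = sc (nm q) r := by
  rw [← mul_assoc, mul_star', sc_mul, one_mul]
lemma mul_mul_star (q r : OO α β) : r * q * star q = sc (nm q) r := by
  rw [mul_assoc, mul_star', mul_sc, mul_one]
lemma mul_star_mul (q r : OO α β) : r * star q * q = sc (nm q) r := by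
  rw [mul_assoc, star_mul'', mul_sc, mul_one]
lemma sc_inj {k : ℤ} (hk : k ≠ 0) {q r : OO α β} (h : sc k q = sc k r) : q = r := by
  have h1 := congrArg QuaternionAlgebra.re h
  have h2 := congrArg QuaternionAlgebra.imI h
  have h3 := congrArg QuaternionAlgebra.imJ h
  have h4 := congrArg QuaternionAlgebra.imK h
  simp only [sc_re, sc_imI, sc_imJ, sc_imK] at h1 h2 h3 h4
  ext
  · exact mul_left_cancel₀ hk h1
  · exact mul_left_cancel₀ hk h2
  · exact mul_left_cancel₀ hk h3
  · exact mul_left_cancel₀ hk h4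

lemma nm_nonneg (q : OO α β) : 0 ≤ nm q := by unfold nm; positivity

section bounds

lemma coords_le (hα : 0 < α) (hβ : 0 < β) (q : OO α β) : q.re ^ 2 ≤ nm q ∧ q.imI ^ 2 ≤ nm q ∧ q.imJ ^ 2 ≤ nm q ∧ q.imK ^ 2 ≤ nm q := by
  have a : (1 : ℤ) ≤ α := by exact_mod_cast hα
  have b : (1 : ℤ) ≤ β := by exact_mod_cast hβ
  have ab : (1 : ℤ) ≤ α * β := by exact_mod_cast Nat.mul_pos hα hβ
  have h1 : q.imI ^ 2 ≤ α * q.imI ^ 2 := by nlinarith [sq_nonneg q.imI]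
  have h2 : q.imJ ^ 2 ≤ β * q.imJ ^ 2 := by nlinarith [sq_nonneg q.imJ]
  have h3 : q.imK ^ 2 ≤ α * β * q.imK ^ 2 := by nlinarith [sq_nonneg q.imK]
  have := sq_nonneg q.re
  have := sq_nonneg q.imI
  have := sq_nonneg q.imJ
  have := sq_nonneg q.imK
  unfold nm
  refine ⟨by linarith, by linarith, by linarith, by linarith⟩

lemma nm_pos (hα : 0 < α) (hβ : 0 < β) {q : OO α β} (hq : q ≠ 0) : 0 < nm q := by
  obtain ⟨h1, h2, h3, h4⟩ := coords_le hα hβ q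
  rcases (nm_nonneg q).lt_or_eq with h | h
  · exact h
  · exfalso; apply hq
    rw [← h] at h1 h2 h3 h4
    ext
    · exact pow_eq_zero_iff two_ne_zero |>.mp (le_antisymm h1 (sq_nonneg _))
    · exact pow_eq_zero_iff two_ne_zero |>.mp (le_antisymm h2 (sq_nonneg _))
    · exact pow_eq_zero_iff two_ne_zero |>.mp (le_antisymm h3 (sq_nonneg _))
    · exact pow_eq_zero_iff two_ne_zero |>.mp (le_antisymm h4 (sq_nonneg _))

lemma finite_le (hα : 0 < α) (hβ : 0 < β) (B : ℤ) : {q : OO α β | nm q ≤ B}.Finite := by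
  have hinj : Function.Injective (fun q : OO α β => (q.re, q.imI, q.imJ, q.imK)) := by
    intro q r h
    simp only [Prod.mk.injEq] at h
    ext <;> simp [h]
  refine Set.Finite.of_finite_image (f := fun q : OO α β => (q.re, q.imI, q.imJ, q.imK)) ?_ hinj.injOn
  refine Set.Finite.subset ((Finset.Icc (-B) B ×ˢ Finset.Icc (-B) B ×ˢ Finset.Icc (-B) B ×ˢ Finset.Icc (-B) B).finite_toSet) ?_
  rintro _ ⟨q, hq, rfl⟩
  obtain ⟨h1, h2, h3, h4⟩ := coords_le hα hβ q
  have hq : nm q ≤ B := hq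
  have key : ∀ z : ℤ, z ^ 2 ≤ nm q → z ∈ Finset.Icc (-B) B := by
    intro z hz
    rw [Finset.mem_Icc, ← abs_le]
    have : |z| ≤ z ^ 2 := by rw [← sq_abs]; nlinarith [abs_nonneg z, sq_nonneg (|z|), Int.natAbs_le_self_sq z, Int.natCast_natAbs z, sq_abs z]
    linarith
  simp only [Finset.coe_product, Set.mem_prod, Finset.mem_coe]
  exact ⟨key _ h1, key _ h2, key _ h3, key _ h4⟩

lemma finite_eq (hα : 0 < α) (hβ : 0 < β) (B : ℤ) : {q : OO α β | nm q = B}.Finite :=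
  (finite_le hα hβ B).subset fun _ h => le_of_eq h

/-- basic counting: fix `re` and `imK`. -/
lemma count_re_imK (hα : 0 < α) (hβ : 0 < β) (δ : ℝ) (hδ : 0 < δ) : ∃ C : ℝ, 1 ≤ C ∧ ∀ (ν : ℤ) (s : Finset (OO α β))
    (I J : Finset ℤ), 1 ≤ ν → (∀ q ∈ s, nm q = ν ∧ q.re ∈ I ∧ q.imK ∈ J) →
    (s.card : ℝ) ≤ C * (ν : ℝ) ^ δ * I.card * J.card := by
  classical
  obtain ⟨C, hC1, hC⟩ := binary_bound (α * β) (Nat.mul_pos hα hβ) δ hδ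
  have hα1 : (1 : ℝ) ≤ α := by exact_mod_cast hα
  refine ⟨C * (2 * α) ^ δ, ?_, fun ν s I J hν hs => ?_⟩
  · have : (1 : ℝ) ≤ (2 * α) ^ δ := Real.one_le_rpow (by linarith) hδ.le
    nlinarith
  have h1 : ((s.card : ℕ) : ℝ) ≤ (I ×ˢ J).card • (C * (2 * α) ^ δ * (ν : ℝ) ^ δ) := by
    have hmaps : ∀ q ∈ s, (q.re, q.imK) ∈ I ×ˢ J := fun q hq => by
      simp [(hs q hq).2.1, (hs q hq).2.2]
    rw [Finset.card_eq_sum_card_fiberwise hmaps]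
    push_cast
    refine Finset.sum_le_card_nsmul _ _ _ ?_
    rintro ⟨x, w⟩ -
    have hinj : Set.InjOn (fun q : OO α β => ((α : ℤ) * q.imI, q.imJ)) (s.filter (fun q => (q.re, q.imK) = (x, w))) := by
      intro q hq r hr h
      have hq := (Finset.mem_filter.mp hq).2
      have hr := (Finset.mem_filter.mp hr).2
      simp only [Prod.mk.injEq] at h hq hr
      have hα0 : (α : ℤ) ≠ 0 := by exact_mod_cast hα.ne'
      ext
      · rw [hq.1, hr.1]
      · exact mul_left_cancel₀ hα0 h.1
      · exact h.2
      · rw [hq.2, hr.2]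
    rw [← Finset.card_image_of_injOn hinj]
    by_cases hem : (s.filter (fun q => (q.re, q.imK) = (x, w))).Nonempty
    swap
    · rw [Finset.not_nonempty_iff_eq_empty] at hem
      rw [hem]; simp; positivity
    obtain ⟨q0, hq0⟩ := hem
    have e0 := (Finset.mem_filter.mp hq0)
    have hle : (0 : ℤ) ≤ (ν - x ^ 2 - α * β * w ^ 2) ∧ (ν - x ^ 2 - α * β * w ^ 2) ≤ ν := by
      have := (hs q0 e0.1).1
      have e := e0.2
      simp only [Prod.mk.injEq] at e
      rw [← this, nm, ← e.1, ← e.2]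
      constructor
      · have : 0 ≤ α * q0.imI ^ 2 + β * q0.imJ ^ 2 := by positivity
        linarith
      · have : 0 ≤ q0.re ^ 2 + α * β * q0.imK ^ 2 := by positivity
        linarith
    refine (hC (α * (ν - x ^ 2 - α * β * w ^ 2)) _ ?_).trans ?_
    · intro z hz
      obtain ⟨q, hq, rfl⟩ := Finset.mem_image.mp hz
      have e0 := (Finset.mem_filter.mp hq)
      have := (hs q e0.1).1
      have e := e0.2
      simp only [Prod.mk.injEq] at e
      rw [← this, nm, ← e.1, ← e.2]
      push_cast; ring
    · rw [mul_assoc C, ← Real.mul_rpow (by positivity) (by positivity)]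
      gcongr
      have hle' : (0 : ℝ) ≤ (ν - x ^ 2 - α * β * w ^ 2) ∧ ((ν - x ^ 2 - α * β * w ^ 2) : ℝ) ≤ ν := by exact_mod_cast hle
      push_cast
      rw [abs_mul, abs_of_nonneg hle'.1, abs_of_nonneg (by positivity)]
      have hν' : (1 : ℝ) ≤ ν := by exact_mod_cast hν
      have : (α : ℝ) * (ν - x ^ 2 - α * β * w ^ 2) ≤ α * ν := by gcongr; exact hle'.2
      nlinarith
  refine h1.trans (le_of_eq ?_)
  rw [Finset.card_product]
  simp; ring

/-- number of elements of given norm -/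
lemma count_nm (hα : 0 < α) (hβ : 0 < β) (δ : ℝ) (hδ : 0 < δ) : ∃ C : ℝ, 1 ≤ C ∧ ∀ (ν : ℤ) (s : Finset (OO α β)),
    1 ≤ ν → (∀ q ∈ s, nm q = ν) → (s.card : ℝ) ≤ C * (ν : ℝ) ^ (1 + δ) := by
  obtain ⟨C, hC1, hC⟩ := count_re_imK hα hβ δ hδ
  refine ⟨C * 9, by linarith, fun ν s hν hs => ?_⟩
  have hν' : (1 : ℝ) ≤ ν := by exact_mod_cast hν
  have hsq : (1 : ℤ) ≤ Int.sqrt ν := by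
    have : (1 : ℤ) ≤ (Nat.sqrt ν.toNat : ℕ) := by
      have : 1 ≤ Nat.sqrt ν.toNat := by rw [Nat.le_sqrt]; omega
      exact_mod_cast this
    exact this
  have hsq2 : (Int.sqrt ν) ^ 2 ≤ ν := by
    have h := Nat.sqrt_le' ν.toNat
    have : ((Nat.sqrt ν.toNat : ℕ) : ℤ) ^ 2 ≤ (ν.toNat : ℤ) := by exact_mod_cast h
    have h2 : (ν.toNat : ℤ) = ν := Int.toNat_of_nonneg (by omega)
    rw [h2] at this; exact this
  have hmem : ∀ z : ℤ, z ^ 2 ≤ ν → z ∈ Finset.Icc (-(Int.sqrt ν)) (Int.sqrt ν) := by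
    intro z hz
    rw [Finset.mem_Icc, ← abs_le]
    have h2 : (ν.toNat : ℤ) = ν := Int.toNat_of_nonneg (by omega)
    have : z.natAbs ≤ Nat.sqrt ν.toNat := by
      rw [Nat.le_sqrt']
      zify
      rw [sq_abs, h2]; exact hz
    rw [Int.abs_eq_natAbs]
    exact Int.ofNat_le.mpr this
  have := hC ν s (Finset.Icc (-(Int.sqrt ν)) (Int.sqrt ν)) (Finset.Icc (-(Int.sqrt ν)) (Int.sqrt ν)) hν ?_
  · refine this.trans ?_
    have hc : ((Finset.Icc (-(Int.sqrt ν)) (Int.sqrt ν)).card : ℝ) ≤ 3 * (Int.sqrt ν : ℤ) := by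
      rw [Int.card_Icc]
      have : ((Int.sqrt ν + 1 - -(Int.sqrt ν)).toNat : ℤ) ≤ 3 * (Int.sqrt ν : ℤ) := by
        rw [Int.toNat_of_nonneg (by omega)]; omega
      exact_mod_cast this
    have hs2 : ((Int.sqrt ν : ℤ) : ℝ) ^ 2 ≤ ν := by exact_mod_cast hsq2
    calc C * (ν : ℝ) ^ δ * ((Finset.Icc (-(Int.sqrt ν)) (Int.sqrt ν)).card : ℝ) * ((Finset.Icc (-(Int.sqrt ν)) (Int.sqrt ν)).card : ℝ)
        ≤ C * (ν : ℝ) ^ δ * (3 * (Int.sqrt ν : ℤ)) * (3 * (Int.sqrt ν : ℤ)) := by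
          have : (0 : ℝ) ≤ (Int.sqrt ν : ℤ) := by exact_mod_cast (by omega : (0 : ℤ) ≤ Int.sqrt ν)
          gcongr
      _ = C * 9 * ((ν : ℝ) ^ δ * ((Int.sqrt ν : ℤ) : ℝ) ^ 2) := by ring
      _ ≤ C * 9 * ((ν : ℝ) ^ δ * ν) := by gcongr
      _ = _ := by rw [Real.rpow_add (by linarith), Real.rpow_one]; ring
  · intro q hq
    obtain ⟨h1, h2, h3, h4⟩ := coords_le hα hβ q
    rw [hs q hq] at h1 h4
    exact ⟨hs q hq, hmem _ h1, hmem _ h4⟩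

end bounds
end OO
end

noncomputable section

lemma padic_add_le {p : ℕ} [Fact p.Prime] {a b : ℚ_[p]} {t : ℝ} (ha : ‖a‖ ≤ t) (hb : ‖b‖ ≤ t) :
    ‖a + b‖ ≤ t := (Padic.nonarchimedean a b).trans (max_le ha hb)
lemma padic_sub_le {p : ℕ} [Fact p.Prime] {a b : ℚ_[p]} {t : ℝ} (ha : ‖a‖ ≤ t) (hb : ‖b‖ ≤ t) :
    ‖a - b‖ ≤ t := by rw [sub_eq_add_neg]; exact padic_add_le ha (by rwa [norm_neg])
lemma padic_mul_le {p : ℕ} [Fact p.Prime] {a b : ℚ_[p]} {s t : ℝ} (ha : ‖a‖ ≤ s) (hb : ‖b‖ ≤ t) :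
    ‖a * b‖ ≤ s * t := by
  rw [norm_mul]; exact mul_le_mul ha hb (norm_nonneg _) ((norm_nonneg _).trans ha)

lemma padic_pigeon {p : ℕ} [hp : Fact p.Prime] (N : ℕ) (a b : Fin 4 → ℤ_[p]) :
    ∃ z : Fin 4 → ℤ, z ≠ 0 ∧ (∀ i, z i ^ 2 ≤ (p : ℤ) ^ N) ∧
      ‖∑ i, a i * (z i : ℤ_[p])‖ ≤ (p : ℝ) ^ (-(N : ℤ)) ∧
      ‖∑ i, b i * (z i : ℤ_[p])‖ ≤ (p : ℝ) ^ (-(N : ℤ)) := by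
  set s := Nat.sqrt (p ^ N) with hs
  have : NeZero (p ^ N) := ⟨pow_ne_zero _ hp.out.ne_zero⟩
  let f : (Fin 4 → Fin (s + 1)) → ZMod (p ^ N) × ZMod (p ^ N) := fun t =>
    (PadicInt.toZModPow N (∑ i, a i * ((t i : ℕ) : ℤ_[p])),
     PadicInt.toZModPow N (∑ i, b i * ((t i : ℕ) : ℤ_[p])))
  obtain ⟨t, t', hne, hf⟩ := Fintype.exists_ne_map_eq_of_card_lt f (by
    simp only [Fintype.card_prod, ZMod.card, Fintype.card_pi, Fintype.card_fin, Finset.prod_const, Finset.card_univ]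
    have h := Nat.lt_succ_sqrt' (p ^ N)
    have h' : p ^ N < (s + 1) ^ 2 := h
    calc p ^ N * p ^ N < (s + 1) ^ 2 * (s + 1) ^ 2 := Nat.mul_lt_mul'' h' h'
      _ = _ := by ring)
  refine ⟨fun i => ((t i : ℕ) : ℤ) - ((t' i : ℕ) : ℤ), ?_, ?_, ?_, ?_⟩
  · intro h0
    apply hne
    funext i
    have := congrFun h0 i
    simp only [Pi.zero_apply] at this
    apply Fin.ext
    omega
  · intro i
    have h1 := (t i).2
    have h2 := (t' i).2
    have h3 : s ^ 2 ≤ p ^ N := Nat.sqrt_le' _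
    have h4 : |((t i : ℕ) : ℤ) - ((t' i : ℕ) : ℤ)| ≤ s := by rw [abs_le]; constructor <;> omega
    calc _ ≤ (s : ℤ) ^ 2 := sq_le_sq' (abs_le.mp h4).1 (abs_le.mp h4).2
      _ ≤ _ := by exact_mod_cast h3
  · simp only [f, Prod.mk.injEq] at hf
    have : (∑ i, a i * (((((t i : ℕ) : ℤ) - ((t' i : ℕ) : ℤ) : ℤ)) : ℤ_[p])) ∈ RingHom.ker (PadicInt.toZModPow (p := p) N) := by
      rw [RingHom.mem_ker]
      have : (∑ i, a i * (((((t i : ℕ) : ℤ) - ((t' i : ℕ) : ℤ) : ℤ)) : ℤ_[p])) =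
        (∑ i, a i * ((t i : ℕ) : ℤ_[p])) - (∑ i, a i * ((t' i : ℕ) : ℤ_[p])) := by
        rw [← Finset.sum_sub_distrib]; push_cast; exact Finset.sum_congr rfl fun i _ => by ring
      rw [this, map_sub, hf.1, sub_self]
    rw [PadicInt.ker_toZModPow] at this
    exact (PadicInt.norm_le_pow_iff_mem_span_pow _ _).mpr this
  · simp only [f, Prod.mk.injEq] at hf
    have : (∑ i, b i * (((((t i : ℕ) : ℤ) - ((t' i : ℕ) : ℤ) : ℤ)) : ℤ_[p])) ∈ RingHom.ker (PadicInt.toZModPow (p := p) N) := by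
      rw [RingHom.mem_ker]
      have : (∑ i, b i * (((((t i : ℕ) : ℤ) - ((t' i : ℕ) : ℤ) : ℤ)) : ℤ_[p])) =
        (∑ i, b i * ((t i : ℕ) : ℤ_[p])) - (∑ i, b i * ((t' i : ℕ) : ℤ_[p])) := by
        rw [← Finset.sum_sub_distrib]; push_cast; exact Finset.sum_congr rfl fun i _ => by ring
      rw [this, map_sub, hf.2, sub_self]
    rw [PadicInt.ker_toZModPow] at this
    exact (PadicInt.norm_le_pow_iff_mem_span_pow _ _).mpr this

namespace OO
variable {α β : ℕ} {p : ℕ} [hp : Fact p.Prime]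

/-- divisibility by an integer in the order -/
def dv (k : ℤ) (q : OO α β) : Prop := ∃ w, q = sc k w

def eA (x y : ℚ_[p]) (q : OO α β) : ℚ_[p] := q.re + x * q.imJ - α * y * q.imK
def eB (x y : ℚ_[p]) (q : OO α β) : ℚ_[p] := -(α * q.imI) + α * y * q.imJ + α * x * q.imK
def eC (x y : ℚ_[p]) (q : OO α β) : ℚ_[p] := q.imI + y * q.imJ + x * q.imK
def eD (x y : ℚ_[p]) (q : OO α β) : ℚ_[p] := q.re - x * q.imJ + α * y * q.imK

def smallpi (x y : ℚ_[p]) (t : ℝ) (q : OO α β) : Prop :=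
  ‖eA x y q‖ ≤ t ∧ ‖eB x y q‖ ≤ t ∧ ‖eC x y q‖ ≤ t ∧ ‖eD x y q‖ ≤ t

variable (p) in
def small (t : ℝ) (q : OO α β) : Prop :=
  ‖(q.re : ℚ_[p])‖ ≤ t ∧ ‖(q.imI : ℚ_[p])‖ ≤ t ∧ ‖(q.imJ : ℚ_[p])‖ ≤ t ∧ ‖(q.imK : ℚ_[p])‖ ≤ t

lemma small_one (q : OO α β) : small p 1 q :=
  ⟨Padic.norm_int_le_one _, Padic.norm_int_le_one _, Padic.norm_int_le_one _, Padic.norm_int_le_one _⟩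

lemma small_iff_dv (n : ℕ) (q : OO α β) : small p ((p : ℝ) ^ (-(n : ℤ))) q ↔ dv ((p : ℤ) ^ n) q := by
  unfold small
  simp only [Padic.norm_int_le_pow_iff_dvd]
  push_cast
  constructor
  · rintro ⟨⟨a, ha⟩, ⟨b, hb⟩, ⟨c, hc⟩, ⟨d, hd⟩⟩
    exact ⟨⟨a, b, c, d⟩, by ext <;> simp [ha, hb, hc, hd]⟩
  · rintro ⟨w, rfl⟩
    exact ⟨⟨_, rfl⟩, ⟨_, rfl⟩, ⟨_, rfl⟩, ⟨_, rfl⟩⟩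

section
variable {x y : ℚ_[p]} 

lemma eA_mul (h : x ^ 2 + α * y ^ 2 = -(β : ℚ_[p])) (q r : OO α β) : eA x y (q * r) = eA x y q * eA x y r + eB x y q * eC x y r := by
  simp [eA, eB, eC]
  linear_combination -((q.imJ : ℚ_[p]) * r.imJ + α * q.imK * r.imK) * h
lemma eB_mul (h : x ^ 2 + α * y ^ 2 = -(β : ℚ_[p])) (q r : OO α β) : eB x y (q * r) = eA x y q * eB x y r + eB x y q * eD x y r := by
  simp [eA, eB, eD]
  linear_combination (α * ((q.imK : ℚ_[p]) * r.imJ - q.imJ * r.imK)) * h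
lemma eC_mul (h : x ^ 2 + α * y ^ 2 = -(β : ℚ_[p])) (q r : OO α β) : eC x y (q * r) = eC x y q * eA x y r + eD x y q * eC x y r := by
  simp [eA, eC, eD]
  linear_combination -((q.imK : ℚ_[p]) * r.imJ - q.imJ * r.imK) * h
lemma eD_mul (h : x ^ 2 + α * y ^ 2 = -(β : ℚ_[p])) (q r : OO α β) : eD x y (q * r) = eC x y q * eB x y r + eD x y q * eD x y r := by
  simp [eB, eC, eD]
  linear_combination -((q.imJ : ℚ_[p]) * r.imJ + α * q.imK * r.imK) * h
lemma e_det (h : x ^ 2 + α * y ^ 2 = -(β : ℚ_[p])) (q : OO α β) : eA x y q * eD x y q - eB x y q * eC x y q = (nm q : ℤ) := by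
  simp [eA, eB, eC, eD, nm]
  linear_combination -((q.imJ : ℚ_[p]) ^ 2 + α * q.imK ^ 2) * h
lemma eA_star (q : OO α β) : eA x y (star q) = eD x y q := by simp [eA, eD]; ring
lemma eB_star (q : OO α β) : eB x y (star q) = -eB x y q := by simp [eB]; ring
lemma eC_star (q : OO α β) : eC x y (star q) = -eC x y q := by simp [eC]; ring
lemma eD_star (q : OO α β) : eD x y (star q) = eA x y q := by simp [eA, eD]; ring
end

lemma pi_le (x y : ℚ_[p]) : ∃ K : ℝ, 1 ≤ K ∧ ∀ (q : OO α β) (t : ℝ), small p t q → smallpi x y (K * t) q := by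
  refine ⟨max 1 (max ‖x‖ ‖y‖), le_max_left _ _, fun q t ⟨h0, h1, h2, h3⟩ => ?_⟩
  set K := max 1 (max ‖x‖ ‖y‖)
  have hK1 : ‖(1 : ℚ_[p])‖ ≤ K := by simp [K]
  have hKx : ‖x‖ ≤ K := by simp [K]
  have hKy : ‖y‖ ≤ K := by simp [K]
  have hα : ‖(α : ℚ_[p])‖ ≤ 1 := Padic.norm_int_le_one (α : ℤ)
  have hKα : ‖(α : ℚ_[p])‖ ≤ K := hα.trans (le_max_left _ _)
  have hαx : ‖(α : ℚ_[p]) * x‖ ≤ K := by simpa using padic_mul_le hα hKx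
  have hαy : ‖(α : ℚ_[p]) * y‖ ≤ K := by simpa using padic_mul_le hα hKy
  have g0 : ‖(q.re : ℚ_[p])‖ ≤ K * t := by simpa using padic_mul_le hK1 h0
  have g1 : ‖(q.imI : ℚ_[p])‖ ≤ K * t := by simpa using padic_mul_le hK1 h1
  refine ⟨?_, ?_, ?_, ?_⟩
  · exact padic_sub_le (padic_add_le g0 (padic_mul_le hKx h2)) (padic_mul_le hαy h3)
  · exact padic_add_le (padic_add_le (by rw [norm_neg]; exact padic_mul_le hKα h1) (padic_mul_le hαy h2)) (padic_mul_le hαx h3)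
  · exact padic_add_le (padic_add_le g1 (padic_mul_le hKy h2)) (padic_mul_le hKx h3)
  · exact padic_add_le (padic_sub_le g0 (padic_mul_le hKx h2)) (padic_mul_le hαy h3)

lemma le_pi (hα : 0 < α) (hβ : 0 < β) (x y : ℚ_[p]) (h : x ^ 2 + α * y ^ 2 = -(β : ℚ_[p])) :
    ∃ K : ℝ, 1 ≤ K ∧ ∀ (q : OO α β) (t : ℝ), smallpi x y t q → small p (K * t) q := by
  have hα0 : (α : ℚ_[p]) ≠ 0 := by exact_mod_cast hα.ne'
  have hβ0 : (β : ℚ_[p]) ≠ 0 := by exact_mod_cast hβ.ne'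
  set d : ℚ_[p] := (2 * α * β)⁻¹
  set L : ℝ := max 1 (max ‖x‖ ‖y‖)
  have hL1 : ‖(1 : ℚ_[p])‖ ≤ L := by simp [L]
  have hL1' : 1 ≤ L := le_max_left _ _
  have hLx : ‖x‖ ≤ L := by simp [L]
  have hLy : ‖y‖ ≤ L := by simp [L]
  have hIntg : ∀ k : ℕ, ‖(k : ℚ_[p])‖ ≤ 1 := fun k => Padic.norm_int_le_one (k : ℤ)
  have key : ∀ (t : ℝ) (u v w c : ℚ_[p]), 0 ≤ t → ‖u‖ ≤ L * t → ‖v‖ ≤ L * t → c = d * (u + v) → ‖c‖ ≤ (1 + ‖d‖) * L * t := by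
    intro t u v w c ht hu hv hc
    rw [hc, norm_mul]
    have := padic_add_le hu hv
    have : ‖d‖ * ‖u + v‖ ≤ ‖d‖ * (L * t) := by gcongr
    have : 0 ≤ L * t := by positivity
    nlinarith
  refine ⟨(1 + ‖d‖) * L, by nlinarith [norm_nonneg d], fun q t ⟨hA, hB, hC, hD⟩ => ?_⟩
  have ht : 0 ≤ t := (norm_nonneg _).trans hA
  have mulk : ∀ (k : ℕ) (a b : ℚ_[p]), ‖a‖ ≤ L → ‖b‖ ≤ t → ‖(k : ℚ_[p]) * a * b‖ ≤ L * t := by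
    intro k a b ha hb
    have := padic_mul_le (padic_mul_le (hIntg k) ha) hb
    rwa [one_mul] at this
  have hp0 : p ≠ 0 := hp.out.ne_zero
  have hd : d * (2 * α * β) = 1 := inv_mul_cancel₀ (by simp [hα0, hβ0])
  refine ⟨?_, ?_, ?_, ?_⟩
  · refine key t ((α * β : ℕ) * 1 * eA x y q) ((α * β : ℕ) * 1 * eD x y q) 0 _ ht (mulk _ _ _ hL1 hA) (mulk _ _ _ hL1 hD) ?_
    simp only [eA, eD]; push_cast
    linear_combination -(q.re : ℚ_[p]) * hd
  · refine key t (-((β : ℕ) * 1 * eB x y q)) ((α * β : ℕ) * 1 * eC x y q) 0 _ ht (by rw [norm_neg]; exact mulk _ _ _ hL1 hB) (mulk _ _ _ hL1 hC) ?_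
    simp only [eB, eC]; push_cast
    linear_combination -(q.imI : ℚ_[p]) * hd
  · refine key t (-((α : ℕ) * x * (eA x y q - eD x y q))) (-((α : ℕ) * y * (eB x y q + α * eC x y q))) 0 _ ht 
      (by rw [norm_neg]; exact mulk _ _ _ hLx (padic_sub_le hA hD)) (by rw [norm_neg]; exact mulk _ _ _ hLy (padic_add_le hB (by simpa using padic_mul_le (hIntg α) hC))) ?_
    simp only [eA, eB, eC, eD]; push_cast
    linear_combination -(q.imJ : ℚ_[p]) * hd + 2 * α * d * q.imJ * h
  · refine key t (-((1 : ℕ) * x * (eB x y q + α * eC x y q))) ((α : ℕ) * y * (eA x y q - eD x y q)) 0 _ ht 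
      (by rw [norm_neg]; exact mulk _ _ _ hLx (padic_add_le hB (by simpa using padic_mul_le (hIntg α) hC))) (mulk _ _ _ hLy (padic_sub_le hA hD)) ?_
    simp only [eA, eB, eC, eD]; push_cast
    linear_combination -(q.imK : ℚ_[p]) * hd + 2 * α * d * q.imK * h

end OO
end

noncomputable section
namespace OO
variable {α β : ℕ} {p : ℕ} [hp : Fact p.Prime]

lemma exists_pow_ge (K : ℝ) : ∃ c : ℕ, K ≤ (p : ℝ) ^ c := by
  have : (1 : ℝ) < p := by exact_mod_cast hp.out.one_lt
  obtain ⟨c, hc⟩ := pow_unbounded_of_one_lt K this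
  exact ⟨c, hc.le⟩

lemma padic_pigeon' (N : ℕ) (a b : Fin 4 → ℚ_[p]) (ha : ∀ i, ‖a i‖ ≤ 1) (hb : ∀ i, ‖b i‖ ≤ 1) :
    ∃ z : Fin 4 → ℤ, z ≠ 0 ∧ (∀ i, z i ^ 2 ≤ (p : ℤ) ^ N) ∧
      ‖∑ i, a i * (z i : ℚ_[p])‖ ≤ (p : ℝ) ^ (-(N : ℤ)) ∧
      ‖∑ i, b i * (z i : ℚ_[p])‖ ≤ (p : ℝ) ^ (-(N : ℤ)) := by
  obtain ⟨z, h0, h1, h2, h3⟩ := padic_pigeon (p := p) N (fun i => ⟨a i, ha i⟩) (fun i => ⟨b i, hb i⟩)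
  refine ⟨z, h0, h1, ?_, ?_⟩
  · rw [← PadicInt.padic_norm_e_of_padicInt, PadicInt.coe_sum] at h2
    exact h2
  · rw [← PadicInt.padic_norm_e_of_padicInt, PadicInt.coe_sum] at h3
    exact h3

lemma pigeon (x y : ℚ_[p]) : ∃ C : ℝ, 1 ≤ C ∧ ∀ (n : ℕ) (v1 v2 : ℚ_[p]), ‖v1‖ ≤ 1 → ‖v2‖ ≤ 1 →
    ∃ q : OO α β, q ≠ 0 ∧ (nm q : ℝ) ≤ C * (p : ℝ) ^ n ∧
      ‖v1 * eA x y q + v2 * eC x y q‖ ≤ (p : ℝ) ^ (-(n : ℤ)) ∧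
      ‖v1 * eB x y q + v2 * eD x y q‖ ≤ (p : ℝ) ^ (-(n : ℤ)) := by
  have hp1 : (1 : ℝ) < p := by exact_mod_cast hp.out.one_lt
  have hp0 : (0 : ℝ) < p := by linarith
  set K : ℝ := max 1 (max ‖x‖ ‖y‖)
  obtain ⟨c, hc⟩ := exists_pow_ge (p := p) K
  have hK1 : 1 ≤ K := le_max_left _ _
  have hKx : ‖x‖ ≤ K := by simp [K]
  have hKy : ‖y‖ ≤ K := by simp [K]
  have hα : ‖(α : ℚ_[p])‖ ≤ 1 := Padic.norm_int_le_one (α : ℤ)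
  refine ⟨(1 + α + β + α * β) * (p : ℝ) ^ c, ?_, fun n v1 v2 h1 h2 => ?_⟩
  · have := one_le_pow₀ hp1.le (n := c)
    have : (0 : ℝ) ≤ α := by positivity
    have : (0 : ℝ) ≤ β := by positivity
    have : (0 : ℝ) ≤ α * β := by positivity
    nlinarith
  have up : ∀ a : ℚ_[p], ‖a‖ ≤ K → ‖(p : ℚ_[p]) ^ c * a‖ ≤ 1 := by
    intro a ha
    rw [norm_mul, norm_pow, Padic.norm_p, inv_pow]
    rw [inv_mul_le_iff₀ (by positivity)]
    linarith
  have hx1 : ‖v1 * x‖ ≤ K := by simpa using padic_mul_le h1 hKx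
  have hx2 : ‖v2 * x‖ ≤ K := by simpa using padic_mul_le h2 hKx
  have hy1 : ‖v1 * y‖ ≤ K := by simpa using padic_mul_le h1 hKy
  have hy2 : ‖v2 * y‖ ≤ K := by simpa using padic_mul_le h2 hKy
  have ha1 : ‖(α : ℚ_[p]) * v1‖ ≤ K := (by simpa using padic_mul_le hα h1 : _ ≤ (1 : ℝ)).trans hK1
  have hax1 : ‖(α : ℚ_[p]) * (v1 * x)‖ ≤ K := by simpa using padic_mul_le hα hx1
  have hay1 : ‖(α : ℚ_[p]) * (v1 * y)‖ ≤ K := by simpa using padic_mul_le hα hy1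
  have hay2 : ‖(α : ℚ_[p]) * (v2 * y)‖ ≤ K := by simpa using padic_mul_le hα hy2
  obtain ⟨z, hz0, hzb, hz1, hz2⟩ := padic_pigeon' (p := p) (n + c)
    ![(p : ℚ_[p]) ^ c * v1, (p : ℚ_[p]) ^ c * v2, (p : ℚ_[p]) ^ c * (v1 * x + v2 * y),
      (p : ℚ_[p]) ^ c * (v2 * x - α * (v1 * y))]
    ![(p : ℚ_[p]) ^ c * v2, (p : ℚ_[p]) ^ c * (-(α * v1)), (p : ℚ_[p]) ^ c * (α * (v1 * y) - v2 * x),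
      (p : ℚ_[p]) ^ c * (α * (v1 * x) + α * (v2 * y))]
    (by
      intro i
      fin_cases i
      exacts [up _ (h1.trans hK1), up _ (h2.trans hK1), up _ (padic_add_le hx1 hy2), up _ (padic_sub_le hx2 hay1)])
    (by
      intro i
      fin_cases i
      exacts [up _ (h2.trans hK1), up _ (by rw [norm_neg]; exact ha1), up _ (padic_sub_le hay1 hx2), up _ (padic_add_le hax1 hay2)])
  have down : ∀ a : ℚ_[p], ‖(p : ℚ_[p]) ^ c * a‖ ≤ (p : ℝ) ^ (-((n + c : ℕ) : ℤ)) → ‖a‖ ≤ (p : ℝ) ^ (-(n : ℤ)) := by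
    intro a ha
    rw [norm_mul, norm_pow, Padic.norm_p, inv_pow, inv_mul_le_iff₀ (by positivity), ← zpow_natCast, ← zpow_add₀ hp0.ne'] at ha
    have e : (c : ℤ) + -((n + c : ℕ) : ℤ) = -(n : ℤ) := by push_cast; ring
    rwa [e] at ha
  refine ⟨⟨z 0, z 1, z 2, z 3⟩, ?_, ?_, ?_, ?_⟩
  · intro h
    apply hz0
    have e0 := congrArg QuaternionAlgebra.re h
    have e1 := congrArg QuaternionAlgebra.imI h
    have e2 := congrArg QuaternionAlgebra.imJ h
    have e3 := congrArg QuaternionAlgebra.imK h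
    simp only [QuaternionAlgebra.re_zero, QuaternionAlgebra.imI_zero, QuaternionAlgebra.imJ_zero, QuaternionAlgebra.imK_zero] at e0 e1 e2 e3
    funext i
    fin_cases i <;> assumption
  · have hb : ∀ i, ((z i : ℤ) : ℝ) ^ 2 ≤ (p : ℝ) ^ (n + c) := fun i => by exact_mod_cast hzb i
    simp only [nm]
    push_cast
    calc (z 0 : ℝ) ^ 2 + α * (z 1 : ℝ) ^ 2 + β * (z 2 : ℝ) ^ 2 + α * β * (z 3 : ℝ) ^ 2
        ≤ (p : ℝ) ^ (n + c) + α * (p : ℝ) ^ (n + c) + β * (p : ℝ) ^ (n + c) + α * β * (p : ℝ) ^ (n + c) := by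
          gcongr <;> exact hb _
      _ = _ := by rw [pow_add]; ring
  · apply down
    convert hz1 using 2
    simp [Fin.sum_univ_four, eA, eC]
    ring
  · apply down
    convert hz2 using 2
    simp [Fin.sum_univ_four, eB, eD]
    ring

lemma adj_small {x y : ℚ_[p]} (h : x ^ 2 + α * y ^ 2 = -(β : ℚ_[p])) {K s t : ℝ} (q r : OO α β)
    (hq : smallpi x y K q) (hr : smallpi x y K r) (v1 v2 : ℚ_[p]) (hv : v1 = 1 ∨ v2 = 1) (hst : s ≤ t)
    (q1 : ‖v1 * eA x y q + v2 * eC x y q‖ ≤ s) (q2 : ‖v1 * eB x y q + v2 * eD x y q‖ ≤ s)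
    (r1 : ‖v1 * eA x y r + v2 * eC x y r‖ ≤ t) (r2 : ‖v1 * eB x y r + v2 * eD x y r‖ ≤ t) :
    smallpi x y (K * t) (star q * r) := by
  obtain ⟨qa, qb, qc, qd⟩ := hq
  obtain ⟨ra, rb, rc, rd⟩ := hr
  have q1 := q1.trans hst
  have q2 := q2.trans hst
  unfold smallpi
  rw [eA_mul h, eB_mul h, eC_mul h, eD_mul h, eA_star, eB_star, eC_star, eD_star]
  rcases hv with rfl | rfl
  · refine ⟨?_, ?_, ?_, ?_⟩
    · convert padic_sub_le (padic_mul_le qd r1) (padic_mul_le rc q2) using 2; ring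
    · convert padic_sub_le (padic_mul_le qd r2) (padic_mul_le rd q2) using 2; ring
    · convert padic_sub_le (padic_mul_le rc q1) (padic_mul_le qc r1) using 2; ring
    · convert padic_sub_le (padic_mul_le rd q1) (padic_mul_le qc r2) using 2; ring
  · refine ⟨?_, ?_, ?_, ?_⟩
    · convert padic_sub_le (padic_mul_le ra q2) (padic_mul_le qb r1) using 2; ring
    · convert padic_sub_le (padic_mul_le rb q2) (padic_mul_le qb r2) using 2; ring
    · convert padic_sub_le (padic_mul_le qa r1) (padic_mul_le ra q1) using 2; ring
    · convert padic_sub_le (padic_mul_le qa r2) (padic_mul_le rb q1) using 2; ring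

lemma count_vec (hα : 0 < α) (hβ : 0 < β) (x y : ℚ_[p]) (h : x ^ 2 + α * y ^ 2 = -(β : ℚ_[p]))
    (T δ : ℝ) (hδ : 0 < δ) : ∃ C : ℝ, 1 ≤ C ∧ ∀ (m n : ℕ) (v1 v2 : ℚ_[p]) (s : Finset (OO α β)), n ≤ m →
    ‖v1‖ ≤ 1 → ‖v2‖ ≤ 1 → (v1 = 1 ∨ v2 = 1) → (∀ q ∈ s, nm q = (p : ℤ) ^ m ∧
      ‖v1 * eA x y q + v2 * eC x y q‖ ≤ T * (p : ℝ) ^ (-(n : ℤ)) ∧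
      ‖v1 * eB x y q + v2 * eD x y q‖ ≤ T * (p : ℝ) ^ (-(n : ℤ))) →
    (s.card : ℝ) ≤ C * (p : ℝ) ^ (m - n) * (p : ℝ) ^ (δ * m) := by
  have hp1 : (1 : ℝ) < p := by exact_mod_cast hp.out.one_lt
  have hp0 : (0 : ℝ) < p := by linarith
  have hp0' : (0 : ℤ) < p := by exact_mod_cast hp.out.pos
  obtain ⟨C1, hC11, hC1⟩ := pigeon (α := α) (β := β) x y
  obtain ⟨C2, hC21, hC2⟩ := count_nm hα hβ δ hδ
  obtain ⟨K, hK1, hK⟩ := pi_le (α := α) (β := β) x y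
  obtain ⟨K', hK'1, hK'⟩ := le_pi hα hβ x y h
  obtain ⟨c, hc⟩ := exists_pow_ge (p := p) (K' * (K * max T 1))
  refine ⟨C2 * (p : ℝ) ^ c + C2 * (C1 * (p : ℝ) ^ (2 * c)) ^ (1 + δ), ?_, fun m n v1 v2 s hnm h1 h2 hv hs => ?_⟩
  · have := one_le_pow₀ hp1.le (n := c)
    have : 0 ≤ C2 * (C1 * (p : ℝ) ^ (2 * c)) ^ (1 + δ) := by positivity
    nlinarith
  by_cases hcn : n ≤ c
  · have := hC2 ((p : ℤ) ^ m) s (one_le_pow₀ (by omega)) (fun q hq => (hs q hq).1)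
    refine this.trans ?_
    rw [add_mul, add_mul]
    refine le_add_of_le_of_nonneg ?_ (by positivity)
    push_cast
    rw [Real.rpow_add (by positivity), Real.rpow_one]
    have e1 : (p : ℝ) ^ m ≤ (p : ℝ) ^ c * (p : ℝ) ^ (m - n) := by
      rw [← pow_add]; exact pow_le_pow_right₀ hp1.le (by omega)
    have e2 : ((p : ℝ) ^ m) ^ δ = (p : ℝ) ^ (δ * m) := by
      rw [← Real.rpow_natCast, ← Real.rpow_mul hp0.le, mul_comm]
    rw [e2]
    calc C2 * ((p : ℝ) ^ m * (p : ℝ) ^ (δ * m)) ≤ C2 * (((p : ℝ) ^ c * (p : ℝ) ^ (m - n)) * (p : ℝ) ^ (δ * m)) := by gcongr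
      _ = _ := by ring
  push Not at hcn
  rcases s.eq_empty_or_nonempty with rfl | ⟨q1, hq1⟩
  · simp; positivity
  obtain ⟨qs, hqs0, hqsN, hqs1, hqs2⟩ := hC1 n v1 v2 h1 h2
  have hN0 : 0 < nm qs := nm_pos hα hβ hqs0
  have hdv : ∀ q ∈ s, dv ((p : ℤ) ^ (n - c)) (star qs * q) := by
    intro q hq
    obtain ⟨_, e1, e2⟩ := hs q hq
    rw [← small_iff_dv]
    have hpn : 0 < (p : ℝ) ^ (-(n : ℤ)) := by positivity
    have hle : (p : ℝ) ^ (-(n : ℤ)) ≤ max T 1 * (p : ℝ) ^ (-(n : ℤ)) := by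
      have := le_max_right T 1; nlinarith
    have hle2 : T * (p : ℝ) ^ (-(n : ℤ)) ≤ max T 1 * (p : ℝ) ^ (-(n : ℤ)) := by
      have := le_max_left T 1; nlinarith
    have sp := adj_small h qs q (by simpa using hK qs 1 (small_one qs)) (by simpa using hK q 1 (small_one q)) v1 v2 hv hle hqs1 hqs2 (e1.trans hle2) (e2.trans hle2)
    have sm := hK' _ _ sp
    have : K' * (K * (max T 1 * (p : ℝ) ^ (-(n : ℤ)))) ≤ (p : ℝ) ^ (-((n - c : ℕ) : ℤ)) := by
      calc _ = (K' * (K * max T 1)) * (p : ℝ) ^ (-(n : ℤ)) := by ring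
        _ ≤ (p : ℝ) ^ c * (p : ℝ) ^ (-(n : ℤ)) := by gcongr
        _ = _ := by
          rw [← zpow_natCast, ← zpow_add₀ hp0.ne']
          congr 1
          push_cast [hcn.le]; ring
    exact ⟨sm.1.trans this, sm.2.1.trans this, sm.2.2.1.trans this, sm.2.2.2.trans this⟩
  classical
  choose! w hw using hdv
  have hinj : Set.InjOn w s := by
    intro q hq r hr e
    have : star qs * q = star qs * r := by rw [hw q hq, hw r hr, e]
    have := congrArg (qs * ·) this
    simp only [mul_star_cancel] at this
    exact sc_inj hN0.ne' this
  have hwN : ∀ q ∈ s, (p : ℤ) ^ (2 * (n - c)) * nm (w q) = nm qs * (p : ℤ) ^ m := by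
    intro q hq
    have := congrArg nm (hw q hq)
    rw [nm_mul, nm_star, nm_sc, (hs q hq).1, ← pow_mul, mul_comm _ 2] at this
    exact this.symm
  have hall : ∀ q ∈ s, nm (w q) = nm (w q1) := by
    intro q hq
    have := (hwN q hq).trans (hwN q1 hq1).symm
    exact mul_left_cancel₀ (by positivity) this
  have hpos : 1 ≤ nm (w q1) := by
    have : 0 < (p : ℤ) ^ (2 * (n - c)) * nm (w q1) := by rw [hwN q1 hq1]; positivity
    exact pos_of_mul_pos_right this (by positivity)
  rw [← Finset.card_image_of_injOn hinj]
  refine (hC2 (nm (w q1)) _ hpos ?_).trans ?_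
  · intro r hr
    obtain ⟨q, hq, rfl⟩ := Finset.mem_image.mp hr
    exact hall q hq
  have hbd : (nm (w q1) : ℝ) ≤ C1 * (p : ℝ) ^ (2 * c) * (p : ℝ) ^ (m - n) := by
    have e : (p : ℝ) ^ (2 * (n - c)) * (nm (w q1) : ℝ) = nm qs * (p : ℝ) ^ m := by exact_mod_cast hwN q1 hq1
    have : (p : ℝ) ^ (2 * (n - c)) * (nm (w q1) : ℝ) ≤ (p : ℝ) ^ (2 * (n - c)) * (C1 * (p : ℝ) ^ (2 * c) * (p : ℝ) ^ (m - n)) := by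
      rw [e]
      calc _ ≤ C1 * (p : ℝ) ^ n * (p : ℝ) ^ m := by gcongr
        _ = _ := by
          have : (p : ℝ) ^ n * (p : ℝ) ^ m = (p : ℝ) ^ (2 * (n - c)) * (p : ℝ) ^ (2 * c) * (p : ℝ) ^ (m - n) := by
            rw [← pow_add, ← pow_add, ← pow_add]; congr 1; omega
          rw [mul_assoc, this]; ring
    exact le_of_mul_le_mul_left this (by positivity)
  have hw0 : (0 : ℝ) ≤ nm (w q1) := by exact_mod_cast (by omega : 0 ≤ nm (w q1))
  calc C2 * (nm (w q1) : ℝ) ^ (1 + δ) ≤ C2 * (C1 * (p : ℝ) ^ (2 * c) * (p : ℝ) ^ (m - n)) ^ (1 + δ) := by gcongr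
    _ = C2 * (C1 * (p : ℝ) ^ (2 * c)) ^ (1 + δ) * ((p : ℝ) ^ (m - n)) ^ (1 + δ) := by
      rw [Real.mul_rpow (by positivity) (by positivity)]; ring
    _ ≤ C2 * (C1 * (p : ℝ) ^ (2 * c)) ^ (1 + δ) * ((p : ℝ) ^ (m - n) * (p : ℝ) ^ (δ * m)) := by
      gcongr
      rw [Real.rpow_add (by positivity), Real.rpow_one]
      gcongr
      rw [← Real.rpow_natCast, ← Real.rpow_mul hp0.le, mul_comm]
      apply Real.rpow_le_rpow_of_exponent_le hp1.le
      gcongr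
      omega
    _ ≤ (C2 * (p : ℝ) ^ c + C2 * (C1 * (p : ℝ) ^ (2 * c)) ^ (1 + δ)) * ((p : ℝ) ^ (m - n) * (p : ℝ) ^ (δ * m)) := by
      gcongr
      have : 0 ≤ C2 * (p : ℝ) ^ c := by positivity
      linarith
    _ = _ := by ring

lemma count_row (hα : 0 < α) (hβ : 0 < β) (x y : ℚ_[p]) (h : x ^ 2 + α * y ^ 2 = -(β : ℚ_[p]))
    (δ : ℝ) (hδ : 0 < δ) : ∃ C : ℝ, 1 ≤ C ∧ ∀ (m n : ℕ) (P : OO α β) (s : Finset (OO α β)), n ≤ m →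
    ¬ dv p P → (∀ q ∈ s, nm q = (p : ℤ) ^ m ∧ dv ((p : ℤ) ^ n) (P * q)) →
    (s.card : ℝ) ≤ C * (p : ℝ) ^ (m - n) * (p : ℝ) ^ (δ * m) := by
  have hp1 : (1 : ℝ) < p := by exact_mod_cast hp.out.one_lt
  have hp0 : (0 : ℝ) < p := by linarith
  obtain ⟨K, hK1, hK⟩ := pi_le (α := α) (β := β) x y
  obtain ⟨K', hK'1, hK'⟩ := le_pi hα hβ x y h
  obtain ⟨C, hC1, hC⟩ := count_vec hα hβ x y h (K * (K' * p)) δ hδ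
  refine ⟨C, hC1, fun m n P s hnm hP hs => ?_⟩
  -- a row with a large entry
  have hnot : ¬ smallpi x y ((K' * p)⁻¹) P := by
    intro hsm
    apply hP
    have := hK' _ _ hsm
    have e : K' * (K' * p)⁻¹ = (p : ℝ) ^ (-((1 : ℕ) : ℤ)) := by simp; field_simp
    rw [e, small_iff_dv] at this
    simpa using this
  have fin : ∀ V1 V2 V : ℚ_[p], (V = V1 ∨ V = V2) → ‖V1‖ ≤ ‖V‖ → ‖V2‖ ≤ ‖V‖ → (K' * p)⁻¹ < ‖V‖ →
      (∀ q ∈ s, ‖V1 * eA x y q + V2 * eC x y q‖ ≤ K * (p : ℝ) ^ (-(n : ℤ)) ∧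
        ‖V1 * eB x y q + V2 * eD x y q‖ ≤ K * (p : ℝ) ^ (-(n : ℤ))) →
      (s.card : ℝ) ≤ C * (p : ℝ) ^ (m - n) * (p : ℝ) ^ (δ * m) := by
    intro V1 V2 V hV l1 l2 hlt hall
    have hVpos : 0 < ‖V‖ := lt_trans (by positivity) hlt
    have hV0 : V ≠ 0 := norm_pos_iff.mp hVpos
    have hinv : ‖V‖⁻¹ ≤ K' * p := by
      rw [inv_le_comm₀ hVpos (by positivity)]; exact hlt.le
    have red : ∀ z : ℚ_[p], ‖z‖ ≤ K * (p : ℝ) ^ (-(n : ℤ)) → ‖z / V‖ ≤ (K * (K' * p)) * (p : ℝ) ^ (-(n : ℤ)) := by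
      intro z hz
      rw [norm_div, div_eq_mul_inv]
      calc ‖z‖ * ‖V‖⁻¹ ≤ (K * (p : ℝ) ^ (-(n : ℤ))) * (K' * p) := by gcongr
        _ = _ := by ring
    refine hC m n (V1 / V) (V2 / V) s hnm ?_ ?_ ?_ ?_
    · rw [norm_div]; exact div_le_one_of_le₀ l1 (norm_nonneg _)
    · rw [norm_div]; exact div_le_one_of_le₀ l2 (norm_nonneg _)
    · rcases hV with rfl | rfl
      · left; exact div_self hV0
      · right; exact div_self hV0
    · intro q hq
      refine ⟨(hs q hq).1, ?_, ?_⟩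
      · have := red _ (hall q hq).1
        convert this using 2; ring
      · have := red _ (hall q hq).2
        convert this using 2; ring
  have hrow1 : ∀ q ∈ s, ‖eA x y P * eA x y q + eB x y P * eC x y q‖ ≤ K * (p : ℝ) ^ (-(n : ℤ)) ∧
        ‖eA x y P * eB x y q + eB x y P * eD x y q‖ ≤ K * (p : ℝ) ^ (-(n : ℤ)) := by
    intro q hq
    have := hK _ _ ((small_iff_dv (p := p) n (P * q)).mpr (hs q hq).2)
    rw [← eA_mul h, ← eB_mul h]
    exact ⟨this.1, this.2.1⟩
  have hrow2 : ∀ q ∈ s, ‖eC x y P * eA x y q + eD x y P * eC x y q‖ ≤ K * (p : ℝ) ^ (-(n : ℤ)) ∧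
        ‖eC x y P * eB x y q + eD x y P * eD x y q‖ ≤ K * (p : ℝ) ^ (-(n : ℤ)) := by
    intro q hq
    have := hK _ _ ((small_iff_dv (p := p) n (P * q)).mpr (hs q hq).2)
    rw [← eC_mul h, ← eD_mul h]
    exact ⟨this.2.2.1, this.2.2.2⟩
  have row : ∀ V1 V2 : ℚ_[p], ¬ (‖V1‖ ≤ (K' * p)⁻¹ ∧ ‖V2‖ ≤ (K' * p)⁻¹) →
      (∀ q ∈ s, ‖V1 * eA x y q + V2 * eC x y q‖ ≤ K * (p : ℝ) ^ (-(n : ℤ)) ∧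
        ‖V1 * eB x y q + V2 * eD x y q‖ ≤ K * (p : ℝ) ^ (-(n : ℤ))) →
      (s.card : ℝ) ≤ C * (p : ℝ) ^ (m - n) * (p : ℝ) ^ (δ * m) := by
    intro V1 V2 hn hall
    rcases le_total ‖V1‖ ‖V2‖ with hle | hle
    · exact fin V1 V2 V2 (Or.inr rfl) hle le_rfl (by by_contra hcon; push Not at hcon; exact hn ⟨hle.trans hcon, hcon⟩) hall
    · exact fin V1 V2 V1 (Or.inl rfl) le_rfl hle (by by_contra hcon; push Not at hcon; exact hn ⟨hcon, hle.trans hcon⟩) hall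
  by_cases hr1 : ‖eA x y P‖ ≤ (K' * p)⁻¹ ∧ ‖eB x y P‖ ≤ (K' * p)⁻¹
  · by_cases hr2 : ‖eC x y P‖ ≤ (K' * p)⁻¹ ∧ ‖eD x y P‖ ≤ (K' * p)⁻¹
    · exact absurd ⟨hr1.1, hr1.2, hr2.1, hr2.2⟩ hnot
    · exact row _ _ hr2 hrow2
  · exact row _ _ hr1 hrow1

end OO
end

noncomputable section
namespace OO
variable {α β : ℕ} {p : ℕ} [hp : Fact p.Prime]

/-- sum of `F` over all products of `r` elements of `S`. -/
def WW (S : Finset (OO α β)) : ℕ → (OO α β → ℝ) → ℝ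
  | 0, F => F 1
  | r + 1, F => ∑ q ∈ S, WW S r (fun Q => F (q * Q))

lemma WW_add (S : Finset (OO α β)) (r : ℕ) : ∀ F G : OO α β → ℝ,
    WW S r (fun Q => F Q + G Q) = WW S r F + WW S r G := by
  induction r with
  | zero => intro F G; rfl
  | succ r ih => intro F G; simp only [WW, ih, Finset.sum_add_distrib]

lemma WW_mul (S : Finset (OO α β)) (r : ℕ) (a : ℝ) : ∀ F : OO α β → ℝ,
    WW S r (fun Q => a * F Q) = a * WW S r F := by
  induction r with
  | zero => intro F; rfl
  | succ r ih => intro F; simp only [WW, ih, Finset.mul_sum]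

lemma WW_sum {ι : Type*} (S : Finset (OO α β)) (r : ℕ) (I : Finset ι) : ∀ F : ι → OO α β → ℝ,
    WW S r (fun Q => ∑ i ∈ I, F i Q) = ∑ i ∈ I, WW S r (F i) := by
  induction r with
  | zero => intro F; rfl
  | succ r ih =>
    intro F
    simp only [WW, ih]
    rw [Finset.sum_comm]

lemma WW_mono {S : Finset (OO α β)} {ν : ℤ} (hS : ∀ q ∈ S, nm q = ν) (r : ℕ) : ∀ F G : OO α β → ℝ,
    (∀ Q, nm Q = ν ^ r → F Q ≤ G Q) → WW S r F ≤ WW S r G := by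
  induction r with
  | zero => intro F G h; exact h 1 (by simp [nm_one])
  | succ r ih =>
    intro F G h
    simp only [WW]
    refine Finset.sum_le_sum fun q hq => ih _ _ fun Q hQ => h _ ?_
    rw [nm_mul, hS q hq, hQ, pow_succ, mul_comm]

lemma WW_congr {S : Finset (OO α β)} {ν : ℤ} (hS : ∀ q ∈ S, nm q = ν) (r : ℕ) (F G : OO α β → ℝ)
    (h : ∀ Q, nm Q = ν ^ r → F Q = G Q) : WW S r F = WW S r G :=
  le_antisymm (WW_mono hS r F G fun Q hQ => (h Q hQ).le) (WW_mono hS r G F fun Q hQ => (h Q hQ).ge)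

lemma WW_const (S : Finset (OO α β)) (r : ℕ) (a : ℝ) : WW S r (fun _ => a) = (S.card : ℝ) ^ r * a := by
  induction r with
  | zero => simp [WW]
  | succ r ih => simp only [WW, ih, Finset.sum_const, nsmul_eq_mul, pow_succ]; ring

lemma WW_zero (S : Finset (OO α β)) (r : ℕ) : WW S r (fun _ => 0) = 0 := by
  rw [WW_const]; simp

lemma exists_decomp (hα : 0 < α) (hβ : 0 < β) : ∀ Q : OO α β, Q ≠ 0 →
    ∃ (j : ℕ) (Q' : OO α β), Q = sc ((p : ℤ) ^ j) Q' ∧ ¬ dv p Q' := by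
  have key : ∀ N : ℕ, ∀ Q : OO α β, Q ≠ 0 → nm Q ≤ N → 
      ∃ (j : ℕ) (Q' : OO α β), Q = sc ((p : ℤ) ^ j) Q' ∧ ¬ dv p Q' := by
    intro N
    induction N with
    | zero =>
      intro Q hQ h
      have := nm_pos hα hβ hQ
      simp at h; omega
    | succ N ih =>
      intro Q hQ h
      by_cases hd : dv p Q
      · obtain ⟨W, hW⟩ := hd
        have hW0 : W ≠ 0 := by
          rintro rfl; apply hQ; rw [hW]; ext <;> simp
        have hnW := nm_pos hα hβ hW0
        have hn : nm Q = (p : ℤ) ^ 2 * nm W := by rw [hW, nm_sc]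
        have hp2 : (2 : ℤ) ≤ p := by exact_mod_cast hp.out.two_le
        obtain ⟨j, Q', h1, h2⟩ := ih W hW0 (by
          push_cast at h
          have : (4 : ℤ) ≤ (p : ℤ) ^ 2 := by nlinarith
          nlinarith)
        refine ⟨j + 1, Q', ?_, h2⟩
        rw [hW, h1, sc_sc, pow_succ, mul_comm]
      · exact ⟨0, Q, by simp [sc_one'], hd⟩
  intro Q hQ
  exact key (nm Q).toNat Q hQ (Int.self_le_toNat _)

lemma dv_star {k : ℤ} {q : OO α β} (h : dv k q) : dv k (star q) := by
  obtain ⟨w, rfl⟩ := h; exact ⟨star w, star_sc _ _⟩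

lemma sc_dv_cancel {k l : ℤ} (hl : l ≠ 0) {q r : OO α β} (h : sc l q = sc (l * k) r) : q = sc k r :=
  sc_inj hl (by rw [h, sc_sc])

/-- multiplicity bound -/
lemma mult_bound (hα : 0 < α) (hβ : 0 < β) (x y : ℚ_[p]) (h : x ^ 2 + α * y ^ 2 = -(β : ℚ_[p]))
    (δ : ℝ) (hδ : 0 < δ) : ∃ C : ℝ, 1 ≤ C ∧ ∀ (m : ℕ) (S : Finset (OO α β)),
    (∀ q ∈ S, nm q = (p : ℤ) ^ m) → ∀ (r j : ℕ) (Q' : OO α β), ¬ dv p Q' →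
    WW S r (fun P => open Classical in if P = sc ((p : ℤ) ^ j) Q' then 1 else 0) ≤
      (C * (m + 1) * (p : ℝ) ^ (δ * m)) ^ r * (p : ℝ) ^ j := by
  classical
  have hp1 : (1 : ℝ) < p := by exact_mod_cast hp.out.one_lt
  have hp0 : (0 : ℝ) < p := by linarith
  have hpZ : (p : ℤ) ≠ 0 := by exact_mod_cast hp.out.ne_zero
  obtain ⟨C, hC1, hC⟩ := count_row hα hβ x y h δ hδ
  refine ⟨C, hC1, fun m S hS r => ?_⟩
  set B : ℝ := C * (m + 1) * (p : ℝ) ^ (δ * m) with hB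
  have hB0 : 0 ≤ B := by positivity
  induction r with
  | zero =>
    intro j Q' hQ'
    simp only [WW, pow_zero, one_mul]
    split_ifs
    · exact one_le_pow₀ hp1.le
    · positivity
  | succ r ih =>
    intro j Q' hQ'
    have hQ'0 : Q' ≠ 0 := by
      rintro rfl; apply hQ'; exact ⟨0, by ext <;> simp⟩
    simp only [WW]
    have step : ∀ q ∈ S, WW S r (fun P => if q * P = sc ((p : ℤ) ^ j) Q' then (1 : ℝ) else 0) ≤
        ∑ i ∈ Finset.range (m + 1), if dv ((p : ℤ) ^ (m - i)) (star Q' * q) then B ^ r * ((p : ℝ) ^ j / (p : ℝ) ^ i) else 0 := by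
      intro q hq
      have hR0 : 0 ≤ ∑ i ∈ Finset.range (m + 1), (if dv ((p : ℤ) ^ (m - i)) (star Q' * q) then B ^ r * ((p : ℝ) ^ j / (p : ℝ) ^ i) else 0) :=
        Finset.sum_nonneg fun i _ => by split_ifs <;> positivity
      by_cases hex : ∃ P, q * P = sc ((p : ℤ) ^ j) Q'
      swap
      · push Not at hex
        simp only [hex, if_false, WW_zero]
        exact hR0
      obtain ⟨P, hP⟩ := hex
      have hqN : nm q ≠ 0 := by rw [hS q hq]; positivity
      have hP0 : P ≠ 0 := by
        rintro rfl
        rw [mul_zero] at hP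
        apply hQ'0
        apply sc_inj (pow_ne_zero j hpZ)
        rw [← hP]; ext <;> simp
      have huniq : ∀ P1, q * P1 = sc ((p : ℤ) ^ j) Q' ↔ P1 = P := by
        intro P1
        constructor
        · intro h1
          have := congrArg (star q * ·) (h1.trans hP.symm)
          simp only [star_mul_cancel] at this
          exact sc_inj hqN this
        · rintro rfl; exact hP
      simp only [huniq]
      obtain ⟨j1, P', hP', hnd⟩ := exists_decomp (p := p) hα hβ P hP0
      -- star q * Q = p^m P
      have e1 : sc ((p : ℤ) ^ j) (star q * Q') = sc ((p : ℤ) ^ (m + j1)) P' := by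
        have := congrArg (star q * ·) hP
        simp only [star_mul_cancel, mul_sc] at this
        rw [← this, hS q hq, hP', sc_sc, pow_add]
      have e2 : sc ((p : ℤ) ^ j1) (q * P') = sc ((p : ℤ) ^ j) Q' := by
        rw [← hP, hP', mul_sc]
      have hj1 : j1 ≤ j := by
        by_contra hcon
        push Not at hcon
        apply hQ'
        obtain ⟨d, rfl⟩ : ∃ d, j1 = j + (d + 1) := ⟨j1 - j - 1, by omega⟩
        rw [pow_add] at e2
        have := sc_dv_cancel (pow_ne_zero j hpZ) e2.symm
        exact ⟨sc ((p : ℤ) ^ d) (q * P'), by rw [this, sc_sc, pow_succ, mul_comm]⟩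
      have hj2 : j ≤ m + j1 := by
        by_contra hcon
        push Not at hcon
        apply hnd
        obtain ⟨d, rfl⟩ : ∃ d, j = (m + j1) + (d + 1) := ⟨j - (m + j1) - 1, by omega⟩
        rw [pow_add _ (m + j1) (d + 1)] at e1
        have := sc_dv_cancel (pow_ne_zero (m + j1) hpZ) e1.symm
        exact ⟨sc ((p : ℤ) ^ d) (star q * Q'), by rw [this, sc_sc, pow_succ, mul_comm]⟩
      have hi : j - j1 ∈ Finset.range (m + 1) := by rw [Finset.mem_range]; omega
      have hdv : dv ((p : ℤ) ^ (m - (j - j1))) (star Q' * q) := by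
        have : m + j1 = j + (m - (j - j1)) := by omega
        rw [this, pow_add] at e1
        have e3 := sc_dv_cancel (pow_ne_zero j hpZ) e1
        have := dv_star ⟨P', e3⟩
        rwa [star_mul, star_star] at this
      have hih := ih j1 P' hnd
      rw [← hP'] at hih
      refine hih.trans ?_
      refine le_trans ?_ (Finset.single_le_sum (fun i _ => by split_ifs <;> positivity) hi)
      rw [if_pos hdv]
      refine le_of_eq ?_
      congr 1
      rw [eq_div_iff (by positivity), ← pow_add]
      congr 1; omega
    refine (Finset.sum_le_sum step).trans ?_
    rw [Finset.sum_comm]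
    have inner : ∀ i ∈ Finset.range (m + 1), (∑ q ∈ S, if dv ((p : ℤ) ^ (m - i)) (star Q' * q) then B ^ r * ((p : ℝ) ^ j / (p : ℝ) ^ i) else 0) ≤ C * (p : ℝ) ^ (δ * m) * B ^ r * (p : ℝ) ^ j := by
      intro i hi
      rw [Finset.mem_range] at hi
      rw [← Finset.sum_filter, Finset.sum_const, nsmul_eq_mul]
      have hcard := hC m (m - i) (star Q') (S.filter (fun q => dv ((p : ℤ) ^ (m - i)) (star Q' * q))) (by omega)
        (fun hd => hQ' (by simpa using dv_star hd))
        (fun q hq => ⟨hS q (Finset.mem_filter.mp hq).1, (Finset.mem_filter.mp hq).2⟩)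
      have hmi : m - (m - i) = i := by omega
      rw [hmi] at hcard
      calc _ ≤ (C * (p : ℝ) ^ i * (p : ℝ) ^ (δ * m)) * (B ^ r * ((p : ℝ) ^ j / (p : ℝ) ^ i)) := by gcongr
        _ = _ := by field_simp
    refine (Finset.sum_le_sum inner).trans (le_of_eq ?_)
    rw [Finset.sum_const, Finset.card_range, nsmul_eq_mul, pow_succ, hB]
    push_cast; ring

/-- decompose over the values of the product -/
lemma WW_eq_sum (hα : 0 < α) (hβ : 0 < β) {S : Finset (OO α β)} {ν : ℤ} (hS : ∀ q ∈ S, nm q = ν) (r : ℕ)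
    (F : OO α β → ℝ) : WW S r F = ∑ Q ∈ (finite_eq hα hβ (ν ^ r)).toFinset,
      F Q * WW S r (fun P => open Classical in if P = Q then 1 else 0) := by
  classical
  simp_rw [← WW_mul, ← WW_sum]
  apply WW_congr hS
  intro Q hQ
  simp [hQ]

lemma weighted_count (hα : 0 < α) (hβ : 0 < β) (x y : ℚ_[p]) (h : x ^ 2 + α * y ^ 2 = -(β : ℚ_[p]))
    (δ : ℝ) (hδ : 0 < δ) : ∃ C : ℝ, 1 ≤ C ∧ ∀ (m : ℕ) (S : Finset (OO α β)),
    (∀ q ∈ S, nm q = (p : ℤ) ^ m) → ∀ (k : ℕ) (A : Set (OO α β)) (Φ : ℕ → ℝ),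
    (∀ j ≤ m * k, ∀ s : Finset (OO α β), (∀ Q' ∈ s, nm Q' = (p : ℤ) ^ (2 * (m * k - j)) ∧ sc ((p : ℤ) ^ j) Q' ∈ A) →
      (s.card : ℝ) ≤ Φ j) →
    WW S (2 * k) (A.indicator fun _ => 1) ≤ (C * (m + 1) * (p : ℝ) ^ (δ * m)) ^ (2 * k) *
      ∑ j ∈ Finset.range (m * k + 1), (p : ℝ) ^ j * Φ j := by
  classical
  obtain ⟨C, hC1, hC⟩ := mult_bound hα hβ x y h δ hδ
  have hp1 : (1 : ℝ) < p := by exact_mod_cast hp.out.one_lt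
  have hp0 : (0 : ℝ) < p := by linarith
  have hpZ : (p : ℤ) ≠ 0 := by exact_mod_cast hp.out.ne_zero
  refine ⟨C, hC1, fun m S hS k A Φ hΦ => ?_⟩
  set B : ℝ := C * (m + 1) * (p : ℝ) ^ (δ * m) with hB
  have hB0 : 0 ≤ B := by positivity
  set E := (finite_eq hα hβ (((p : ℤ) ^ m) ^ (2 * k))).toFinset with hE
  rw [WW_eq_sum hα hβ hS]
  have hmemE : ∀ Q, Q ∈ E ↔ nm Q = ((p : ℤ) ^ m) ^ (2 * k) := by intro Q; simp [hE]
  have hne : ∀ Q ∈ E, Q ≠ 0 := by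
    rintro Q hQ rfl
    rw [hmemE] at hQ
    simp [nm] at hQ
    exact absurd hQ.symm (pow_ne_zero _ (pow_ne_zero _ hpZ))
  choose! J Pr hJ using exists_decomp (p := p) hα hβ
  have hterm : ∀ Q ∈ E, A.indicator (fun _ => (1 : ℝ)) Q * WW S (2 * k) (fun P => if P = Q then 1 else 0) ≤
      if Q ∈ A then B ^ (2 * k) * (p : ℝ) ^ (J Q) else 0 := by
    intro Q hQ
    obtain ⟨h1, h2⟩ := hJ Q (hne Q hQ)
    by_cases hA : Q ∈ A
    · rw [Set.indicator_of_mem hA, one_mul, if_pos hA]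
      have := hC m S hS (2 * k) (J Q) (Pr Q) h2
      rwa [← h1] at this
    · rw [Set.indicator_of_notMem hA, zero_mul, if_neg hA]
  refine (Finset.sum_le_sum hterm).trans ?_
  rw [← Finset.sum_filter, ← Finset.mul_sum]
  gcongr
  have hnorm : ∀ Q ∈ E, J Q ≤ m * k ∧ nm (Pr Q) = (p : ℤ) ^ (2 * (m * k - J Q)) := by
    intro Q hQ
    obtain ⟨h1, h2⟩ := hJ Q (hne Q hQ)
    have e := congrArg nm h1
    rw [(hmemE Q).mp hQ, nm_sc, ← pow_mul, ← pow_mul] at e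
    have hnp : 0 < nm (Pr Q) := by
      have : 0 < (p : ℤ) ^ (J Q * 2) * nm (Pr Q) := by rw [← e]; positivity
      exact pos_of_mul_pos_right this (by positivity)
    have hle : J Q ≤ m * k := by
      have : (p : ℤ) ^ (J Q * 2) ≤ (p : ℤ) ^ (m * (2 * k)) := by
        rw [e]; exact le_mul_of_one_le_right (by positivity) hnp
      have h3 := (pow_le_pow_iff_right₀ (by exact_mod_cast hp.out.one_lt)).mp this
      nlinarith
    refine ⟨hle, ?_⟩
    have : (p : ℤ) ^ (J Q * 2) * nm (Pr Q) = (p : ℤ) ^ (J Q * 2) * (p : ℤ) ^ (2 * (m * k - J Q)) := by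
      rw [← e, ← pow_add]; congr 1
      have : m * (2 * k) = 2 * (m * k) := by ring
      omega
    exact mul_left_cancel₀ (by positivity) this
  rw [← Finset.sum_fiberwise_of_maps_to (s := E.filter (· ∈ A)) (t := Finset.range (m * k + 1)) (g := J)
    (fun Q hQ => by rw [Finset.mem_range]; exact Nat.lt_succ_of_le (hnorm Q (Finset.mem_filter.mp hQ).1).1)]
  refine Finset.sum_le_sum fun j hj => ?_
  have hconst : ∀ Q ∈ (E.filter (· ∈ A)).filter (fun Q => J Q = j), (p : ℝ) ^ (J Q) = (p : ℝ) ^ j := fun Q hQ => by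
    rw [(Finset.mem_filter.mp hQ).2]
  rw [Finset.sum_congr rfl hconst, Finset.sum_const, nsmul_eq_mul, mul_comm]
  gcongr
  have hinj : Set.InjOn Pr ((E.filter (· ∈ A)).filter (fun Q => J Q = j)) := by
    intro Q hQ R hR e
    have hQ := Finset.mem_filter.mp hQ
    have hR := Finset.mem_filter.mp hR
    rw [(hJ Q (hne Q (Finset.mem_filter.mp hQ.1).1)).1, (hJ R (hne R (Finset.mem_filter.mp hR.1).1)).1, hQ.2, hR.2, e]
  rw [← Finset.card_image_of_injOn hinj]
  refine hΦ j (by rw [Finset.mem_range] at hj; omega) _ ?_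
  intro Q' hQ'
  obtain ⟨Q, hQ, rfl⟩ := Finset.mem_image.mp hQ'
  have hQ2 := Finset.mem_filter.mp hQ
  have hQE := Finset.mem_filter.mp hQ2.1
  refine ⟨?_, ?_⟩
  · rw [(hnorm Q hQE.1).2, hQ2.2]
  · rw [← hQ2.2, ← (hJ Q (hne Q hQE.1)).1]; exact hQE.2

end OO
end

noncomputable section
namespace OO
variable {α β : ℕ} {p : ℕ} [hp : Fact p.Prime]

lemma zbound (hα : 0 < α) (hβ : 0 < β) (x y : ℚ_[p]) (h : x ^ 2 + α * y ^ 2 = -(β : ℚ_[p])) :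
    ∃ (a : ℕ) (T : ℕ), ∀ n, a ≤ n → ∃ Z : Finset (OO α β),
      (∀ q ∈ Z, ∃ t : ℕ, 1 ≤ t ∧ t ≤ T ∧ nm q = t * (p : ℤ) ^ (n - a)) ∧ p ^ n ≤ p ^ a * Z.card := by
  classical
  have hp1 : (1 : ℝ) < p := by exact_mod_cast hp.out.one_lt
  have hp0 : (0 : ℝ) < p := by linarith
  obtain ⟨C1, hC11, hC1⟩ := pigeon (α := α) (β := β) x y
  obtain ⟨K, hK1, hK⟩ := pi_le (α := α) (β := β) x y
  obtain ⟨K', hK'1, hK'⟩ := le_pi hα hβ x y h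
  obtain ⟨c, hc⟩ := exists_pow_ge (p := p) K
  obtain ⟨J, hJ⟩ := exists_pow_ge (p := p) (C1 * p ^ c + 1)
  obtain ⟨a', ha'⟩ := exists_pow_ge (p := p) (p ^ J * K')
  set a := a' + c
  have ha : (p : ℝ) ^ J * K' ≤ (p : ℝ) ^ a := ha'.trans (pow_le_pow_right₀ hp1.le (by omega))
  obtain ⟨T, hT⟩ := exists_nat_ge (C1 * (p : ℝ) ^ a)
  refine ⟨a, T, fun n hn => ?_⟩
  have hN : ∀ s : ℕ, ‖(s : ℚ_[p])‖ ≤ 1 := fun s => Padic.norm_int_le_one (s : ℤ)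
  have hone : ‖(1 : ℚ_[p])‖ ≤ 1 := by simp
  choose Q hQ0 hQn hQ1 hQ2 using fun s : ℕ => hC1 n 1 (s : ℚ_[p]) hone (hN s)
  have hdet : ∀ s (t : ℝ), smallpi x y t (Q s) → ‖((nm (Q s) : ℤ) : ℚ_[p])‖ ≤ (p : ℝ) ^ (-(n : ℤ)) * t := by
    intro s t ⟨hA, hB, hC, hD⟩
    have e := e_det h (Q s)
    rw [← e]
    convert padic_sub_le (padic_mul_le (hQ1 s) hD) (padic_mul_le (hQ2 s) hC) using 2
    ring
  refine ⟨(Finset.range (p ^ n)).image Q, ?_, ?_⟩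
  · intro q hq
    obtain ⟨s, hs, rfl⟩ := Finset.mem_image.mp hq
    have h1 := hdet s K (by simpa using hK (Q s) 1 (small_one _))
    have h2 : ‖((nm (Q s) : ℤ) : ℚ_[p])‖ ≤ (p : ℝ) ^ (-((n - a : ℕ) : ℤ)) := by
      refine h1.trans ?_
      calc _ ≤ (p : ℝ) ^ (-(n : ℤ)) * (p : ℝ) ^ a := by
            gcongr; exact hc.trans (pow_le_pow_right₀ hp1.le (by omega))
        _ = _ := by
          rw [← zpow_natCast, ← zpow_add₀ hp0.ne']; congr 1; push_cast [hn]; ring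
    rw [Padic.norm_int_le_pow_iff_dvd] at h2
    obtain ⟨t, ht⟩ := h2
    push_cast at ht
    have hpos := nm_pos hα hβ (hQ0 s)
    have htpos : 0 < t := by
      rw [ht] at hpos; exact pos_of_mul_pos_right hpos (by positivity)
    lift t to ℕ using htpos.le
    refine ⟨t, by omega, ?_, by rw [ht, mul_comm]⟩
    have h3 := hQn s
    rw [ht] at h3
    push_cast at h3
    have h4 : (p : ℝ) ^ (n - a) * t ≤ (p : ℝ) ^ (n - a) * (C1 * (p : ℝ) ^ a) := by
      refine h3.trans (le_of_eq ?_)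
      have : (p : ℝ) ^ n = (p : ℝ) ^ (n - a) * (p : ℝ) ^ a := by rw [← pow_add]; congr 1; omega
      rw [this]; ring
    have h5 := le_of_mul_le_mul_left h4 (by positivity)
    exact_mod_cast h5.trans hT
  · have hbig : ∀ s, ¬ small p ((p : ℝ) ^ (-(J : ℤ))) (Q s) := by
      intro s hsm
      have h1 := hdet s _ (hK _ _ hsm)
      have hcJ : c ≤ J := by
        have : (p : ℝ) ^ c ≤ (p : ℝ) ^ J := by nlinarith [pow_pos hp0 c]
        exact (pow_le_pow_iff_right₀ hp1).mp this
      have h2 : ‖((nm (Q s) : ℤ) : ℚ_[p])‖ ≤ (p : ℝ) ^ (-((n + (J - c) : ℕ) : ℤ)) := by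
        refine h1.trans ?_
        calc _ ≤ (p : ℝ) ^ (-(n : ℤ)) * ((p : ℝ) ^ c * (p : ℝ) ^ (-(J : ℤ))) := by gcongr
          _ = _ := by
            rw [← zpow_natCast, ← zpow_add₀ hp0.ne', ← zpow_add₀ hp0.ne']; congr 1; push_cast [hcJ]; ring
      rw [Padic.norm_int_le_pow_iff_dvd] at h2
      have h3 := Int.le_of_dvd (nm_pos hα hβ (hQ0 s)) h2
      have h4 : (p : ℝ) ^ (n + (J - c)) ≤ C1 * (p : ℝ) ^ n := le_trans (by exact_mod_cast h3) (hQn s)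
      rw [pow_add, mul_comm] at h4
      have h5 := le_of_mul_le_mul_right h4 (by positivity)
      have h6 : (p : ℝ) ^ J = (p : ℝ) ^ (J - c) * (p : ℝ) ^ c := by rw [← pow_add]; congr 1; omega
      have : (p : ℝ) ^ (J - c) * (p : ℝ) ^ c ≤ C1 * (p : ℝ) ^ c := by gcongr
      linarith
    have := Finset.card_le_mul_card_image (f := Q) (Finset.range (p ^ n)) (p ^ a) ?_
    · rwa [Finset.card_range] at this
    intro q hq
    obtain ⟨s0, hs0, rfl⟩ := Finset.mem_image.mp hq
    -- all s with same Q
    have hdiv : ∀ s, Q s = Q s0 → ((p : ℤ) ^ (n - a)) ∣ (s : ℤ) - s0 := by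
      intro s hs
      set q := Q s0
      have e1 : ‖((s : ℚ_[p]) - s0) * eC x y q‖ ≤ (p : ℝ) ^ (-(n : ℤ)) := by
        have := hQ1 s; rw [hs] at this
        convert padic_sub_le this (hQ1 s0) using 2; ring
      have e2 : ‖((s : ℚ_[p]) - s0) * eD x y q‖ ≤ (p : ℝ) ^ (-(n : ℤ)) := by
        have := hQ2 s; rw [hs] at this
        convert padic_sub_le this (hQ2 s0) using 2; ring
      have hKJ : 0 < (p : ℝ) ^ J * K' := by positivity
      have hsm : ¬ smallpi x y (((p : ℝ) ^ J * K')⁻¹) q := by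
        intro hh
        apply hbig s0
        have := hK' _ _ hh
        have e : K' * ((p : ℝ) ^ J * K')⁻¹ = (p : ℝ) ^ (-(J : ℤ)) := by
          rw [zpow_neg, zpow_natCast]; field_simp
        rwa [e] at this
      have hnle : (p : ℝ) ^ (-(n : ℤ)) ≤ ((p : ℝ) ^ J * K')⁻¹ := by
        rw [zpow_neg, zpow_natCast]
        apply inv_anti₀ hKJ
        exact ha.trans (pow_le_pow_right₀ hp1.le hn)
      have hlarge : ((p : ℝ) ^ J * K')⁻¹ < ‖eC x y q‖ ∨ ((p : ℝ) ^ J * K')⁻¹ < ‖eD x y q‖ := by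
        by_contra hcon
        push Not at hcon
        obtain ⟨hC, hD⟩ := hcon
        apply hsm
        refine ⟨?_, ?_, hC, hD⟩
        · convert padic_sub_le ((hQ1 s0).trans hnle) (by simpa using padic_mul_le (hN s0) hC : ‖(s0 : ℚ_[p]) * eC x y q‖ ≤ _) using 2; ring
        · convert padic_sub_le ((hQ2 s0).trans hnle) (by simpa using padic_mul_le (hN s0) hD : ‖(s0 : ℚ_[p]) * eD x y q‖ ≤ _) using 2; ring
      have fin : ∀ z : ℚ_[p], ((p : ℝ) ^ J * K')⁻¹ < ‖z‖ → ‖((s : ℚ_[p]) - s0) * z‖ ≤ (p : ℝ) ^ (-(n : ℤ)) →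
          ‖(((s : ℤ) - s0 : ℤ) : ℚ_[p])‖ ≤ (p : ℝ) ^ (-((n - a : ℕ) : ℤ)) := by
        intro z hz hle
        push_cast
        rw [norm_mul] at hle
        have hz0 : 0 < ‖z‖ := lt_trans (by positivity) hz
        have h1 : ‖(s : ℚ_[p]) - s0‖ ≤ (p : ℝ) ^ (-(n : ℤ)) * ‖z‖⁻¹ := by
          rw [← div_eq_mul_inv, le_div_iff₀ hz0]; exact hle
        have h2 : ‖z‖⁻¹ ≤ (p : ℝ) ^ J * K' := by
          rw [inv_le_comm₀ hz0 hKJ]; exact hz.le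
        calc _ ≤ _ := h1
          _ ≤ (p : ℝ) ^ (-(n : ℤ)) * (p : ℝ) ^ a := by gcongr; exact h2.trans ha
          _ = _ := by
            rw [← zpow_natCast, ← zpow_add₀ hp0.ne']; congr 1; push_cast [hn]; ring
      rcases hlarge with hl | hl
      · have := fin _ hl e1
        rw [Padic.norm_int_le_pow_iff_dvd] at this
        exact_mod_cast this
      · have := fin _ hl e2
        rw [Padic.norm_int_le_pow_iff_dvd] at this
        exact_mod_cast this
    calc _ ≤ (Finset.range (p ^ a)).card := by
          refine Finset.card_le_card_of_injOn (fun s => s / p ^ (n - a)) ?_ ?_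
          · intro s hs
            have hs := Finset.mem_filter.mp hs
            rw [Finset.mem_range] at hs
            simp only [Finset.coe_range, Set.mem_Iio]
            rw [Nat.div_lt_iff_lt_mul (by have := hp.out.pos; positivity), ← pow_add]
            have : a + (n - a) = n := by omega
            rw [this]; exact hs.1
          · intro s hs s' hs' e
            have d1 := hdiv s (Finset.mem_filter.mp hs).2
            have d2 := hdiv s' (Finset.mem_filter.mp hs').2
            have d3 := dvd_sub d1 d2
            have d4 : ((p ^ (n - a) : ℕ) : ℤ) ∣ (s : ℤ) - s' := by
              
              have e9 : (s : ℤ) - s' = ((s : ℤ) - s0) - ((s' : ℤ) - s0) := by ring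
              rw [e9]; push_cast; exact d3
            have d5 : s ≡ s' [MOD p ^ (n - a)] := (Nat.modEq_iff_dvd.mpr d4).symm
            simp only at e
            rw [← Nat.div_add_mod s (p ^ (n - a)), ← Nat.div_add_mod s' (p ^ (n - a)), e, d5]
      _ = p ^ a := Finset.card_range _

/-- many elements of norm `p^m` for infinitely many `m`. -/
lemma lower_bound (hα : 0 < α) (hβ : 0 < β) (x y : ℚ_[p]) (h : x ^ 2 + α * y ^ 2 = -(β : ℚ_[p])) :
    ∃ c0 : ℝ, 0 < c0 ∧ ∀ m0 : ℕ, ∃ m, m0 ≤ m ∧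
      c0 * (p : ℝ) ^ m ≤ ((finite_eq hα hβ ((p : ℤ) ^ m)).toFinset.card : ℝ) := by
  classical
  have hp1 : (1 : ℝ) < p := by exact_mod_cast hp.out.one_lt
  have hp0 : (0 : ℝ) < p := by linarith
  have hpZ : (0 : ℤ) < p := by exact_mod_cast hp.out.pos
  obtain ⟨a, T, hZ⟩ := zbound hα hβ x y h
  let I : Finset ℤ := Finset.Icc 0 (T : ℤ)
  let Ω : Finset (ℕ × ℤ × ℤ × ℤ × ℤ) := Finset.range (T + 1) ×ˢ I ×ˢ I ×ˢ I ×ˢ I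
  let P : (ℕ × ℤ × ℤ × ℤ × ℤ) → ℕ → OO α β → Prop := fun κ n q =>
    nm q = κ.1 * (p : ℤ) ^ n ∧ 1 ≤ κ.1 ∧ (q.re % κ.1, q.imI % κ.1, q.imJ % κ.1, q.imK % κ.1) = κ.2
  -- fix representatives
  have hg : ∀ κ, ∃ g : OO α β × ℕ, (∃ n q, P κ n q) → P κ g.2 g.1 := by
    intro κ
    by_cases hex : ∃ n q, P κ n q
    · obtain ⟨n, q, hq⟩ := hex; exact ⟨(q, n), fun _ => hq⟩
    · exact ⟨(0, 0), fun h' => absurd h' hex⟩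
  choose g hg using hg
  set M := Ω.sup (fun κ => (g κ).2)
  have hΩ : Ω.Nonempty := by
    refine ⟨(0, 0, 0, 0, 0), ?_⟩
    simp [Ω, I]
  have hΩ0 : (0 : ℝ) < Ω.card := by exact_mod_cast hΩ.card_pos
  refine ⟨((p : ℝ) ^ a * Ω.card * (p : ℝ) ^ M)⁻¹, by positivity, fun m0 => ?_⟩
  obtain ⟨Z, hZ1, hZ2⟩ := hZ (m0 + a) (by omega)
  simp only [Nat.add_sub_cancel] at hZ1
  -- classify
  choose! t ht1 htT htn using hZ1
  let cl : OO α β → (ℕ × ℤ × ℤ × ℤ × ℤ) := fun q => (t q, q.re % t q, q.imI % t q, q.imJ % t q, q.imK % t q)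
  have hmaps : ∀ q ∈ Z, cl q ∈ Ω := by
    intro q hq
    have h1 := ht1 q hq
    have h2 := htT q hq
    have hm : ∀ z : ℤ, z % (t q : ℤ) ∈ I := by
      intro z
      have a1 := Int.emod_nonneg z (by omega : (t q : ℤ) ≠ 0)
      have a2 := Int.emod_lt_of_pos z (by omega : (0 : ℤ) < t q)
      simp only [I, Finset.mem_Icc]; omega
    simp only [Ω, cl, Finset.mem_product, Finset.mem_range]
    exact ⟨by omega, hm _, hm _, hm _, hm _⟩
  obtain ⟨κ, hκ, hcard⟩ : ∃ κ ∈ Ω, Z.card ≤ Ω.card * (Z.filter (fun q => cl q = κ)).card := by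
    by_contra hcon
    push Not at hcon
    have h1 := Finset.card_eq_sum_card_fiberwise hmaps
    have h2 : ∑ κ ∈ Ω, Ω.card * (Z.filter (fun q => cl q = κ)).card < ∑ κ ∈ Ω, Z.card :=
      Finset.sum_lt_sum_of_nonempty hΩ hcon
    rw [← Finset.mul_sum, ← h1, Finset.sum_const, smul_eq_mul] at h2
    exact lt_irrefl _ h2
  have hPκ : ∀ q ∈ Z.filter (fun q => cl q = κ), P κ m0 q := by
    intro q hq
    obtain ⟨hq1, hq2⟩ := Finset.mem_filter.mp hq
    simp only [P, ← hq2, cl]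
    exact ⟨htn q hq1, ht1 q hq1, trivial⟩
  have hZpos : 0 < (Z.filter (fun q => cl q = κ)).card := by
    by_contra hcon
    have h0 : (Z.filter (fun q => cl q = κ)).card = 0 := by omega
    rw [h0] at hcard
    have : Z.card = 0 := by simpa using hcard
    rw [this] at hZ2
    have := pow_pos hp.out.pos (m0 + a)
    omega
  obtain ⟨q1, hq1⟩ := Finset.card_pos.mp hZpos
  obtain ⟨gN, gt, gc⟩ := hg κ ⟨m0, q1, hPκ q1 hq1⟩
  set n1 := (g κ).2
  set γ := (g κ).1
  set τ := κ.1
  have hn1 : n1 ≤ M := Finset.le_sup (f := fun κ => (g κ).2) hκ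
  have hτ : (τ : ℤ) ≠ 0 := by omega
  have hdv : ∀ q ∈ Z.filter (fun q => cl q = κ), dv τ (q * star γ) := by
    intro q hq
    obtain ⟨_, _, qc⟩ := hPκ q hq
    have hc := qc.trans gc.symm
    simp only [Prod.mk.injEq] at hc
    obtain ⟨c1, c2, c3, c4⟩ := hc
    obtain ⟨d1, hd1⟩ := (Int.ModEq.dvd (Int.ModEq.symm c1) : (τ : ℤ) ∣ _)
    obtain ⟨d2, hd2⟩ := (Int.ModEq.dvd (Int.ModEq.symm c2) : (τ : ℤ) ∣ _)
    obtain ⟨d3, hd3⟩ := (Int.ModEq.dvd (Int.ModEq.symm c3) : (τ : ℤ) ∣ _)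
    obtain ⟨d4, hd4⟩ := (Int.ModEq.dvd (Int.ModEq.symm c4) : (τ : ℤ) ∣ _)
    have e : q = γ + sc τ ⟨d1, d2, d3, d4⟩ := by
      ext <;> simp only [QuaternionAlgebra.re_add, QuaternionAlgebra.imI_add, QuaternionAlgebra.imJ_add, QuaternionAlgebra.imK_add, sc_re, sc_imI, sc_imJ, sc_imK] <;> linarith
    refine ⟨sc ((p : ℤ) ^ n1) 1 + ⟨d1, d2, d3, d4⟩ * star γ, ?_⟩
    rw [e, add_mul, mul_star', gN, sc_mul, ← sc_sc]
    ext <;> simp <;> ring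
  choose! w hw using hdv
  have hinj : Set.InjOn w (Z.filter (fun q => cl q = κ)) := by
    intro q hq r hr e
    have h1 : q * star γ = r * star γ := by rw [hw q hq, hw r hr, e]
    have := congrArg (· * γ) h1
    simp only [mul_star_mul] at this
    refine sc_inj ?_ this
    rw [gN]; positivity
  refine ⟨m0 + n1, by omega, ?_⟩
  have hsub : (Z.filter (fun q => cl q = κ)).card ≤ (finite_eq hα hβ ((p : ℤ) ^ (m0 + n1))).toFinset.card := by
    refine Finset.card_le_card_of_injOn w ?_ hinj
    intro q hq
    have e := congrArg nm (hw q hq)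
    rw [nm_mul, nm_star, nm_sc, (hPκ q hq).1, gN] at e
    simp only [Set.Finite.coe_toFinset, Set.mem_ofPred_eq]
    have : (τ : ℤ) ^ 2 * nm (w q) = (τ : ℤ) ^ 2 * (p : ℤ) ^ (m0 + n1) := by
      rw [← e, pow_add]; ring
    exact mul_left_cancel₀ (pow_ne_zero 2 hτ) this
  have hfin : (p : ℝ) ^ (m0 + a) ≤ (p : ℝ) ^ a * (Ω.card * ((finite_eq hα hβ ((p : ℤ) ^ (m0 + n1))).toFinset.card : ℝ)) := by
    have : p ^ (m0 + a) ≤ p ^ a * (Ω.card * (finite_eq hα hβ ((p : ℤ) ^ (m0 + n1))).toFinset.card) :=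
      hZ2.trans (Nat.mul_le_mul_left _ (hcard.trans (Nat.mul_le_mul_left _ hsub)))
    exact_mod_cast this
  rw [inv_mul_le_iff₀ (by positivity)]
  calc (p : ℝ) ^ (m0 + n1) ≤ (p : ℝ) ^ (m0 + a) * (p : ℝ) ^ M := by
        rw [← pow_add]; exact pow_le_pow_right₀ hp1.le (by omega)
    _ ≤ _ := by
      calc _ ≤ ((p : ℝ) ^ a * (Ω.card * ((finite_eq hα hβ ((p : ℤ) ^ (m0 + n1))).toFinset.card : ℝ))) * (p : ℝ) ^ M := by gcongr
        _ = _ := by ring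

end OO
end

noncomputable section
namespace OO
variable {α β : ℕ} {p : ℕ} [hp : Fact p.Prime]

lemma card_Icc_le (a b : ℝ) (hab : a ≤ b) : ((Finset.Icc ⌈a⌉ ⌊b⌋).card : ℝ) ≤ 1 + (b - a) := by
  rw [Int.card_Icc]
  have h1 := Int.floor_le b
  have h2 := Int.le_ceil a
  rcases le_or_gt 0 (⌊b⌋ + 1 - ⌈a⌉) with h | h
  · have : (((⌊b⌋ + 1 - ⌈a⌉).toNat : ℤ) : ℝ) = ((⌊b⌋ + 1 - ⌈a⌉ : ℤ) : ℝ) := by rw [Int.toNat_of_nonneg h]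
    rw [← Int.cast_natCast, this]; push_cast; linarith
  · rw [Int.toNat_of_nonpos h.le]; push_cast; linarith

lemma cnt1 (hα : 0 < α) (hβ : 0 < β) (δ : ℝ) (hδ : 0 < δ) : ∃ C : ℝ, 1 ≤ C ∧ ∀ (Y : ℕ) (θ : ℝ)
    (s : Finset (OO α β)), 1 ≤ Y → 0 < θ → θ ≤ 1 →
    (∀ Q ∈ s, nm Q = (Y : ℤ) ^ 2 ∧ (nm (Q - sc Y 1) : ℝ) ≤ θ ^ 2 * (Y : ℝ) ^ 2) →
    (s.card : ℝ) ≤ C * (Y : ℝ) ^ (2 * δ) * (1 + θ ^ 2 * Y) * (1 + 2 * θ * Y) := by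
  obtain ⟨C, hC1, hC⟩ := count_re_imK hα hβ δ hδ
  refine ⟨C, hC1, fun Y θ s hY hθ hθ1 hs => ?_⟩
  have hY' : (1 : ℝ) ≤ Y := by exact_mod_cast hY
  have key := hC ((Y : ℤ) ^ 2) s (Finset.Icc ⌈(Y : ℝ) - θ ^ 2 * Y⌉ ⌊(Y : ℝ)⌋)
    (Finset.Icc ⌈-(θ * Y)⌉ ⌊θ * Y⌋) (by exact_mod_cast Nat.one_le_pow _ _ hY) ?_
  · refine key.trans ?_
    have e : (((Y : ℤ) ^ 2 : ℤ) : ℝ) ^ δ = (Y : ℝ) ^ (2 * δ) := by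
      push_cast
      rw [Real.rpow_mul (by positivity)]; norm_cast
    rw [e]
    have h1 := card_Icc_le ((Y : ℝ) - θ ^ 2 * Y) Y (by nlinarith [sq_nonneg θ])
    have h2 := card_Icc_le (-(θ * Y)) (θ * Y) (by nlinarith)
    gcongr
    · linarith
    · linarith
  · intro Q hQ
    obtain ⟨h1, h2⟩ := hs Q hQ
    have e1 : (Q.re : ℝ) ^ 2 + α * Q.imI ^ 2 + β * Q.imJ ^ 2 + α * β * Q.imK ^ 2 = (Y : ℝ) ^ 2 := by
      have := h1; rw [nm] at this; exact_mod_cast this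
    have e2 : ((Q.re : ℝ) - Y) ^ 2 + α * Q.imI ^ 2 + β * Q.imJ ^ 2 + α * β * Q.imK ^ 2 ≤ θ ^ 2 * (Y : ℝ) ^ 2 := by
      refine le_trans (le_of_eq ?_) h2
      simp [nm]
    have a1 : (1 : ℝ) ≤ α := by exact_mod_cast hα
    have b1 : (1 : ℝ) ≤ β := by exact_mod_cast hβ
    have ab1 : (1 : ℝ) ≤ α * β := by nlinarith
    have p1 : 0 ≤ (α : ℝ) * Q.imI ^ 2 := by positivity
    have p2 : 0 ≤ (β : ℝ) * Q.imJ ^ 2 := by positivity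
    have p3 : (Q.imK : ℝ) ^ 2 ≤ (α : ℝ) * β * Q.imK ^ 2 := by nlinarith [sq_nonneg (Q.imK : ℝ)]
    have p4 := sq_nonneg (Q.imK : ℝ)
    refine ⟨h1, ?_, ?_⟩
    · rw [Finset.mem_Icc, Int.ceil_le, Int.le_floor]
      constructor
      · have : (Y : ℝ) * ((Y : ℝ) - θ ^ 2 * Y) ≤ Y * Q.re := by nlinarith
        exact le_of_mul_le_mul_left this (by linarith)
      · nlinarith
    · rw [Finset.mem_Icc, Int.ceil_le, Int.le_floor]
      have : (Q.imK : ℝ) ^ 2 ≤ (θ * Y) ^ 2 := by nlinarith [sq_nonneg ((Q.re : ℝ) - Y)]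
      exact abs_le.mp (abs_le_of_sq_le_sq this (by positivity))

lemma exists_V (hα : 0 < α) (hβ : 0 < β) (U : OO α β) (hU : U.re = 0) :
    ∃ V : OO α β, 0 < nm V ∧ ∀ Q : OO α β,
      nm U * nm V * nm Q = nm V * (nm U * Q.re ^ 2 + (Q * star U).re ^ 2) +
        (nm U * (Q * star V).re ^ 2 + (Q * star (U * V)).re ^ 2) ∧
      4 * (nm U * (Q * star V).re ^ 2 + (Q * star (U * V)).re ^ 2) = nm V * nm (Q * U - U * Q) := by
  by_cases h : U.imI = 0 ∧ U.imJ = 0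
  · refine ⟨⟨0, 1, 0, 0⟩, nm_pos hα hβ ?_, fun Q => ?_⟩
    · intro h; have := congrArg QuaternionAlgebra.imI h; simp at this
    · constructor
      · simp [nm, hU, h.1, h.2]; ring
      · simp [nm, hU, h.1, h.2]; ring
  · refine ⟨⟨0, β * U.imJ, -(α * U.imI), 0⟩, nm_pos hα hβ ?_, fun Q => ?_⟩
    · intro h'
      have h1 := congrArg QuaternionAlgebra.imI h'
      have h2 := congrArg QuaternionAlgebra.imJ h'
      simp at h1 h2
      exact h ⟨h2.resolve_left hα.ne', h1.resolve_left hβ.ne'⟩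
    · constructor
      · simp [nm, hU]; ring
      · simp [nm, hU]; ring

lemma cnt2 (hα : 0 < α) (hβ : 0 < β) (U : OO α β) (hU : U.re = 0) (hU0 : U ≠ 0)
    (δ : ℝ) (hδ : 0 < δ) : ∃ C : ℝ, 1 ≤ C ∧ ∀ (Y : ℕ) (θ : ℝ)
    (s : Finset (OO α β)), 1 ≤ Y → 0 < θ → θ ≤ 1 →
    (∀ Q ∈ s, nm Q = (Y : ℤ) ^ 2 ∧ (nm (Q * U - U * Q) : ℝ) ≤ θ ^ 2 * (Y : ℝ) ^ 2 * nm U) →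
    (s.card : ℝ) ≤ C * (Y : ℝ) ^ (2 * δ) * (1 + θ ^ 2 * Y ^ 2) := by
  classical
  obtain ⟨V, hV, hid⟩ := exists_V hα hβ U hU
  have hUp := nm_pos hα hβ hU0
  obtain ⟨D, hD⟩ := Int.eq_ofNat_of_zero_le hUp.le
  obtain ⟨n0, hn0⟩ := Int.eq_ofNat_of_zero_le hV.le
  simp only [hD, hn0] at hid
  have hDp : 0 < D := by omega
  have hn0p : 0 < n0 := by omega
  obtain ⟨C, hC1, hC⟩ := binary_bound D hDp δ hδ
  have D1 : (1 : ℝ) ≤ D := by exact_mod_cast hDp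
  have n1 : (1 : ℝ) ≤ n0 := by exact_mod_cast hn0p
  have hK1 : (1 : ℝ) ≤ (1 + D : ℝ) ^ δ := Real.one_le_rpow (by linarith) hδ.le
  refine ⟨(2 + 8 * n0 * D) ^ 2 * (C * (1 + D) ^ δ), ?_, fun Y θ s hY hθ hθ1 hs => ?_⟩
  · have : (1 : ℝ) ≤ 2 + 8 * n0 * D := by nlinarith
    have h3 : (1 : ℝ) ≤ (2 + 8 * n0 * D) ^ 2 := one_le_pow₀ this
    have h4 : 1 ≤ C * (1 + D : ℝ) ^ δ := by nlinarith
    nlinarith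
  have hY' : (1 : ℝ) ≤ Y := by exact_mod_cast hY
  set I : Finset ℤ := Finset.Icc ⌈-(n0 * D * θ * Y)⌉ ⌊n0 * D * θ * Y⌋ with hI
  have hIc : (I.card : ℝ) ≤ 1 + 2 * (n0 * D * θ * Y) := by
    have h0 : 0 ≤ n0 * D * θ * Y := by positivity
    have := card_Icc_le (-(n0 * D * θ * Y)) (n0 * D * θ * Y) (by linarith)
    linarith
  have hmaps : ∀ Q ∈ s, ((Q * star V).re, (Q * star (U * V)).re) ∈ I ×ˢ I := by
    intro Q hQ
    obtain ⟨h1, h2⟩ := hs Q hQ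
    have h3 : 4 * ((D : ℝ) * ((Q * star V).re : ℝ) ^ 2 + ((Q * star (U * V)).re : ℝ) ^ 2) = n0 * (nm (Q * U - U * Q) : ℝ) := by
      exact_mod_cast (hid Q).2
    have hb : (n0 : ℝ) * (nm (Q * U - U * Q) : ℝ) ≤ n0 * (θ ^ 2 * (Y : ℝ) ^ 2 * D) := by
      gcongr; rw [hD] at h2; exact_mod_cast h2
    have hb2 : (n0 : ℝ) * (θ ^ 2 * (Y : ℝ) ^ 2 * D) ≤ (n0 * D * θ * Y) ^ 2 := by
      have : (n0 : ℝ) * D ≤ (n0 * D) ^ 2 := by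
        have : (1 : ℝ) ≤ n0 * D := by nlinarith
        nlinarith
      calc _ = (n0 : ℝ) * D * (θ ^ 2 * Y ^ 2) := by ring
        _ ≤ (n0 * D) ^ 2 * (θ ^ 2 * Y ^ 2) := by gcongr
        _ = _ := by ring
    have f1 : ((Q * star V).re : ℝ) ^ 2 ≤ (n0 * D * θ * Y) ^ 2 := by
      nlinarith [sq_nonneg ((Q * star V).re : ℝ), sq_nonneg ((Q * star (U * V)).re : ℝ)]
    have f2 : ((Q * star (U * V)).re : ℝ) ^ 2 ≤ (n0 * D * θ * Y) ^ 2 := by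
      nlinarith [sq_nonneg ((Q * star V).re : ℝ), sq_nonneg ((Q * star (U * V)).re : ℝ)]
    rw [Finset.mem_product]
    constructor
    · rw [hI, Finset.mem_Icc, Int.ceil_le, Int.le_floor]
      exact abs_le.mp (abs_le_of_sq_le_sq f1 (by positivity))
    · rw [hI, Finset.mem_Icc, Int.ceil_le, Int.le_floor]
      exact abs_le.mp (abs_le_of_sq_le_sq f2 (by positivity))
  have h1 : ((s.card : ℕ) : ℝ) ≤ (I ×ˢ I).card • (C * (1 + D) ^ δ * (Y : ℝ) ^ (2 * δ)) := by
    rw [Finset.card_eq_sum_card_fiberwise hmaps]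
    push_cast
    refine Finset.sum_le_card_nsmul _ _ _ ?_
    rintro ⟨x, w⟩ -
    set s' := s.filter (fun Q => ((Q * star V).re, (Q * star (U * V)).re) = (x, w)) with hs'
    have hinj : Set.InjOn (fun Q : OO α β => ((Q * star U).re, Q.re)) s' := by
      intro q hq r hr h
      have hq := (Finset.mem_filter.mp hq).2
      have hr := (Finset.mem_filter.mp hr).2
      simp only [Prod.mk.injEq] at h hq hr
      have := (hid (q - r)).1
      simp only [sub_mul, QuaternionAlgebra.re_sub, h.1, h.2, hq.1, hq.2, hr.1, hr.2, sub_self] at this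
      by_contra hne
      have hpos := nm_pos hα hβ (sub_ne_zero.mpr hne)
      have : (0 : ℤ) < D * n0 * nm (q - r) := by positivity
      linarith
    rw [← Finset.card_image_of_injOn hinj]
    have bnd : ∀ n : ℤ, (∀ Q ∈ s', (Q * star U).re ^ 2 + D * Q.re ^ 2 = n) → |(n : ℝ)| ≤ D * (Y : ℝ) ^ 2 →
        ((s'.image (fun Q : OO α β => ((Q * star U).re, Q.re))).card : ℝ) ≤ C * (1 + D) ^ δ * (Y : ℝ) ^ (2 * δ) := by
      intro n hn hb
      refine (hC n _ ?_).trans ?_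
      · intro z hz
        obtain ⟨Q, hQ, rfl⟩ := Finset.mem_image.mp hz
        exact hn Q hQ
      · rw [Real.rpow_mul (by positivity), mul_assoc, ← Real.mul_rpow (by positivity) (by positivity)]
        gcongr
        norm_cast at hb ⊢
        push_cast at hb ⊢
        nlinarith
    by_cases hem : s'.Nonempty
    swap
    · rw [Finset.not_nonempty_iff_eq_empty] at hem
      rw [hem]; simp; positivity
    obtain ⟨q0, hq0⟩ := hem
    have hid' : ∀ Q ∈ s', (n0 : ℤ) * ((Q * star U).re ^ 2 + D * Q.re ^ 2) = D * n0 * Y ^ 2 - (D * x ^ 2 + w ^ 2) := by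
      intro Q hQ
      have e := (Finset.mem_filter.mp hQ)
      have h2 := e.2
      simp only [Prod.mk.injEq] at h2
      have := (hid Q).1
      rw [(hs Q e.1).1, h2.1, h2.2] at this
      linarith
    have hn0z : (n0 : ℤ) ≠ 0 := by omega
    refine bnd ((q0 * star U).re ^ 2 + D * q0.re ^ 2) (fun Q hQ => ?_) ?_
    · apply mul_left_cancel₀ hn0z
      rw [hid' Q hQ, hid' q0 hq0]
    · have h5 := hid' q0 hq0
      have h6 : (n0 : ℤ) * ((q0 * star U).re ^ 2 + D * q0.re ^ 2) ≤ n0 * (D * Y ^ 2) := by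
        rw [h5]
        have : 0 ≤ (D : ℤ) * x ^ 2 + w ^ 2 := by positivity
        linarith
      have h7 := le_of_mul_le_mul_left h6 (by omega)
      rw [abs_of_nonneg (by positivity)]
      exact_mod_cast h7
  refine h1.trans ?_
  rw [Finset.card_product, nsmul_eq_mul]
  push_cast
  have hK0 : 0 ≤ C * (1 + D : ℝ) ^ δ * (Y : ℝ) ^ (2 * δ) := by positivity
  have h8 : (I.card : ℝ) * I.card ≤ (2 + 8 * n0 * D) ^ 2 * (1 + θ ^ 2 * Y ^ 2) := by
    have h0 : 0 ≤ θ * Y := by positivity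
    have hD2 : (1 : ℝ) ≤ n0 * D := by nlinarith
    have : (I.card : ℝ) ≤ (2 + 8 * n0 * D) / 2 * (1 + θ * Y) := by
      refine hIc.trans ?_
      nlinarith
    calc (I.card : ℝ) * I.card ≤ ((2 + 8 * n0 * D) / 2 * (1 + θ * Y)) * ((2 + 8 * n0 * D) / 2 * (1 + θ * Y)) := by gcongr
      _ = (2 + 8 * n0 * D) ^ 2 * ((1 + θ * Y) ^ 2 / 4) := by ring
      _ ≤ _ := by
        gcongr
        nlinarith [sq_nonneg (1 - θ * Y)]
  calc _ ≤ ((2 + 8 * n0 * D) ^ 2 * (1 + θ ^ 2 * Y ^ 2)) * (C * (1 + D : ℝ) ^ δ * (Y : ℝ) ^ (2 * δ)) := by gcongr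
    _ = _ := by ring

lemma exists_lin_bound (δ : ℝ) (hδ : 0 < δ) : ∃ C : ℝ, 1 ≤ C ∧ ∀ n : ℕ, (n : ℝ) + 1 ≤ C * (p : ℝ) ^ (δ * n) := by
  have hp1 : (1 : ℝ) < p := by exact_mod_cast hp.out.one_lt
  have hl : 0 < Real.log p := Real.log_pos hp1
  refine ⟨1 + 1 / (δ * Real.log p), by simp; positivity, fun n => ?_⟩
  rw [Real.rpow_def_of_pos (by linarith)]
  have h1 := Real.add_one_le_exp (Real.log p * (δ * n))
  have h2 : 0 ≤ Real.log p * (δ * n) := by positivity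
  have h3 : (n : ℝ) = 1 / (δ * Real.log p) * (Real.log p * (δ * n)) := by field_simp
  have h4 : 0 ≤ 1 / (δ * Real.log p) := by positivity
  have h5 := mul_le_mul_of_nonneg_left (show Real.log p * (δ * n) ≤ Real.exp (Real.log p * (δ * n)) by linarith) h4
  rw [← h3] at h5
  nlinarith

lemma counts_core (hα : 0 < α) (hβ : 0 < β) (x y : ℚ_[p]) (h : x ^ 2 + α * y ^ 2 = -(β : ℚ_[p]))
    (δ : ℝ) (hδ : 0 < δ) : ∃ m0 : ℕ, ∃ C : ℝ, 1 ≤ C ∧ ∀ m ≥ m0, ∀ S : Finset (OO α β),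
    (∀ q ∈ S, nm q = (p : ℤ) ^ m) → ∀ (k : ℕ) (A : Set (OO α β)) (Ψ : ℝ), 0 ≤ Ψ → 
    (∀ j ≤ m * k, ∀ s : Finset (OO α β), (∀ Q' ∈ s, nm Q' = (((p ^ (m * k - j) : ℕ) : ℤ)) ^ 2 ∧ sc ((p : ℤ) ^ j) Q' ∈ A) →
      (p : ℝ) ^ j * (s.card : ℝ) ≤ Ψ) →
    WW S (2 * k) (A.indicator fun _ => 1) ≤ C * ((p : ℝ) ^ (m * k)) ^ (5 * δ) * Ψ := by
  have hp1 : (1 : ℝ) < p := by exact_mod_cast hp.out.one_lt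
  have hp0 : (0 : ℝ) < p := by linarith
  obtain ⟨C, hC1, hC⟩ := weighted_count hα hβ x y h δ hδ
  obtain ⟨C2, hC21, hC2⟩ := exists_lin_bound (p := p) δ hδ
  obtain ⟨C3, hC31, hC3⟩ := exists_lin_bound (p := p) (δ / 2) (by positivity)
  obtain ⟨m0, hm0⟩ : ∃ m0 : ℕ, ∀ m ≥ m0, C * ((m : ℝ) + 1) ≤ (p : ℝ) ^ (δ * m) := by
    obtain ⟨c, hc⟩ := exists_pow_ge (p := p) (C * C3)
    obtain ⟨m0, hm0⟩ := exists_nat_ge (2 * c / δ)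
    refine ⟨m0, fun m hm => ?_⟩
    have hm' : (m0 : ℝ) ≤ m := by exact_mod_cast hm
    have h2 : (c : ℝ) ≤ δ / 2 * m := by
      have : 2 * c / δ ≤ m := hm0.trans hm'
      rw [div_le_iff₀ hδ] at this; linarith
    have h3 : C * C3 ≤ (p : ℝ) ^ (δ / 2 * m) := by
      refine hc.trans ?_
      rw [← Real.rpow_natCast]
      exact Real.rpow_le_rpow_of_exponent_le hp1.le h2
    calc C * ((m : ℝ) + 1) ≤ C * (C3 * (p : ℝ) ^ (δ / 2 * m)) := by gcongr; exact hC3 m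
      _ = C * C3 * (p : ℝ) ^ (δ / 2 * m) := by ring
      _ ≤ (p : ℝ) ^ (δ / 2 * m) * (p : ℝ) ^ (δ / 2 * m) := by gcongr
      _ = _ := by rw [← Real.rpow_add hp0]; congr 1; ring
  refine ⟨m0, C2, hC21, fun m hm S hS k A Ψ hΨ hA => ?_⟩
  refine (hC m S hS k A (fun j => Ψ / (p : ℝ) ^ j) ?_).trans ?_
  · intro j hj s hs
    rw [le_div_iff₀ (by positivity), mul_comm]
    refine hA j hj s fun Q' hQ' => ⟨?_, (hs Q' hQ').2⟩
    rw [(hs Q' hQ').1]; push_cast; rw [← pow_mul]; congr 1; ring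
  · have e1 : ∑ j ∈ Finset.range (m * k + 1), (p : ℝ) ^ j * (Ψ / (p : ℝ) ^ j) = ((m * k : ℕ) + 1) * Ψ := by
      rw [Finset.sum_congr rfl (g := fun _ => Ψ) (fun j _ => by field_simp)]
      simp
    have e2 : ((p : ℝ) ^ (m * k)) ^ (5 * δ) = (p : ℝ) ^ (5 * δ * (m * k : ℕ)) := by
      rw [← Real.rpow_natCast, ← Real.rpow_mul hp0.le]; congr 1; ring
    have e3 : ((p : ℝ) ^ (δ * m) * (p : ℝ) ^ (δ * m)) ^ (2 * k) = (p : ℝ) ^ (4 * δ * (m * k : ℕ)) := by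
      rw [← Real.rpow_add hp0, ← Real.rpow_natCast, ← Real.rpow_mul hp0.le]; congr 1; push_cast; ring
    rw [e1, e2]
    calc _ ≤ ((p : ℝ) ^ (δ * m) * (p : ℝ) ^ (δ * m)) ^ (2 * k) * ((C2 * (p : ℝ) ^ (δ * (m * k : ℕ))) * Ψ) := by
          gcongr
          · exact hm0 m hm
          · exact hC2 _
      _ = C2 * ((p : ℝ) ^ (4 * δ * (m * k : ℕ)) * (p : ℝ) ^ (δ * (m * k : ℕ))) * Ψ := by rw [e3]; ring
      _ = _ := by rw [← Real.rpow_add hp0]; congr 3; ring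

/-- the number theoretic input to the analytic argument -/
theorem NTmain (hα : 0 < α) (hβ : 0 < β) (x y : ℚ_[p]) (h : x ^ 2 + α * y ^ 2 = -(β : ℚ_[p]))
    (U : OO α β) (hU : U.re = 0) (hU0 : U ≠ 0)
    (δ : ℝ) (hδ : 0 < δ) : ∃ m : ℕ, 1 ≤ m ∧ ∃ C : ℝ, 1 ≤ C ∧ 
    (p : ℝ) ^ ((m : ℝ) * (1 - δ)) ≤ ((finite_eq hα hβ ((p : ℤ) ^ m)).toFinset.card : ℝ) ∧
    ∀ (k : ℕ) (θ : ℝ), 0 < θ → θ ≤ 1 →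
      WW (finite_eq hα hβ ((p : ℤ) ^ m)).toFinset (2 * k)
        ({Q : OO α β | (nm (Q - sc ((p : ℤ) ^ (m * k)) 1) : ℝ) ≤ θ ^ 2 * ((p : ℝ) ^ (m * k)) ^ 2}.indicator fun _ => 1) ≤
        C * ((p : ℝ) ^ (m * k)) ^ (1 + δ) * (1 + θ ^ 3 * (p : ℝ) ^ (m * k)) ∧
      WW (finite_eq hα hβ ((p : ℤ) ^ m)).toFinset (2 * k)
        ({Q : OO α β | (nm (Q * U - U * Q) : ℝ) ≤ θ ^ 2 * ((p : ℝ) ^ (m * k)) ^ 2 * nm U}.indicator fun _ => 1) ≤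
        C * ((p : ℝ) ^ (m * k)) ^ (1 + δ) * (1 + θ ^ 2 * (p : ℝ) ^ (m * k)) := by
  have hp1 : (1 : ℝ) < p := by exact_mod_cast hp.out.one_lt
  have hp0 : (0 : ℝ) < p := by linarith
  have hpZ : (p : ℤ) ≠ 0 := by exact_mod_cast hp.out.ne_zero
  obtain ⟨m0, C0, hC0, hcore⟩ := counts_core hα hβ x y h (δ / 7) (by positivity)
  obtain ⟨C1, hC1, h1⟩ := cnt1 hα hβ (δ / 7) (by positivity)
  obtain ⟨C2, hC2, h2⟩ := cnt2 hα hβ U hU hU0 (δ / 7) (by positivity)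
  obtain ⟨c0, hc0, hlow⟩ := lower_bound hα hβ x y h
  obtain ⟨c, hc⟩ := exists_pow_ge (p := p) c0⁻¹
  obtain ⟨m1, hm1⟩ := exists_nat_ge (c / δ)
  obtain ⟨m, hm, hcard⟩ := hlow (max (max m0 m1) 1)
  have hmm0 : m0 ≤ m := by omega
  have hmm1 : m1 ≤ m := by omega
  have hm11 : 1 ≤ m := by omega
  refine ⟨m, hm11, C0 * (4 * C1 + C2), by nlinarith, ?_, fun k θ hθ hθ1 => ?_⟩
  · refine le_trans ?_ hcard
    have e : (p : ℝ) ^ ((m : ℝ) * (1 - δ)) = (p : ℝ) ^ m * ((p : ℝ) ^ (δ * m))⁻¹ := by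
      rw [← Real.rpow_neg hp0.le, ← Real.rpow_natCast, ← Real.rpow_add hp0]; congr 1; ring
    rw [e, mul_comm c0]
    gcongr
    rw [inv_le_comm₀ (by positivity) hc0]
    refine hc.trans ?_
    rw [← Real.rpow_natCast]
    apply Real.rpow_le_rpow_of_exponent_le hp1.le
    have hm' : (m1 : ℝ) ≤ m := by exact_mod_cast hmm1
    have : c / δ ≤ m := hm1.trans hm'
    rw [div_le_iff₀ hδ] at this; linarith
  have hS : ∀ q ∈ (finite_eq hα hβ ((p : ℤ) ^ m)).toFinset, nm q = (p : ℤ) ^ m := by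
    intro q hq; simpa using hq
  set R : ℝ := (p : ℝ) ^ (m * k) with hR
  have hR1 : 1 ≤ R := one_le_pow₀ hp1.le
  have hR0 : 0 < R := by linarith
  have hRR : R ^ (5 * (δ / 7)) * (R ^ (2 * (δ / 7)) * R) = R ^ (1 + δ) := by
    nth_rewrite 3 [← Real.rpow_one R]
    rw [← Real.rpow_add hR0, ← Real.rpow_add hR0]; congr 1; ring
  have hY : ∀ j ≤ m * k, (p : ℝ) ^ j * ((p ^ (m * k - j) : ℕ) : ℝ) = R := by
    intro j hj; push_cast; rw [← pow_add]; congr 1; omega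
  have hYR : ∀ j ≤ m * k, ((p ^ (m * k - j) : ℕ) : ℝ) ≤ R := by
    intro j hj; push_cast; exact pow_le_pow_right₀ hp1.le (by omega)
  have hjR : ∀ j ≤ m * k, (p : ℝ) ^ j ≤ R := by
    intro j hj; exact pow_le_pow_right₀ hp1.le hj
  constructor
  · refine (hcore m hmm0 _ hS k _ (C1 * R ^ (2 * (δ / 7)) * (4 * R * (1 + θ ^ 3 * R))) (by positivity) ?_).trans ?_
    · intro j hj s hs
      have hpj : (0 : ℝ) < (p : ℝ) ^ j := by positivity
      have hY1 : 1 ≤ p ^ (m * k - j) := Nat.one_le_pow _ _ hp.out.pos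
      have := h1 (p ^ (m * k - j)) θ s hY1 hθ hθ1 ?_
      · set Y : ℝ := ((p ^ (m * k - j) : ℕ) : ℝ) with hYdef
        have hY0 : 0 < Y := by rw [hYdef]; exact_mod_cast hY1
        have f1 : Y ^ (2 * (δ / 7)) ≤ R ^ (2 * (δ / 7)) := Real.rpow_le_rpow hY0.le (hYR j hj) (by positivity)
        have f2 : (p : ℝ) ^ j * ((1 + θ ^ 2 * Y) * (1 + 2 * θ * Y)) ≤ 4 * R * (1 + θ ^ 3 * R) := by
          have g1 := hY j hj
          have g2 := hjR j hj
          have g3 := hYR j hj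
          have g4 : θ ^ 2 * R ≤ 1 * R := by gcongr; nlinarith
          have g5 : θ * R ≤ 1 * R := by gcongr
          have g6 : θ ^ 3 * (R * Y) ≤ θ ^ 3 * (R * R) := by gcongr
          have g7 : 0 ≤ θ ^ 3 * (R * R) := by positivity
          calc (p : ℝ) ^ j * ((1 + θ ^ 2 * Y) * (1 + 2 * θ * Y)) = 
            (p : ℝ) ^ j + θ ^ 2 * ((p : ℝ) ^ j * Y) + 2 * (θ * ((p : ℝ) ^ j * Y)) + 2 * (θ ^ 3 * (((p : ℝ) ^ j * Y) * Y)) := by ring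
            _ ≤ _ := by rw [g1]; linarith
        calc (p : ℝ) ^ j * (s.card : ℝ) ≤ (p : ℝ) ^ j * (C1 * Y ^ (2 * (δ / 7)) * (1 + θ ^ 2 * Y) * (1 + 2 * θ * Y)) := by gcongr
          _ = C1 * Y ^ (2 * (δ / 7)) * ((p : ℝ) ^ j * ((1 + θ ^ 2 * Y) * (1 + 2 * θ * Y))) := by ring
          _ ≤ _ := by gcongr
      · intro Q hQ
        obtain ⟨q1, q2⟩ := hs Q hQ
        refine ⟨q1, ?_⟩
        rw [Set.mem_ofPred_eq, ← hY j hj] at q2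
        have e : (sc ((p : ℤ) ^ j) Q - sc ((p : ℤ) ^ (m * k)) 1 : OO α β) = sc ((p : ℤ) ^ j) (Q - sc ((p ^ (m * k - j) : ℕ) : ℤ) 1) := by
          have : (p : ℤ) ^ (m * k) = p ^ j * p ^ (m * k - j) := by rw [← pow_add]; congr 1; omega
          ext <;> simp [this]; ring
        rw [e, nm_sc] at q2
        push_cast at q2 ⊢
        have : ((p : ℝ) ^ j) ^ 2 * (nm (Q - sc ((p : ℤ) ^ (m * k - j)) 1) : ℝ) ≤ ((p : ℝ) ^ j) ^ 2 * (θ ^ 2 * ((p : ℝ) ^ (m * k - j)) ^ 2) := by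
          refine q2.trans (le_of_eq ?_); ring
        exact le_of_mul_le_mul_left this (by positivity)
    · calc _ = (4 * C0 * C1) * (R ^ (5 * (δ / 7)) * (R ^ (2 * (δ / 7)) * R)) * (1 + θ ^ 3 * R) := by ring
        _ ≤ (C0 * (4 * C1 + C2)) * (R ^ (5 * (δ / 7)) * (R ^ (2 * (δ / 7)) * R)) * (1 + θ ^ 3 * R) := by
          have : 0 ≤ C0 * C2 := by positivity
          have : 0 ≤ C0 * C1 := by positivity
          refine mul_le_mul_of_nonneg_right (mul_le_mul_of_nonneg_right (by nlinarith) (by positivity)) (by positivity)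
        _ = _ := by rw [hRR]
  · refine (hcore m hmm0 _ hS k _ (C2 * R ^ (2 * (δ / 7)) * (R * (1 + θ ^ 2 * R))) (by positivity) ?_).trans ?_
    · intro j hj s hs
      have hpj : (0 : ℝ) < (p : ℝ) ^ j := by positivity
      have hY1 : 1 ≤ p ^ (m * k - j) := Nat.one_le_pow _ _ hp.out.pos
      have := h2 (p ^ (m * k - j)) θ s hY1 hθ hθ1 ?_
      · set Y : ℝ := ((p ^ (m * k - j) : ℕ) : ℝ) with hYdef
        have hY0 : 0 < Y := by rw [hYdef]; exact_mod_cast hY1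
        have f1 : Y ^ (2 * (δ / 7)) ≤ R ^ (2 * (δ / 7)) := Real.rpow_le_rpow hY0.le (hYR j hj) (by positivity)
        have f2 : (p : ℝ) ^ j * (1 + θ ^ 2 * Y ^ 2) ≤ R * (1 + θ ^ 2 * R) := by
          have g1 := hY j hj
          have g2 := hjR j hj
          have g3 := hYR j hj
          have g6 : θ ^ 2 * (R * Y) ≤ θ ^ 2 * (R * R) := by gcongr
          calc (p : ℝ) ^ j * (1 + θ ^ 2 * Y ^ 2) = 
            (p : ℝ) ^ j + θ ^ 2 * (((p : ℝ) ^ j * Y) * Y) := by ring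
            _ ≤ _ := by rw [g1]; linarith
        calc (p : ℝ) ^ j * (s.card : ℝ) ≤ (p : ℝ) ^ j * (C2 * Y ^ (2 * (δ / 7)) * (1 + θ ^ 2 * Y ^ 2)) := by gcongr
          _ = C2 * Y ^ (2 * (δ / 7)) * ((p : ℝ) ^ j * (1 + θ ^ 2 * Y ^ 2)) := by ring
          _ ≤ _ := by gcongr
      · intro Q hQ
        obtain ⟨q1, q2⟩ := hs Q hQ
        refine ⟨q1, ?_⟩
        rw [Set.mem_ofPred_eq, ← hY j hj] at q2
        have e : (sc ((p : ℤ) ^ j) Q * U - U * sc ((p : ℤ) ^ j) Q : OO α β) = sc ((p : ℤ) ^ j) (Q * U - U * Q) := by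
          rw [sc_mul, mul_sc]; ext <;> simp <;> ring
        rw [e, nm_sc] at q2
        push_cast at q2 ⊢
        have : ((p : ℝ) ^ j) ^ 2 * (nm (Q * U - U * Q) : ℝ) ≤ ((p : ℝ) ^ j) ^ 2 * (θ ^ 2 * ((p : ℝ) ^ (m * k - j)) ^ 2 * nm U) := by
          refine q2.trans (le_of_eq ?_); ring
        exact le_of_mul_le_mul_left this (by positivity)
    · calc _ = (C0 * C2) * (R ^ (5 * (δ / 7)) * (R ^ (2 * (δ / 7)) * R)) * (1 + θ ^ 2 * R) := by ring
        _ ≤ (C0 * (4 * C1 + C2)) * (R ^ (5 * (δ / 7)) * (R ^ (2 * (δ / 7)) * R)) * (1 + θ ^ 2 * R) := by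
          have : 0 ≤ C0 * C2 := by positivity
          have : 0 ≤ C0 * C1 := by positivity
          refine mul_le_mul_of_nonneg_right (mul_le_mul_of_nonneg_right (by nlinarith) (by positivity)) (by positivity)
        _ = _ := by rw [hRR]
end OO
end

noncomputable section



lemma isotropic_of (a b c : ℕ) (hb : 0 < b) (hc : 0 < c) (p : ℕ) [hp : Fact p.Prime] (u0 u1 u2 : ℚ_[p])
    (hu : u0 ≠ 0 ∨ u1 ≠ 0 ∨ u2 ≠ 0) (h : (a : ℚ_[p]) * u0 ^ 2 + b * u1 ^ 2 + c * u2 ^ 2 = 0) :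
    ∃ x y : ℚ_[p], x ^ 2 + ((b * c : ℕ) : ℚ_[p]) * y ^ 2 = -((c * a : ℕ) : ℚ_[p]) := by
  have hb0 : (b : ℚ_[p]) ≠ 0 := by exact_mod_cast hb.ne'
  have hc0 : (c : ℚ_[p]) ≠ 0 := by exact_mod_cast hc.ne'
  by_cases h0 : u0 = 0
  · subst h0
    have h1 : u1 ≠ 0 := by
      rintro rfl
      have : u2 ^ 2 = 0 := by simpa [hc0] using h
      rcases hu with h | h | h
      · exact h rfl
      · exact h rfl
      · exact h (by simpa using this)
    have h2 : u2 ≠ 0 := by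
      rintro rfl
      have : u1 ^ 2 = 0 := by simpa [hb0] using h
      exact h1 (by simpa using this)
    refine ⟨(1 - c * a) / 2, (1 + c * a) / (2 * (c * u2 / u1)), ?_⟩
    push_cast
    have e : (c : ℚ_[p]) * u2 ^ 2 = - (b * u1 ^ 2) := by linear_combination h
    field_simp
    linear_combination (-(1 - (c : ℚ_[p]) * a) ^ 2 * 0 + (1 + (c : ℚ_[p]) * a) ^ 2) * h
  · refine ⟨c * u2 / u0, u1 / u0, ?_⟩
    push_cast
    field_simp
    linear_combination h

lemma isotropy (a b c d : ℕ) (hb : 0 < b) (hc : 0 < c) (p : ℕ) [hp : Fact p.Prime]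
    (hnd : ¬ DiscreteTopology ↥(ellipsoidZinvp a b c d p)) : 
    ∃ x y : ℚ_[p], x ^ 2 + ((b * c : ℕ) : ℚ_[p]) * y ^ 2 = -((c * a : ℕ) : ℚ_[p]) := by
  have hp1 : (1 : ℝ) < p := by exact_mod_cast hp.out.one_lt
  have hp0 : (0 : ℝ) < p := by linarith
  have hpZ : (p : ℤ) ≠ 0 := by exact_mod_cast hp.out.ne_zero
  -- unbounded denominators
  have unb : ∀ n : ℕ, ∃ r ∈ ellipsoidZinvp a b c d p, ∃ i, ∀ z : ℤ, r i ≠ z / (p : ℝ) ^ n := by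
    intro n
    by_contra hcon
    push Not at hcon
    apply hnd
    refine DiscreteTopology.of_forall_le_dist (r := 1 / (p : ℝ) ^ n) (by positivity) ?_
    rintro ⟨x, hx⟩ ⟨y, hy⟩ hxy
    have hne : x ≠ y := fun h => hxy (by simp [h])
    obtain ⟨i, hi⟩ := Function.ne_iff.mp hne
    obtain ⟨z, hz⟩ := hcon x hx i
    obtain ⟨w, hw⟩ := hcon y hy i
    have hzw : z ≠ w := by rintro rfl; exact hi (hz.trans hw.symm)
    have h1 : (1 : ℝ) ≤ |(z : ℝ) - w| := by
      have : (1 : ℤ) ≤ |z - w| := Int.one_le_abs (sub_ne_zero.mpr hzw)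
      exact_mod_cast this
    show 1 / (p : ℝ) ^ n ≤ dist x y
    refine le_trans ?_ (dist_le_pi_dist x y i)
    rw [hz, hw, Real.dist_eq, ← sub_div, abs_div, abs_of_pos (by positivity : (0 : ℝ) < (p : ℝ) ^ n)]
    gcongr
  have vecs : ∀ n : ℕ, ∃ u : Fin 3 → ℤ, (∃ i, ¬ (p : ℤ) ∣ u i) ∧ 
      ((p : ℤ) ^ n) ∣ a * u 0 ^ 2 + b * u 1 ^ 2 + c * u 2 ^ 2 := by
    intro n
    obtain ⟨r, ⟨hr, hrz⟩, i, hi⟩ := unb n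
    classical
    have hex : ∃ k : ℕ, ∀ i, ∃ z : ℤ, r i = z / (p : ℝ) ^ k := by
      choose z k hzk using hrz
      refine ⟨∑ i, k i, fun i => ⟨z i * p ^ (∑ j, k j - k i), ?_⟩⟩
      have hle : k i ≤ ∑ j, k j := Finset.single_le_sum (f := k) (fun _ _ => Nat.zero_le _) (Finset.mem_univ i)
      rw [hzk i]
      push_cast
      have : (p : ℝ) ^ (∑ j, k j) = p ^ (∑ j, k j - k i) * p ^ (k i) := by rw [← pow_add]; congr 1; omega
      rw [this]; field_simp
    set k := Nat.find hex with hk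
    have hkspec := Nat.find_spec hex
    rw [← hk] at hkspec
    choose u hu using hkspec
    have hnk : n < k := by
      by_contra hle
      push Not at hle
      apply hi (u i * p ^ (n - k))
      rw [hu i]
      push_cast
      have : (p : ℝ) ^ n = p ^ (n - k) * p ^ k := by rw [← pow_add]; congr 1; omega
      rw [this]; field_simp
    refine ⟨u, ?_, ?_⟩
    · by_contra hcon
      push Not at hcon
      choose w hw using hcon
      have : ∀ i, ∃ z : ℤ, r i = z / (p : ℝ) ^ (k - 1) := by
        intro i
        refine ⟨w i, ?_⟩
        rw [hu i, hw i]
        have : (p : ℝ) ^ k = p ^ (k - 1) * p := by rw [← pow_succ]; congr 1; omega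
        push_cast
        rw [this]; field_simp
      have := Nat.find_min' hex this
      omega
    · have hr' : (a : ℝ) * r 0 ^ 2 + b * r 1 ^ 2 + c * r 2 ^ 2 = d := hr
      rw [hu 0, hu 1, hu 2] at hr'
      have e : (a : ℤ) * u 0 ^ 2 + b * u 1 ^ 2 + c * u 2 ^ 2 = p ^ n * (p ^ (2 * k - n) * d) := by
        have : (p : ℝ) ^ n * (p ^ (2 * k - n) * d) = (p ^ k) ^ 2 * d := by
          rw [← mul_assoc, ← pow_add, ← pow_mul]; congr 2; omega
        have e' : (a : ℝ) * u 0 ^ 2 + b * u 1 ^ 2 + c * u 2 ^ 2 = p ^ n * (p ^ (2 * k - n) * d) := by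
          rw [this, ← hr']; field_simp
        exact_mod_cast e'
      exact ⟨_, e⟩
  set K : Set (Fin 3 → ℤ_[p]) := {u | ‖u‖ = 1} with hK
  have hKc : IsCompact K := (isClosed_eq continuous_norm continuous_const).isCompact
  have hcont : Continuous (fun u : Fin 3 → ℤ_[p] => ‖(a : ℤ_[p]) * u 0 ^ 2 + b * u 1 ^ 2 + c * u 2 ^ 2‖) := by fun_prop
  have hmem : ∀ u : Fin 3 → ℤ, (∃ i, ¬ (p : ℤ) ∣ u i) → (fun i => (u i : ℤ_[p])) ∈ K := by
    rintro u ⟨i, hi⟩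
    rw [hK, Set.mem_ofPred_eq]
    apply le_antisymm
    · rw [pi_norm_le_iff_of_nonneg zero_le_one]
      intro j; exact PadicInt.norm_le_one _
    · have : ‖(u i : ℤ_[p])‖ = 1 := by
        rcases (PadicInt.norm_le_one (u i : ℤ_[p])).lt_or_eq with h | h
        · exact absurd ((PadicInt.norm_int_lt_one_iff_dvd _).mp h) hi
        · exact h
      rw [← this]
      exact norm_le_pi_norm (fun i => (u i : ℤ_[p])) i
  obtain ⟨u1, hu1, -⟩ := vecs 0
  obtain ⟨v, hvK, hv⟩ := hKc.exists_isMinOn ⟨_, hmem u1 hu1⟩ hcont.continuousOn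
  have hv0 : ‖(a : ℤ_[p]) * v 0 ^ 2 + b * v 1 ^ 2 + c * v 2 ^ 2‖ = 0 := by
    apply le_antisymm _ (norm_nonneg _)
    apply le_of_forall_pos_le_add
    intro ε hε
    obtain ⟨n, hn⟩ := exists_pow_lt_of_lt_one hε (inv_lt_one_of_one_lt₀ hp1)
    obtain ⟨u, hu, hdiv⟩ := vecs n
    have h1 := hv (hmem u hu)
    simp only [Set.mem_ofPred_eq] at h1
    refine h1.trans ?_
    have h2 : ‖(((a : ℤ) * u 0 ^ 2 + b * u 1 ^ 2 + c * u 2 ^ 2 : ℤ) : ℤ_[p])‖ ≤ (p : ℝ) ^ (-(n : ℤ)) :=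
      PadicInt.norm_int_le_pow_iff_dvd.mpr (by exact_mod_cast hdiv)
    push_cast at h2
    refine h2.trans ?_
    rw [zpow_neg, zpow_natCast, ← inv_pow]
    linarith
  rw [norm_eq_zero] at hv0
  refine isotropic_of a b c hb hc p (v 0) (v 1) (v 2) ?_ ?_
  · by_contra hcon
    push Not at hcon
    have : v = 0 := by
      ext i
      fin_cases i
      · exact Subtype.ext hcon.1
      · exact Subtype.ext hcon.2.1
      · exact Subtype.ext hcon.2.2
    rw [hK, Set.mem_ofPred_eq, this] at hvK
    simp at hvK
  · exact_mod_cast congrArg (fun z : ℤ_[p] => (z : ℚ_[p])) hv0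
end

noncomputable section
open scoped Quaternion

abbrev GG : Type := Metric.sphere (0 : ℍ[ℝ]) 1
instance instMeasurableSpaceGG : MeasurableSpace GG := borel GG
instance instBorelSpaceGG : BorelSpace GG := ⟨rfl⟩
def mu : Measure GG := Measure.haarMeasure ⊤
instance instHaarMu : Measure.IsHaarMeasure mu := by unfold mu; infer_instance
instance instProbMu : IsProbabilityMeasure mu := ⟨by
  unfold mu
  have := Measure.haarMeasure_self (K₀ := (⊤ : TopologicalSpace.PositiveCompacts GG))
  simpa using this⟩

lemma eq_mu_of_left (ν : Measure GG) [IsProbabilityMeasure ν] [ν.IsMulLeftInvariant] : ν = mu := by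
  have h := Measure.isMulInvariant_eq_smul_of_compactSpace ν mu
  have h1 : ν Set.univ = (Measure.haarScalarFactor ν mu : NNReal) • mu Set.univ := by
    conv_lhs => rw [h]
    rfl
  rw [measure_univ, measure_univ] at h1
  have h2 : Measure.haarScalarFactor ν mu = 1 := by
    rw [ENNReal.smul_def, smul_eq_mul, mul_one] at h1
    exact_mod_cast h1.symm
  rw [h, h2, one_smul]

instance instRightMu : mu.IsMulRightInvariant := ⟨fun g => by
  have : IsProbabilityMeasure (Measure.map (fun x => x * g) mu) :=
    Measure.isProbabilityMeasure_map (by fun_prop)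
  exact eq_mu_of_left _⟩

instance instInvMu : mu.IsInvInvariant := ⟨by
  have : IsProbabilityMeasure mu.inv :=
    Measure.isProbabilityMeasure_map (by fun_prop)
  exact eq_mu_of_left _⟩

lemma intg {f : GG → ℝ} (hf : Continuous f) : Integrable f mu :=
  hf.integrable_of_hasCompactSupport (HasCompactSupport.of_compactSpace f)

/-- the `L²` inner product. -/
def ip : LinearMap.BilinForm ℝ C(GG, ℝ) :=
  LinearMap.mk₂ ℝ (fun f h => ∫ x, f x * h x ∂mu)
    (fun f f' h => by
      simp only [ContinuousMap.add_apply, add_mul]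
      exact integral_add (intg (by fun_prop)) (intg (by fun_prop)))
    (fun c f h => by
      simp only [ContinuousMap.smul_apply, smul_eq_mul, mul_assoc]
      exact integral_const_mul _ _)
    (fun f h h' => by
      simp only [ContinuousMap.add_apply, mul_add]
      exact integral_add (intg (by fun_prop)) (intg (by fun_prop)))
    (fun c f h => by
      simp only [ContinuousMap.smul_apply, smul_eq_mul, mul_left_comm]
      exact integral_const_mul _ _)

lemma ip_apply (f h : C(GG, ℝ)) : ip f h = ∫ x, f x * h x ∂mu := rfl
lemma ip_symm (f h : C(GG, ℝ)) : ip f h = ip h f := by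
  simp only [ip_apply, mul_comm]
lemma ip_nonneg (f : C(GG, ℝ)) : 0 ≤ ip f f := by
  rw [ip_apply]; exact integral_nonneg fun x => mul_self_nonneg _
lemma ip_eq_zero {f : C(GG, ℝ)} (h : ip f f = 0) : f = 0 := by
  have hc : Continuous fun x => f x * f x := f.continuous.mul f.continuous
  rw [ip_apply, integral_eq_zero_iff_of_nonneg (fun x => mul_self_nonneg _) (intg hc)] at h
  have h2 := (Continuous.ae_eq_iff_eq mu hc continuous_zero).1 h
  ext x
  have := congrFun h2 x
  simpa using this
lemma ip_pos {f : C(GG, ℝ)} (h : f ≠ 0) : 0 < ip f f :=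
  lt_of_le_of_ne (ip_nonneg f) fun h' => h (ip_eq_zero h'.symm)

lemma ip_mul_mul (f g h : C(GG, ℝ)) : ip (f * g) h = ip f (g * h) := by
  simp only [ip_apply, ContinuousMap.mul_apply, mul_assoc]

/-- Cauchy–Schwarz -/
lemma ip_cs (f h : C(GG, ℝ)) : (ip f h) ^ 2 ≤ ip f f * ip h h := by
  by_cases hh : h = 0
  · subst hh; simp
  have hp := ip_pos hh
  have := ip_nonneg (ip h h • f - ip f h • h)
  simp only [map_sub, map_smul, LinearMap.sub_apply, LinearMap.smul_apply, smul_eq_mul] at this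
  rw [ip_symm h f] at this
  have h3 : 0 ≤ ip h h * (ip f f * ip h h - (ip f h)^2) := by nlinarith
  have := nonneg_of_mul_nonneg_right h3 hp
  linarith

/-- left translation -/
def Lg (g : GG) : C(GG, ℝ) →ₐ[ℝ] C(GG, ℝ) :=
  ContinuousMap.compRightAlgHom ℝ ℝ (⟨fun x => g⁻¹ * x, by fun_prop⟩ : C(GG, GG))

@[simp] lemma Lg_apply (g : GG) (f : C(GG, ℝ)) (x : GG) : Lg g f x = f (g⁻¹ * x) := rfl
lemma Lg_mul (g h : GG) (f : C(GG, ℝ)) : Lg (g * h) f = Lg g (Lg h f) := by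
  ext x; simp [mul_assoc]
lemma Lg_one (f : C(GG, ℝ)) : Lg 1 f = f := by
  ext x; simp
lemma integral_Lg (g : GG) (f : GG → ℝ) : ∫ x, f (g⁻¹ * x) ∂mu = ∫ x, f x ∂mu :=
  integral_mul_left_eq_self f g⁻¹
lemma ip_Lg (g : GG) (f h : C(GG, ℝ)) : ip (Lg g f) (Lg g h) = ip f h := by
  simp only [ip_apply, Lg_apply]
  exact integral_Lg g (fun x => f x * h x)
lemma ip_Lg_left (g : GG) (f h : C(GG, ℝ)) : ip (Lg g f) h = ip f (Lg g⁻¹ h) := by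
  rw [← ip_Lg g f (Lg g⁻¹ h), ← Lg_mul]; simp [Lg_one]
lemma ip_one (f : C(GG, ℝ)) : ip 1 f = ∫ x, f x ∂mu := by simp [ip_apply]

/-! ### abstract finite-dimensional facts -/
lemma eig_bound {E : Type*} [AddCommGroup E] [Module ℝ E] [FiniteDimensional ℝ E]
    (B : LinearMap.BilinForm ℝ E) (hs : ∀ f h, B f h = B h f) (hpos : ∀ f, f ≠ 0 → 0 < B f f)
    (T : E →ₗ[ℝ] E) (hT : ∀ f h, B (T f) h = B f (T h)) (c : ℝ)
    (hc : ∀ (l : ℝ) (f : E), f ≠ 0 → T f = l • f → |l| ≤ c) (f : E) :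
    B (T f) (T f) ≤ c ^ 2 * B f f := by
  let core : InnerProductSpace.Core ℝ E :=
    { inner := fun f h => B f h
      conj_inner_symm := fun f h => by simpa using hs h f
      re_inner_nonneg := fun f => by
        by_cases h : f = 0
        · subst h; simp
        · simpa using (hpos f h).le
      add_left := fun f g h => by simp
      smul_left := fun f g h => by simp
      definite := fun f hf => by
        by_contra h
        exact (hpos f h).ne' hf }
  let : NormedAddCommGroup E := core.toNormedAddCommGroup
  let : InnerProductSpace ℝ E := InnerProductSpace.ofCore core.toCore
  have hin : ∀ f h : E, inner ℝ f h = B f h := fun f h => rfl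
  have hsym : T.IsSymmetric := fun f h => by rw [hin, hin]; exact hT f h
  let b := hsym.eigenvectorBasis rfl
  have key : ∀ f : E, B f f = ∑ i, (inner ℝ (b i) f) ^ 2 := by
    intro f
    rw [← hin, real_inner_self_eq_norm_sq, ← b.sum_sq_norm_inner_right f]
    simp
  rw [key, key, Finset.mul_sum]
  refine Finset.sum_le_sum fun i _ => ?_
  have h1 : inner ℝ (b i) (T f) = hsym.eigenvalues rfl i * inner ℝ (b i) f := by
    rw [← hsym, hsym.apply_eigenvectorBasis]
    simp [b, inner_smul_left]
  rw [h1, mul_pow]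
  have h2 := hc (hsym.eigenvalues rfl i) (b i) (b.orthonormal.ne_zero i) (by
    exact hsym.apply_eigenvectorBasis rfl i)
  refine mul_le_mul_of_nonneg_right ?_ (sq_nonneg _)
  rw [← sq_abs]
  exact pow_le_pow_left₀ (abs_nonneg _) h2 2

lemma proj_exists (W : Submodule ℝ C(GG, ℝ)) [FiniteDimensional ℝ W] (f : C(GG, ℝ)) :
    ∃ g ∈ W, ∀ h ∈ W, ip (f - g) h = 0 := by
  let Φ : W →ₗ[ℝ] Module.Dual ℝ W := (ip.compl₁₂ W.subtype W.subtype)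
  have hinj : Function.Injective Φ := by
    rw [← LinearMap.ker_eq_bot, LinearMap.ker_eq_bot']
    intro m hm
    have : ip (m : C(GG, ℝ)) m = 0 := by
      have := congrArg (fun φ => φ m) hm
      simpa [Φ] using this
    exact Subtype.ext (ip_eq_zero this)
  have hsurj := (LinearMap.injective_iff_surjective_of_finrank_eq_finrank
    (Subspace.dual_finrank_eq (K := ℝ) (V := W)).symm).1 hinj
  obtain ⟨g, hg⟩ := hsurj ((ip f).comp W.subtype)
  refine ⟨g, g.2, fun h hh => ?_⟩
  have := congrArg (fun φ => φ ⟨h, hh⟩) hg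
  simp only [Φ, LinearMap.compl₁₂_apply, Submodule.subtype_apply, LinearMap.comp_apply] at this
  rw [map_sub, LinearMap.sub_apply, this, sub_self]
end

noncomputable section
open scoped Quaternion

lemma GG_nsq (g : GG) : (g : ℍ[ℝ]).re ^ 2 + (g : ℍ[ℝ]).imI ^ 2 + (g : ℍ[ℝ]).imJ ^ 2
    + (g : ℍ[ℝ]).imK ^ 2 = 1 := by
  have h : ‖(g : ℍ[ℝ])‖ = 1 := by simp
  have h2 := Quaternion.normSq_eq_norm_mul_self (g : ℍ[ℝ])
  rw [h, Quaternion.normSq_def'] at h2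
  linarith

/-- constructor for real quaternions -/
def qmk (w x y z : ℝ) : ℍ[ℝ] := ⟨w, x, y, z⟩
@[simp] lemma qmk_re (w x y z : ℝ) : (qmk w x y z).re = w := rfl
@[simp] lemma qmk_imI (w x y z : ℝ) : (qmk w x y z).imI = x := rfl
@[simp] lemma qmk_imJ (w x y z : ℝ) : (qmk w x y z).imJ = y := rfl
@[simp] lemma qmk_imK (w x y z : ℝ) : (qmk w x y z).imK = z := rfl

lemma mem_GG {w x y z : ℝ} (h : w ^ 2 + x ^ 2 + y ^ 2 + z ^ 2 = 1) :
    (qmk w x y z) ∈ Metric.sphere (0 : ℍ[ℝ]) 1 := by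
  have h2 := Quaternion.normSq_eq_norm_mul_self (qmk w x y z)
  rw [Quaternion.normSq_def'] at h2
  simp only [qmk_re, qmk_imI, qmk_imJ, qmk_imK] at h2
  rw [h] at h2
  simp only [mem_sphere_iff_norm, sub_zero]
  have := norm_nonneg (qmk w x y z)
  nlinarith

/-- constructor -/
def mkG (w x y z : ℝ) (h : w ^ 2 + x ^ 2 + y ^ 2 + z ^ 2 = 1) : GG := ⟨qmk w x y z, mem_GG h⟩

lemma coe_inv_GG (g : GG) : ((g⁻¹ : GG) : ℍ[ℝ]) = star (g : ℍ[ℝ]) := by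
  have h1 : ((g⁻¹ : GG) : ℍ[ℝ]) = (g : ℍ[ℝ])⁻¹ := rfl
  rw [h1, Quaternion.instInv]
  simp [Quaternion.normSq_def', GG_nsq]

lemma coe_mul_GG (g h : GG) : ((g * h : GG) : ℍ[ℝ]) = (g : ℍ[ℝ]) * h := rfl
lemma coe_one_GG : ((1 : GG) : ℍ[ℝ]) = 1 := rfl

lemma cont_re : Continuous fun g : GG => (g : ℍ[ℝ]).re := Quaternion.continuous_re.comp continuous_subtype_val
lemma cont_imI : Continuous fun g : GG => (g : ℍ[ℝ]).imI := Quaternion.continuous_imI.comp continuous_subtype_val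
lemma cont_imJ : Continuous fun g : GG => (g : ℍ[ℝ]).imJ := Quaternion.continuous_imJ.comp continuous_subtype_val
lemma cont_imK : Continuous fun g : GG => (g : ℍ[ℝ]).imK := Quaternion.continuous_imK.comp continuous_subtype_val

/-- coordinates of `g i g⁻¹`. -/
def c1 : C(GG, ℝ) := ⟨fun g => (g : ℍ[ℝ]).re ^ 2 + (g : ℍ[ℝ]).imI ^ 2 - (g : ℍ[ℝ]).imJ ^ 2
    - (g : ℍ[ℝ]).imK ^ 2,
  (((cont_re.pow 2).add (cont_imI.pow 2)).sub (cont_imJ.pow 2)).sub (cont_imK.pow 2)⟩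
def c2 : C(GG, ℝ) := ⟨fun g => 2 * ((g : ℍ[ℝ]).imI * (g : ℍ[ℝ]).imJ + (g : ℍ[ℝ]).re * (g : ℍ[ℝ]).imK),
  continuous_const.mul ((cont_imI.mul cont_imJ).add (cont_re.mul cont_imK))⟩
def c3 : C(GG, ℝ) := ⟨fun g => 2 * ((g : ℍ[ℝ]).imI * (g : ℍ[ℝ]).imK - (g : ℍ[ℝ]).re * (g : ℍ[ℝ]).imJ),
  continuous_const.mul ((cont_imI.mul cont_imK).sub (cont_re.mul cont_imJ))⟩

/-- rotated pole -/
def pole (g : GG) : ℍ[ℝ] := qmk 0 (c1 g) (c2 g) (c3 g)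

lemma pole_eq (g : GG) : pole g = (g : ℍ[ℝ]) * (qmk 0 1 0 0) * star (g : ℍ[ℝ]) := by
  ext <;> simp [pole, c1, c2, c3] <;> ring

lemma pole_mul (g h : GG) : pole (g * h) = (g : ℍ[ℝ]) * pole h * star (g : ℍ[ℝ]) := by
  rw [pole_eq, pole_eq, coe_mul_GG, star_mul]; simp only [mul_assoc]

lemma pole_inv_mul (g h : GG) : pole (g⁻¹ * h) = star (g : ℍ[ℝ]) * pole h * (g : ℍ[ℝ]) := by
  rw [pole_mul, coe_inv_GG, star_star]

lemma cc_sq (g : GG) : c1 g ^ 2 + c2 g ^ 2 + c3 g ^ 2 = 1 := by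
  have h := GG_nsq g
  simp only [c1, c2, c3, ContinuousMap.coe_mk]
  linear_combination ((g : ℍ[ℝ]).re ^ 2 + (g : ℍ[ℝ]).imI ^ 2 + (g : ℍ[ℝ]).imJ ^ 2
    + (g : ℍ[ℝ]).imK ^ 2 + 1) * h

/-- the spaces of polynomials on the 2-sphere -/
def VV : Submodule ℝ C(GG, ℝ) := Submodule.span ℝ {1, c1, c2, c3}

lemma one_mem_VV : (1 : C(GG, ℝ)) ∈ VV := Submodule.subset_span (by simp)
lemma c1_mem_VV : c1 ∈ VV := Submodule.subset_span (by simp)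
lemma c2_mem_VV : c2 ∈ VV := Submodule.subset_span (by simp)
lemma c3_mem_VV : c3 ∈ VV := Submodule.subset_span (by simp)

lemma VV_fg : VV.FG := Submodule.fg_span (Set.toFinite _)
lemma VVpow_fg (d : ℕ) : (VV ^ d).FG := VV_fg.pow d
instance instVVfin (d : ℕ) : FiniteDimensional ℝ (VV ^ d : Submodule ℝ C(GG, ℝ)) :=
  Module.Finite.iff_fg.2 (VVpow_fg d)

lemma VV_mono : Monotone fun d : ℕ => (VV ^ d : Submodule ℝ C(GG, ℝ)) := by
  refine monotone_nat_of_le_succ fun d => ?_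
  rw [pow_succ]
  intro f hf
  simpa using Submodule.mul_mem_mul hf one_mem_VV

lemma VV_mul {d e : ℕ} {f h : C(GG, ℝ)} (hf : f ∈ VV ^ d) (hh : h ∈ VV ^ e) : f * h ∈ VV ^ (d + e) := by
  rw [pow_add]; exact Submodule.mul_mem_mul hf hh

lemma VV_lin (f : C(GG, ℝ)) (a0 a1 a2 a3 : ℝ) (h : ∀ x, f x = a0 + a1 * c1 x + a2 * c2 x + a3 * c3 x) :
    f ∈ VV := by
  have : f = a0 • (1 : C(GG, ℝ)) + a1 • c1 + a2 • c2 + a3 • c3 := by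
    ext x; simp [h]
  rw [this]
  exact VV.add_mem (VV.add_mem (VV.add_mem (VV.smul_mem _ one_mem_VV) (VV.smul_mem _ c1_mem_VV))
    (VV.smul_mem _ c2_mem_VV)) (VV.smul_mem _ c3_mem_VV)

/-- explicit action -/
lemma Lg_c1 (g x : GG) : Lg g c1 x = (star (g : ℍ[ℝ]) * pole x * (g : ℍ[ℝ])).imI := by
  rw [Lg_apply, ← pole_inv_mul]; rfl
lemma Lg_c2 (g x : GG) : Lg g c2 x = (star (g : ℍ[ℝ]) * pole x * (g : ℍ[ℝ])).imJ := by
  rw [Lg_apply, ← pole_inv_mul]; rfl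
lemma Lg_c3 (g x : GG) : Lg g c3 x = (star (g : ℍ[ℝ]) * pole x * (g : ℍ[ℝ])).imK := by
  rw [Lg_apply, ← pole_inv_mul]; rfl

lemma VV_Lg (g : GG) : VV.map (Lg g).toLinearMap ≤ VV := by
  rw [VV, Submodule.map_span, Submodule.span_le]
  rintro _ ⟨f, hf, rfl⟩
  simp only [Set.mem_insert_iff, Set.mem_singleton_iff] at hf
  rw [AlgHom.toLinearMap_apply]
  generalize hq : (g : ℍ[ℝ]) = q
  rcases hf with rfl | rfl | rfl | rfl
  · rw [map_one]; exact one_mem_VV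
  · refine VV_lin _ 0 ((star q * (qmk 0 1 0 0) * q).imI) ((star q * (qmk 0 0 1 0) * q).imI)
      ((star q * (qmk 0 0 0 1) * q).imI) fun x => ?_
    rw [Lg_c1, hq]; simp [pole]; ring
  · refine VV_lin _ 0 ((star q * (qmk 0 1 0 0) * q).imJ) ((star q * (qmk 0 0 1 0) * q).imJ)
      ((star q * (qmk 0 0 0 1) * q).imJ) fun x => ?_
    rw [Lg_c2, hq]; simp [pole]; ring
  · refine VV_lin _ 0 ((star q * (qmk 0 1 0 0) * q).imK) ((star q * (qmk 0 0 1 0) * q).imK)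
      ((star q * (qmk 0 0 0 1) * q).imK) fun x => ?_
    rw [Lg_c3, hq]; simp [pole]; ring

lemma VVpow_Lg (g : GG) (d : ℕ) {f : C(GG, ℝ)} (hf : f ∈ VV ^ d) : Lg g f ∈ VV ^ d := by
  have h1 : (VV ^ d).map (Lg g).toLinearMap ≤ VV ^ d := by
    rw [Submodule.map_pow]
    exact pow_le_pow_left' (VV_Lg g) d
  exact h1 ⟨f, hf, rfl⟩

/-! ### one-parameter subgroups -/
/-- `cos s + n sin s` -/
def gs (n : ℝ × ℝ × ℝ) (hn : n.1 ^ 2 + n.2.1 ^ 2 + n.2.2 ^ 2 = 1) (s : ℝ) : GG :=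
  mkG (Real.cos s) (n.1 * Real.sin s) (n.2.1 * Real.sin s) (n.2.2 * Real.sin s) (by
    linear_combination (Real.sin s) ^ 2 * hn + Real.sin_sq_add_cos_sq s)

lemma gs_neg (n) (hn) (s : ℝ) : gs n hn (-s) = (gs n hn s)⁻¹ := by
  apply Subtype.ext
  rw [coe_inv_GG]
  ext <;> simp [gs, mkG]

lemma gs_zero (n) (hn) : gs n hn 0 = 1 := by
  apply Subtype.ext
  rw [coe_one_GG]
  ext <;> simp [gs, mkG]

/-- trigonometric polynomials of degree `≤ d` with coefficients in `C(GG,ℝ)` -/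
def TS (d : ℕ) : Submodule ℝ (ℝ → C(GG, ℝ)) :=
  Submodule.span ℝ ({F | ∃ n ≤ d, ∃ a : C(GG, ℝ), F = fun s => (Real.cos (2 * s)) ^ n • a} ∪
    {F | ∃ n < d, ∃ a : C(GG, ℝ), F = fun s => (Real.sin (2 * s) * (Real.cos (2 * s)) ^ n) • a})

lemma TS_cos {d n : ℕ} (h : n ≤ d) (a : C(GG, ℝ)) : (fun s => (Real.cos (2 * s)) ^ n • a) ∈ TS d :=
  Submodule.subset_span (Or.inl ⟨n, h, a, rfl⟩)
lemma TS_sin {d n : ℕ} (h : n < d) (a : C(GG, ℝ)) :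
    (fun s => (Real.sin (2 * s) * (Real.cos (2 * s)) ^ n) • a) ∈ TS d :=
  Submodule.subset_span (Or.inr ⟨n, h, a, rfl⟩)

lemma TS_mul (d : ℕ) : TS d * TS 1 ≤ TS (d + 1) := by
  conv_lhs => rw [TS, TS]
  rw [Submodule.span_mul_span, Submodule.span_le]
  rintro _ ⟨F, hF, G, hG, rfl⟩
  rw [SetLike.mem_coe]
  change F * G ∈ _
  rcases hF with ⟨n, hn, a, rfl⟩ | ⟨n, hn, a, rfl⟩ <;> rcases hG with ⟨m, hm, b, rfl⟩ | ⟨m, hm, b, rfl⟩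
  · convert TS_cos (d := d + 1) (n := n + m) (by omega) (a * b) using 1
    ext s x
    simp [pow_add]; ring
  · convert TS_sin (d := d + 1) (n := n + m) (by omega) (a * b) using 1
    ext s x
    simp [pow_add]; ring
  · convert TS_sin (d := d + 1) (n := n + m) (by omega) (a * b) using 1
    ext s x
    simp [pow_add]; ring
  · convert (TS (d + 1)).sub_mem (TS_cos (d := d + 1) (n := n + m) (by omega) (a * b))
      (TS_cos (d := d + 1) (n := n + m + 2) (by omega) (a * b)) using 1
    ext s x
    simp [pow_add]
    linear_combination (Real.cos (2 * s) ^ n * a x * Real.cos (2 * s) ^ m * b x) * Real.sin_sq (2 * s)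

lemma TS_pow (d : ℕ) : TS 1 ^ d ≤ TS d := by
  induction d with
  | zero =>
    rw [pow_zero, Submodule.one_le]
    have := TS_cos (d := 0) (n := 0) le_rfl 1
    simp only [pow_zero, one_smul] at this
    exact this
  | succ d ih =>
    rw [pow_succ]
    exact (mul_le_mul_left ih _).trans (TS_mul d)

def PsiG (n : ℝ × ℝ × ℝ) (hn : n.1 ^ 2 + n.2.1 ^ 2 + n.2.2 ^ 2 = 1) :
    C(GG, ℝ) →ₐ[ℝ] (ℝ → C(GG, ℝ)) := AlgHom.pi fun s => Lg (gs n hn s)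

lemma TS_lin {F : ℝ → C(GG, ℝ)} (a b c : C(GG, ℝ))
    (h : ∀ s x, F s x = (Real.cos s) ^ 2 * a x + (Real.sin s * Real.cos s) * b x + (Real.sin s) ^ 2 * c x) :
    F ∈ TS 1 := by
  convert (TS 1).add_mem ((TS 1).add_mem (TS_cos (d := 1) (n := 0) (by omega) ((1 / 2 : ℝ) • (a + c)))
    (TS_cos (d := 1) (n := 1) (by omega) ((1 / 2 : ℝ) • (a - c))))
    (TS_sin (d := 1) (n := 0) (by omega) ((1 / 2 : ℝ) • b)) using 1
  ext s x
  rw [h]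
  simp only [Pi.add_apply, ContinuousMap.add_apply, ContinuousMap.smul_apply, ContinuousMap.sub_apply,
    smul_eq_mul, Real.sin_two_mul, Real.cos_two_mul, Real.sin_sq]
  ring

lemma Psi_VV (n) (hn) : VV.map (PsiG n hn).toLinearMap ≤ TS 1 := by
  rw [VV, Submodule.map_span, Submodule.span_le]
  rintro _ ⟨f, hf, rfl⟩
  simp only [Set.mem_insert_iff, Set.mem_singleton_iff] at hf
  rw [AlgHom.toLinearMap_apply]
  obtain ⟨n1, n2, n3⟩ := n
  simp only at hn
  rcases hf with rfl | rfl | rfl | rfl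
  · rw [map_one]; have := TS_cos (d := 1) (n := 0) (by omega) 1
    simp only [pow_zero, one_smul] at this
    exact this
  · refine TS_lin c1 ((2 * n3) • c2 - (2 * n2) • c3)
      ((n1 ^ 2 - n2 ^ 2 - n3 ^ 2) • c1 + (2 * n1 * n2) • c2 + (2 * n1 * n3) • c3) fun s x => ?_
    change Lg _ c1 x = _
    rw [Lg_c1]; simp [pole, gs, mkG]; ring
  · refine TS_lin c2 ((2 * n1) • c3 - (2 * n3) • c1)
      ((n2 ^ 2 - n1 ^ 2 - n3 ^ 2) • c2 + (2 * n1 * n2) • c1 + (2 * n2 * n3) • c3) fun s x => ?_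
    change Lg _ c2 x = _
    rw [Lg_c2]; simp [pole, gs, mkG]; ring
  · refine TS_lin c3 ((2 * n2) • c1 - (2 * n1) • c2)
      ((n3 ^ 2 - n2 ^ 2 - n1 ^ 2) • c3 + (2 * n3 * n2) • c2 + (2 * n1 * n3) • c1) fun s x => ?_
    change Lg _ c3 x = _
    rw [Lg_c3]; simp [pole, gs, mkG]; ring

open Polynomial in
lemma trig_form (n) (hn) {d : ℕ} {f : C(GG, ℝ)} (hf : f ∈ VV ^ d) (l : C(GG, ℝ) →ₗ[ℝ] ℝ) :
    ∃ A B : ℝ[X], A.degree ≤ d ∧ ∀ s, l (Lg (gs n hn s) f) =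
      A.eval (Real.cos (2 * s)) + Real.sin (2 * s) * B.eval (Real.cos (2 * s)) := by
  have h1 : PsiG n hn f ∈ TS d := by
    have : (VV ^ d).map (PsiG n hn).toLinearMap ≤ TS d := by
      rw [Submodule.map_pow]
      exact (pow_le_pow_left' (Psi_VV n hn) d).trans (TS_pow d)
    exact this ⟨f, hf, rfl⟩
  have h2 : ∀ F ∈ TS d, ∃ A B : ℝ[X], A.degree ≤ d ∧ ∀ s, l (F s) =
      A.eval (Real.cos (2 * s)) + Real.sin (2 * s) * B.eval (Real.cos (2 * s)) := by
    intro F hF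
    induction hF using Submodule.span_induction with
    | mem F hF =>
      rcases hF with ⟨n, hn, a, rfl⟩ | ⟨n, hn, a, rfl⟩
      · refine ⟨C (l a) * X ^ n, 0, (degree_C_mul_X_pow_le n _).trans (by exact_mod_cast hn), fun s => ?_⟩
        simp; ring
      · refine ⟨0, C (l a) * X ^ n, by simp, fun s => ?_⟩
        simp; ring
    | zero => exact ⟨0, 0, by simp, by simp⟩
    | add F G _ _ hF hG =>
      obtain ⟨A, B, h, h'⟩ := hF
      obtain ⟨A', B', k, k'⟩ := hG
      refine ⟨A + A', B + B', (degree_add_le _ _).trans (max_le h k), fun s => ?_⟩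
      simp [h', k']; ring
    | smul c F _ hF =>
      obtain ⟨A, B, h, h'⟩ := hF
      refine ⟨c • A, c • B, (degree_smul_le _ _).trans h, fun s => ?_⟩
      simp [h']; ring
  exact h2 _ h1

open Polynomial in
lemma trig_form_even (n) (hn) {d : ℕ} {f : C(GG, ℝ)} (hf : f ∈ VV ^ d) (l : C(GG, ℝ) →ₗ[ℝ] ℝ)
    (he : ∀ s, l (Lg (gs n hn (-s)) f) = l (Lg (gs n hn s) f)) :
    ∃ A : ℝ[X], A.degree ≤ d ∧ ∀ s, l (Lg (gs n hn s) f) = A.eval (Real.cos (2 * s)) := by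
  obtain ⟨A, B, h, h'⟩ := trig_form n hn hf l
  refine ⟨A, h, fun s => ?_⟩
  have h1 := h' s
  have h2 := h' (-s)
  rw [he] at h2
  simp only [mul_neg, Real.cos_neg, Real.sin_neg] at h2
  linarith
end

noncomputable section
open scoped Quaternion

/-- integration as a continuous linear functional -/
def intC : C(GG, ℝ) →L[ℝ] ℝ := LinearMap.mkContinuous (ip 1) 1 (fun f => by
  rw [ip_one, one_mul]
  refine (norm_integral_le_of_norm_le_const (C := ‖f‖) (Eventually.of_forall fun x => f.norm_coe_le_norm x)).trans ?_
  simp)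
lemma intC_apply (f : C(GG, ℝ)) : intC f = ∫ x, f x ∂mu := ip_one f
lemma intC_Lg (g : GG) (f : C(GG, ℝ)) : intC (Lg g f) = intC f := by
  rw [intC_apply, intC_apply]; exact integral_Lg g f

lemma int_deriv (a b : C(GG, ℝ)) (n : ℕ) (g : ℝ → GG)
    (ha : ∀ s, Lg (g s) a = Real.cos (2 * s) • a + Real.sin (2 * s) • b)
    (hb : ∀ s, Lg (g s) b = Real.cos (2 * s) • b - Real.sin (2 * s) • a) :
    (n + 1 : ℝ) * intC (a ^ n * b ^ 2) = intC (a ^ (n + 2)) := by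
  let u : ℝ → C(GG, ℝ) := fun s => Lg (g s) (a ^ (n + 1) * b)
  have hu : u = fun s => (Real.cos (2 * s) • a + Real.sin (2 * s) • b) ^ (n + 1) *
      (Real.cos (2 * s) • b - Real.sin (2 * s) • a) := by
    funext s; simp only [u, map_mul, map_pow, ha, hb]
  have hc : HasDerivAt (fun s : ℝ => Real.cos (2 * s)) 0 0 := by
    have := ((hasDerivAt_id (0 : ℝ)).const_mul 2).cos
    simpa using this
  have hs : HasDerivAt (fun s : ℝ => Real.sin (2 * s)) 2 0 := by
    have := ((hasDerivAt_id (0 : ℝ)).const_mul 2).sin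
    simpa using this
  have hA : HasDerivAt (fun s => Real.cos (2 * s) • a + Real.sin (2 * s) • b) ((2 : ℝ) • b) 0 := by
    have := (hc.smul_const a).fun_add (hs.smul_const b)
    rw [zero_smul, zero_add] at this
    exact this
  have hB : HasDerivAt (fun s => Real.cos (2 * s) • b - Real.sin (2 * s) • a) (-((2 : ℝ) • a)) 0 := by
    have := (hc.smul_const b).fun_sub (hs.smul_const a)
    rw [zero_smul, zero_sub] at this
    exact this
  have hd := (hA.fun_pow (n + 1)).mul hB
  have hd2 := intC.hasFDerivAt.comp_hasDerivAt (0 : ℝ) hd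
  have hconst : (intC ∘ fun s => (Real.cos (2 * s) • a + Real.sin (2 * s) • b) ^ (n + 1) *
      (Real.cos (2 * s) • b - Real.sin (2 * s) • a)) = fun _ => intC (a ^ (n + 1) * b) := by
    rw [← hu]; funext s; exact intC_Lg _ _
  have hd3 : HasDerivAt (fun _ : ℝ => intC (a ^ (n + 1) * b)) _ 0 := hconst ▸ hd2
  have h0 := hd3.unique (hasDerivAt_const _ _)
  simp only [mul_zero, Real.cos_zero, Real.sin_zero, one_smul, zero_smul, add_zero, sub_zero,
    Nat.add_sub_cancel] at h0
  have e : (((n + 1 : ℕ) : C(GG, ℝ)) * a ^ n * (2 : ℝ) • b * b + a ^ (n + 1) * -((2 : ℝ) • a))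
      = (2 * (n + 1) : ℝ) • (a ^ n * b ^ 2) - (2 : ℝ) • a ^ (n + 2) := by
    ext x; simp; ring
  rw [e] at h0
  rw [map_sub, map_smul, map_smul, smul_eq_mul, smul_eq_mul] at h0
  linarith

lemma moment (n : ℕ) : (n + 1 : ℝ) * intC (c1 ^ n) = (1 + (-1) ^ n) / 2 := by
  induction n using Nat.twoStepInduction with
  | zero => simp [intC_apply]
  | one =>
    have h := intC_Lg (gs (0, 1, 0) (by norm_num) (Real.pi / 2)) c1
    have : Lg (gs (0, 1, 0) (by norm_num) (Real.pi / 2)) c1 = -c1 := by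
      ext x; rw [Lg_c1]; simp [pole, gs, mkG]
    rw [this, map_neg] at h
    have h2 : intC c1 = 0 := by linarith
    simp [h2]
  | more n ih _ =>
    have h2 := int_deriv c1 c2 n (gs (0, 0, 1) (by norm_num))
      (fun s => by ext x; rw [Lg_c1]; simp [pole, gs, mkG, Real.sin_two_mul, Real.cos_two_mul']; ring)
      (fun s => by ext x; rw [Lg_c2]; simp [pole, gs, mkG, Real.sin_two_mul, Real.cos_two_mul']; ring)
    have h3 := int_deriv c1 c3 n (gs (0, -1, 0) (by norm_num))
      (fun s => by ext x; rw [Lg_c1]; simp [pole, gs, mkG, Real.sin_two_mul, Real.cos_two_mul']; ring)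
      (fun s => by ext x; rw [Lg_c3]; simp [pole, gs, mkG, Real.sin_two_mul, Real.cos_two_mul']; ring)
    have h4 : c1 ^ n = c1 ^ (n + 2) + c1 ^ n * c2 ^ 2 + c1 ^ n * c3 ^ 2 := by
      ext x
      simp only [ContinuousMap.add_apply, ContinuousMap.mul_apply, ContinuousMap.pow_apply]
      linear_combination -(c1 x ^ n) * cc_sq x
    have h5 := congrArg intC h4
    rw [map_add, map_add] at h5
    have h6 : (n + 1 : ℝ) * intC (c1 ^ n) = (n + 3) * intC (c1 ^ (n + 2)) := by
      rw [h5]; linear_combination h2 + h3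
    push_cast
    rw [pow_add (-1 : ℝ)]
    linarith

/-- `P(c1)` -/
def pc (P : Polynomial ℝ) : C(GG, ℝ) := Polynomial.aeval c1 P

open Polynomial in
lemma pc_apply (P : ℝ[X]) (x : GG) : pc P x = P.eval (c1 x) := by
  simp only [pc]
  induction P using Polynomial.induction_on' with
  | add p q hp hq => simp [hp, hq]
  | monomial n a => simp [aeval_monomial, eval_monomial]

lemma pc_mem {P : Polynomial ℝ} {d : ℕ} (h : P.degree ≤ d) : pc P ∈ VV ^ d := by
  rw [pc, Polynomial.aeval_eq_sum_range]
  refine Submodule.sum_mem _ fun i hi => Submodule.smul_mem _ _ ?_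
  have : i ≤ d := by
    have := Polynomial.natDegree_le_of_degree_le h
    rw [Finset.mem_range] at hi; omega
  exact VV_mono this (Submodule.pow_mem_pow _ c1_mem_VV i)

open Polynomial in
lemma int_derivative (P : ℝ[X]) : intC (pc (derivative P)) = (P.eval 1 - P.eval (-1)) / 2 := by
  induction P using Polynomial.induction_on' with
  | add p q hp hq =>
    rw [derivative_add, pc, map_add, map_add]
    simp only [pc] at hp hq
    rw [hp, hq, eval_add, eval_add]; ring
  | monomial n a =>
    rw [derivative_monomial, pc, aeval_monomial]
    rcases n with _ | n
    · simp
    · have := moment n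
      simp only [Nat.add_sub_cancel, eval_monomial, one_pow, mul_one]
      rw [← Algebra.smul_def, map_smul, smul_eq_mul]
      push_cast
      rw [mul_assoc, this, pow_succ]; ring

open Polynomial in
lemma legendre (A : ℝ[X]) (d : ℕ) (hA : A.degree ≤ (d + 1 : ℕ))
    (horth : ∀ P : ℝ[X], P.degree ≤ d → ip (pc A) (pc P) = 0) :
    (2 * d + 3 : ℝ) * ip (pc A) (pc A) = (A.eval 1 ^ 2 + A.eval (-1) ^ 2) / 2 := by
  have h1 := int_derivative (X * A ^ 2)
  set P : ℝ[X] := X * derivative A - C (d + 1 : ℝ) * A with hP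
  have hPd : P.degree ≤ d := by
    rw [degree_le_iff_coeff_zero]
    intro m hm
    have hm' : d < m := by exact_mod_cast hm
    rw [hP, coeff_sub, coeff_C_mul]
    obtain ⟨k, rfl⟩ : ∃ k, m = k + 1 := ⟨m - 1, by omega⟩
    rw [coeff_X_mul, coeff_derivative]
    rcases eq_or_lt_of_le (show d + 1 ≤ k + 1 by omega) with h | h
    · have : k = d := by omega
      subst this; push_cast; ring
    · have : A.coeff (k + 1) = 0 := coeff_eq_zero_of_degree_lt (lt_of_le_of_lt hA (by exact_mod_cast h))
      simp [this]
  have h2 := horth P hPd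
  have e : pc (derivative (X * A ^ 2)) = (2 * d + 3 : ℝ) • (pc A * pc A) + (2 : ℝ) • (pc A * pc P) := by
    ext x
    simp only [pc_apply, ContinuousMap.add_apply, ContinuousMap.smul_apply, ContinuousMap.mul_apply, hP]
    simp [derivative_mul, derivative_pow]
    ring
  rw [e, map_add, map_smul, map_smul] at h1
  have e2 : ∀ f h : C(GG, ℝ), intC (f * h) = ip f h := fun f h => by rw [intC_apply]; rfl
  rw [e2, e2, h2] at h1
  simp at h1
  rw [h1]

lemma cosh_lower (t : ℝ) : 1 + t ^ 2 / 2 ≤ Real.cosh t := by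
  have h := Real.cosh_two_mul (t / 2)
  have h2 := Real.cosh_sq (t / 2)
  rw [show 2 * (t / 2) = t by ring] at h
  have h3 : (t / 2) ^ 2 ≤ Real.sinh (t / 2) ^ 2 := by
    rw [sq_le_sq, Real.abs_sinh]
    exact Real.self_le_sinh_iff.2 (abs_nonneg _)
  nlinarith

open Polynomial in
/-- A one-sided Markov-type bound near the endpoint `1`. -/
lemma markov (A : ℝ[X]) (n : ℕ) (hA : A.degree ≤ n) (hb : ∀ x ∈ Set.Icc (-1 : ℝ) 1, |A.eval x| ≤ 1)
    (h1 : A.eval 1 = 1) (h : ℝ) (hh : 0 ≤ h) (hh2 : (n : ℝ) ^ 2 * h ≤ 2 / 5) : 1 / 2 ≤ A.eval (1 - h) := by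
  have key : ∀ k, |(taylor 1 A).coeff k| ≤ (taylor 1 (Chebyshev.T ℝ n)).coeff k := by
    intro k
    have hf : (0 : ℝ) < k.factorial := by positivity
    have e : ∀ Q : ℝ[X], (k.factorial : ℝ) * (taylor 1 Q).coeff k = (derivative^[k] Q).eval 1 := by
      intro Q
      rw [taylor_coeff, ← factorial_smul_hasseDeriv]
      simp
    have a1 := Chebyshev.eval_iterate_derivative_le_of_forall_abs_le_one (k := k) (le_refl (1 : ℝ)) hA hb
    have a2 := Chebyshev.eval_iterate_derivative_le_of_forall_abs_le_one (P := -A) (k := k) (le_refl (1 : ℝ))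
      (by rwa [degree_neg]) (by simpa using hb)
    rw [iterate_derivative_neg, eval_neg, ← e, ← e] at a2
    rw [← e, ← e] at a1
    rw [abs_le]
    constructor <;> nlinarith
  have eA : A.eval (1 - h) = ∑ k ∈ Finset.range (n + 1), (taylor 1 A).coeff k * (-h) ^ k := by
    have := taylor_eval 1 A (-h)
    rw [show -h + 1 = 1 - h by ring] at this
    rw [← this]
    exact eval_eq_sum_range' (by
      rw [natDegree_taylor]; exact Nat.lt_succ_of_le (natDegree_le_of_degree_le hA)) _
  have eT : (Chebyshev.T ℝ n).eval (1 + h) =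
      ∑ k ∈ Finset.range (n + 1), (taylor 1 (Chebyshev.T ℝ n)).coeff k * h ^ k := by
    have := taylor_eval 1 (Chebyshev.T ℝ n) h
    rw [show h + 1 = 1 + h by ring] at this
    rw [← this]
    exact eval_eq_sum_range' (by
      rw [natDegree_taylor]; exact Nat.lt_succ_of_le (natDegree_le_of_degree_le (by simp))) _
  have hT0 : (taylor 1 (Chebyshev.T ℝ n)).coeff 0 = 1 := by rw [taylor_coeff_zero]; simp
  have hA0 : (taylor 1 A).coeff 0 = 1 := by rw [taylor_coeff_zero]; exact h1
  rw [Finset.sum_range_succ', hA0] at eA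
  rw [Finset.sum_range_succ', hT0] at eT
  have hsum : |∑ k ∈ Finset.range n, (taylor 1 A).coeff (k + 1) * (-h) ^ (k + 1)| ≤
      ∑ k ∈ Finset.range n, (taylor 1 (Chebyshev.T ℝ n)).coeff (k + 1) * h ^ (k + 1) := by
    refine (Finset.abs_sum_le_sum_abs _ _).trans (Finset.sum_le_sum fun k _ => ?_)
    rw [abs_mul, abs_pow, abs_neg, abs_of_nonneg hh]
    exact mul_le_mul_of_nonneg_right (key _) (by positivity)
  have hTle : (Chebyshev.T ℝ n).eval (1 + h) ≤ 3 / 2 := by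
    set t := Real.arcosh (1 + h)
    have ht : Real.cosh t = 1 + h := Real.cosh_arcosh (by linarith)
    rw [← ht, Chebyshev.T_real_cosh]
    have : t ^ 2 / 2 ≤ h := by
      have := cosh_lower t
      linarith
    calc Real.cosh (((n : ℤ) : ℝ) * t) ≤ Real.exp ((((n : ℤ) : ℝ) * t) ^ 2 / 2) := Real.cosh_le_exp_half_sq _
      _ ≤ Real.exp (2 / 5) := by
          apply Real.exp_le_exp.2
          push_cast
          nlinarith [sq_nonneg (n : ℝ)]
      _ ≤ 3 / 2 := by
          have h0 := Real.exp_one_lt_d9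
          have : Real.exp (2 / 5) ^ 5 = Real.exp 1 ^ 2 := by
            rw [← Real.exp_nat_mul, ← Real.exp_nat_mul]; norm_num
          by_contra hc
          push Not at hc
          have : (3 / 2 : ℝ) ^ 5 < Real.exp (2 / 5) ^ 5 := pow_lt_pow_left₀ hc (by norm_num) (by norm_num)
          have h2 : Real.exp 1 ^ 2 < 2.7182818286 ^ 2 := pow_lt_pow_left₀ h0 (Real.exp_pos _).le (by norm_num)
          norm_num at *
          linarith
  have := (abs_le.1 hsum).1
  simp only [pow_zero, mul_one] at eA eT
  linarith
end

noncomputable section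
open scoped Quaternion

/-- parametric integrals of continuous functions -/
def par (F : C(GG × GG, ℝ)) : C(GG, ℝ) :=
  (⟨intC, intC.continuous⟩ : C(C(GG, ℝ), ℝ)).comp (ContinuousMap.curry F)

lemma par_apply (F : C(GG × GG, ℝ)) (x : GG) : par F x = ∫ y, F (x, y) ∂mu := by
  show intC (ContinuousMap.curry F x) = _
  rw [intC_apply]; rfl

lemma fub (F : GG → GG → ℝ) (hF : Continuous F.uncurry) :
    ∫ x, ∫ y, F x y ∂mu ∂mu = ∫ y, ∫ x, F x y ∂mu ∂mu :=
  integral_integral_swap_of_hasCompactSupport hF (HasCompactSupport.of_compactSpace _)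

/-- functions factoring through the pole form a subalgebra -/
def poleAlg : Subalgebra ℝ C(GG, ℝ) where
  carrier := {f | ∀ x y, pole x = pole y → f x = f y}
  mul_mem' := fun {f g} hf hg x y h => by
    simp only [ContinuousMap.mul_apply, hf x y h, hg x y h]
  add_mem' := fun {f g} hf hg x y h => by
    simp only [ContinuousMap.add_apply, hf x y h, hg x y h]
  algebraMap_mem' := fun r x y h => by simp

lemma VVpow_pole {d : ℕ} {f : C(GG, ℝ)} (hf : f ∈ VV ^ d) (x y : GG) (h : pole x = pole y) :
    f x = f y := by
  have h1 : VV ≤ poleAlg.toSubmodule := by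
    rw [VV, Submodule.span_le]
    rintro g (rfl | rfl | rfl | rfl) x y h
    · simp
    · exact congrArg (fun q : ℍ[ℝ] => q.imI) h
    · exact congrArg (fun q : ℍ[ℝ] => q.imJ) h
    · exact congrArg (fun q : ℍ[ℝ] => q.imK) h
  have h2 : VV ^ d ≤ poleAlg.toSubmodule := by
    induction d with
    | zero =>
      rw [pow_zero, Submodule.one_le]
      exact poleAlg.one_mem
    | succ d ih =>
      rw [pow_succ, Submodule.mul_le]
      intro m hm n hn
      have hm' : m ∈ poleAlg.toSubmodule := by
        clear hf
        have : ∀ e : ℕ, VV ^ e ≤ poleAlg.toSubmodule := by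
          intro e
          induction e with
          | zero => rw [pow_zero, Submodule.one_le]; exact poleAlg.one_mem
          | succ e ih =>
            rw [pow_succ, Submodule.mul_le]
            exact fun m hm n hn => poleAlg.mul_mem (ih hm) (h1 hn)
        exact this d hm
      exact poleAlg.mul_mem hm' (h1 hn)
  exact h2 hf x y h

/-- the autocorrelation -/
def K0 (w : C(GG, ℝ)) : C(GG, ℝ) := par ⟨fun z => w (z.2 * z.1) * w z.2, by fun_prop⟩
lemma K0_apply (w : C(GG, ℝ)) (x : GG) : K0 w x = ∫ g, w (g * x) * w g ∂mu := par_apply _ x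

lemma ip_K0 (w h : C(GG, ℝ)) : ip (K0 w) h = ∫ g, w g * ip (Lg g⁻¹ w) h ∂mu := by
  rw [ip_apply]
  simp only [K0_apply, ← integral_mul_const]
  rw [fub _ (by simp only [Function.uncurry_def]; fun_prop)]
  congr 1; ext g
  rw [ip_apply, ← integral_const_mul]
  congr 1; ext x
  simp only [Lg_apply, inv_inv]; ring

lemma K0_orth {w : C(GG, ℝ)} {d : ℕ} (hw : ∀ h ∈ VV ^ d, ip w h = 0) (h) (hh : h ∈ VV ^ d) :
    ip (K0 w) h = 0 := by
  rw [ip_K0]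
  simp only [ip_Lg_left]
  simp [hw _ (VVpow_Lg _ d hh)]

lemma K0_mem {w : C(GG, ℝ)} {d : ℕ} (hw : w ∈ VV ^ d) : K0 w ∈ VV ^ d := by
  obtain ⟨g, hg, hgo⟩ := proj_exists (VV ^ d) (K0 w)
  have h1 : ip (K0 w) (K0 w - g) = 0 := by
    rw [ip_K0]
    have : ∀ x : GG, ip (Lg x⁻¹ w) (K0 w - g) = 0 := fun x => by
      rw [ip_symm]; exact hgo _ (VVpow_Lg _ d hw)
    simp [this]
  have h2 : ip (K0 w - g) (K0 w - g) = 0 := by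
    have h3 := hgo g hg
    rw [ip_symm] at h3
    have : ip (K0 w - g) (K0 w - g) = ip (K0 w) (K0 w - g) - ip g (K0 w - g) := by
      simp only [map_sub, LinearMap.sub_apply]; ring
    rw [this, h1, h3, sub_zero]
  rw [sub_eq_zero.1 (ip_eq_zero h2)]
  exact hg

lemma K0_inv (w : C(GG, ℝ)) (x : GG) : K0 w x⁻¹ = K0 w x := by
  rw [K0_apply, K0_apply, ← integral_mul_right_eq_self _ x]
  congr 1; ext g
  simp; ring

/-- rotation about the pole -/
def hh (t : ℝ) : GG := mkG (Real.cos t) (Real.sin t) 0 0 (by simp)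

lemma pole_mul_hh (g : GG) (t : ℝ) : pole (g * hh t) = pole g := by
  rw [pole_mul, pole_eq g, pole_eq (hh t)]
  congr 2
  have := Real.cos_sq_add_sin_sq t
  ext <;> simp [hh, mkG] <;> nlinarith

lemma K0_hh {w : C(GG, ℝ)} {d : ℕ} (hw : w ∈ VV ^ d) (t : ℝ) (x : GG) : K0 w (hh t * x) = K0 w x := by
  rw [K0_apply, K0_apply]
  conv_rhs => rw [← integral_mul_right_eq_self _ (hh t)]
  congr 1; ext g
  rw [← mul_assoc, VVpow_pole hw (g * hh t) g (pole_mul_hh g t)]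

lemma K0_one (w : C(GG, ℝ)) : K0 w 1 = ip w w := by
  rw [K0_apply, ip_apply]; simp

lemma K0_le (w : C(GG, ℝ)) (x : GG) : (K0 w x) ^ 2 ≤ (ip w w) ^ 2 := by
  let w' : C(GG, ℝ) := ⟨fun g => w (g * x), by fun_prop⟩
  have h1 : K0 w x = ip w' w := by rw [K0_apply, ip_apply]; rfl
  have h2 : ip w' w' = ip w w := by
    rw [ip_apply, ip_apply]
    exact integral_mul_right_eq_self (fun g => w g * w g) x
  rw [h1]
  refine (ip_cs _ _).trans ?_
  rw [h2, sq]

lemma exists_angle (u v r : ℝ) (hr : 0 ≤ r) (h : u ^ 2 + v ^ 2 = r ^ 2) :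
    ∃ φ : ℝ, u = r * Real.cos φ ∧ v = r * Real.sin φ := by
  refine ⟨Complex.arg ⟨u, v⟩, ?_⟩
  have hn : ‖(⟨u, v⟩ : ℂ)‖ = r := by
    rw [Complex.norm_def, Complex.normSq_mk, ← sq, ← sq, h, Real.sqrt_sq hr]
  have h1 := Complex.norm_mul_cos_arg ⟨u, v⟩
  have h2 := Complex.norm_mul_sin_arg ⟨u, v⟩
  rw [hn] at h1 h2
  exact ⟨h1.symm, h2.symm⟩

def nk : ℝ × ℝ × ℝ := (0, 0, 1)
lemma hnk : nk.1 ^ 2 + nk.2.1 ^ 2 + nk.2.2 ^ 2 = 1 := by simp [nk]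

lemma reach (x : GG) : ∃ t s : ℝ, pole x = pole (hh t * gs nk hnk s) ∧ c1 x = Real.cos (2 * s) := by
  have hx := cc_sq x
  have hb : c1 x ^ 2 ≤ 1 := by nlinarith [sq_nonneg (c2 x), sq_nonneg (c3 x)]
  have hb1 : -1 ≤ c1 x := by nlinarith
  have hb2 : c1 x ≤ 1 := by nlinarith
  set θ := Real.arccos (c1 x) with hθ
  have hc : Real.cos θ = c1 x := Real.cos_arccos hb1 hb2
  have hs0 : 0 ≤ Real.sin θ := Real.sin_nonneg_of_nonneg_of_le_pi (Real.arccos_nonneg _) (Real.arccos_le_pi _)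
  have hcs := Real.cos_sq_add_sin_sq θ
  obtain ⟨φ, h1, h2⟩ := exists_angle (c2 x) (c3 x) (Real.sin θ) hs0 (by rw [hc] at hcs; linarith)
  refine ⟨φ / 2, θ / 2, ?_, by rw [mul_div_cancel₀ _ two_ne_zero, hc]⟩
  have e1 : Real.cos θ = Real.cos (θ/2) ^ 2 - Real.sin (θ/2) ^ 2 := by
    rw [← Real.cos_two_mul', mul_div_cancel₀ _ two_ne_zero]
  have e2 : Real.sin θ = 2 * Real.sin (θ/2) * Real.cos (θ/2) := by
    rw [← Real.sin_two_mul, mul_div_cancel₀ _ two_ne_zero]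
  have e3 : Real.cos φ = Real.cos (φ/2) ^ 2 - Real.sin (φ/2) ^ 2 := by
    rw [← Real.cos_two_mul', mul_div_cancel₀ _ two_ne_zero]
  have e4 : Real.sin φ = 2 * Real.sin (φ/2) * Real.cos (φ/2) := by
    rw [← Real.sin_two_mul, mul_div_cancel₀ _ two_ne_zero]
  have e5 := Real.cos_sq_add_sin_sq (θ/2)
  have e6 := Real.cos_sq_add_sin_sq (φ/2)
  have hp : pole x = qmk 0 (c1 x) (c2 x) (c3 x) := rfl
  rw [hp, h1, h2, ← hc, e1, e2, e3, e4]




  rw [pole_mul]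
  ext <;> simp [pole, c1, c2, c3, hh, gs, mkG, nk]
  all_goals first
    | ring1
    | linear_combination (-Real.cos (θ / 2) ^ 2 + Real.sin (θ / 2) ^ 2) * e6
end

noncomputable section
open scoped Quaternion

/-- evaluation as a linear functional -/
def evl (x : GG) : C(GG, ℝ) →ₗ[ℝ] ℝ where
  toFun := fun f => f x
  map_add' := fun _ _ => rfl
  map_smul' := fun _ _ => rfl

lemma evl_Lg (g : GG) (f : C(GG, ℝ)) : evl 1 (Lg g f) = f g⁻¹ := by
  show Lg g f 1 = _
  simp

lemma K0_norm {w : C(GG, ℝ)} {d : ℕ} (hw : w ∈ VV ^ (d + 1)) (ho : ∀ h ∈ VV ^ d, ip w h = 0)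
    (h1 : ip w w = 1) : (2 * d + 3) * ip (K0 w) (K0 w) ≤ 1 := by
  have hK := K0_mem hw
  have hKo := K0_orth ho
  obtain ⟨A, hA, hAe⟩ := trig_form_even nk hnk hK (evl 1) (fun s => by
    rw [evl_Lg, evl_Lg, gs_neg, K0_inv])
  have hAe' : ∀ s, K0 w (gs nk hnk s) = A.eval (Real.cos (2 * s)) := fun s => by
    rw [← hAe s, evl_Lg, K0_inv]
  have hpc : K0 w = pc A := by
    ext x
    obtain ⟨t, s, hp, hc⟩ := reach x
    rw [VVpow_pole hK x _ hp, K0_hh hw, hAe', pc_apply, hc]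
  have hleg := legendre A d hA (fun P hP => by rw [← hpc]; exact hKo _ (pc_mem hP))
  have b1 : (A.eval 1) ^ 2 ≤ 1 := by
    have := K0_le w (gs nk hnk 0)
    rw [hAe' 0, h1] at this
    simpa using this
  have b2 : (A.eval (-1)) ^ 2 ≤ 1 := by
    have := K0_le w (gs nk hnk (Real.pi / 2))
    rw [hAe', h1, mul_div_cancel₀ _ two_ne_zero, Real.cos_pi] at this
    simpa using this
  rw [hpc, hleg]; linarith

/-- the matrix coefficient -/
def mc (w : C(GG, ℝ)) : C(GG, ℝ) := par ⟨fun z => w (z.1⁻¹ * z.2) * w z.2, by fun_prop⟩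
lemma mc_apply (w : C(GG, ℝ)) (g : GG) : mc w g = ip (Lg g w) w := par_apply _ g
lemma mc_apply' (w : C(GG, ℝ)) (g : GG) : mc w g = ∫ x, w (g⁻¹ * x) * w x ∂mu := par_apply _ g

def qc (w k : C(GG, ℝ)) : C(GG, ℝ) := par ⟨fun z => w z.2 * k (z.1⁻¹ * z.2), by fun_prop⟩
lemma qc_apply (w k : C(GG, ℝ)) (g : GG) : qc w k g = ip w (Lg g k) := par_apply _ g

lemma mc_K0 (w : C(GG, ℝ)) : ip (mc w) (mc w) = ip w (qc w (K0 w)) := by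
  have e1 : ∀ y, ∫ g, mc w g * w (g⁻¹ * y) ∂mu = qc w (K0 w) y := by
    intro y
    simp only [mc_apply', ← integral_mul_const]
    rw [fub _ (by simp only [Function.uncurry_def]; fun_prop), qc_apply, ip_apply]
    congr 1; ext x
    have : ∀ g, w (g⁻¹ * x) * w x * w (g⁻¹ * y) = w x * (w (g⁻¹ * x) * w (g⁻¹ * y)) := fun g => by ring
    simp only [this]
    rw [integral_const_mul, Lg_apply, K0_apply]
    congr 1
    rw [integral_inv_eq_self (fun g => w (g * x) * w (g * y)) mu,
      ← integral_mul_right_eq_self (fun g => w (g * x) * w (g * y)) y⁻¹]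
    simp [mul_assoc]
  rw [ip_apply]
  have e2 : ∀ g, mc w g * mc w g = ∫ y, mc w g * (w (g⁻¹ * y) * w y) ∂mu := fun g => by
    rw [integral_const_mul, ← mc_apply']
  simp only [e2]
  rw [fub _ (by simp only [Function.uncurry_def]; fun_prop), ip_apply]
  congr 1; ext y
  rw [← e1 y, ← integral_const_mul]
  congr 1; ext g; ring

lemma ip_one_one : ip 1 1 = 1 := by rw [ip_one]; simp

lemma ip_self_le {f : C(GG, ℝ)} {c : ℝ} (h : ∀ x, f x ^ 2 ≤ c) : ip f f ≤ c := by
  rw [ip_apply]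
  calc ∫ x, f x * f x ∂mu ≤ ∫ _x, c ∂mu :=
        integral_mono (intg (by fun_prop)) (by simp) fun x => by
          have := h x
          simp only; nlinarith
    _ = c := by simp

/-- H2 : matrix coefficients of high frequency functions are small in L². -/
lemma mc_small {w : C(GG, ℝ)} {d : ℕ} (hw : w ∈ VV ^ (d + 1)) (ho : ∀ h ∈ VV ^ d, ip w h = 0)
    (h1 : ip w w = 1) : (2 * d + 3) * (ip (mc w) (mc w)) ^ 2 ≤ 1 := by
  have hK := K0_norm hw ho h1
  rw [mc_K0]
  have h2 : (ip w (qc w (K0 w))) ^ 2 ≤ ip (K0 w) (K0 w) := by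
    refine (ip_cs _ _).trans ?_
    rw [h1, one_mul]
    refine ip_self_le fun x => ?_
    rw [qc_apply]
    refine (ip_cs _ _).trans ?_
    rw [h1, one_mul, ip_Lg]
  have : (0:ℝ) ≤ 2 * d + 3 := by positivity
  nlinarith

lemma norm_sub_one_sq (g : GG) : ‖(g : ℍ[ℝ]) - 1‖ ^ 2 = 2 - 2 * (g : ℍ[ℝ]).re := by
  rw [sq, ← Quaternion.normSq_eq_norm_mul_self, Quaternion.normSq_def']
  have := GG_nsq g
  simp; linarith

lemma exists_gs (g : GG) : ∃ n hn s, g = gs n hn s := by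
  have hg := GG_nsq g
  set q := (g : ℍ[ℝ]) with hq
  have hb : q.re ^ 2 ≤ 1 := by nlinarith [sq_nonneg q.imI, sq_nonneg q.imJ, sq_nonneg q.imK]
  have hb1 : -1 ≤ q.re := by nlinarith
  have hb2 : q.re ≤ 1 := by nlinarith
  set s := Real.arccos q.re
  have hc : Real.cos s = q.re := Real.cos_arccos hb1 hb2
  have hcs := Real.sin_sq_add_cos_sq s
  rw [hc] at hcs
  by_cases hs : Real.sin s = 0
  · refine ⟨nk, hnk, s, Subtype.ext ?_⟩
    rw [hs] at hcs
    have h1 : q.imI = 0 := by nlinarith [sq_nonneg q.imI, sq_nonneg q.imJ, sq_nonneg q.imK]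
    have h2 : q.imJ = 0 := by nlinarith [sq_nonneg q.imI, sq_nonneg q.imJ, sq_nonneg q.imK]
    have h3 : q.imK = 0 := by nlinarith [sq_nonneg q.imI, sq_nonneg q.imJ, sq_nonneg q.imK]
    ext <;> simp [gs, mkG, hc, hs, h1, h2, h3, ← hq]
  · refine ⟨(q.imI / Real.sin s, q.imJ / Real.sin s, q.imK / Real.sin s), ?_, s, Subtype.ext ?_⟩
    · simp only [div_pow, ← add_div]
      rw [div_eq_one_iff_eq (pow_ne_zero 2 hs)]; linarith
    · ext <;> simp [gs, mkG, hc, hs, ← hq]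

lemma mc_inv (w : C(GG, ℝ)) (g : GG) : mc w g⁻¹ = mc w g := by
  rw [mc_apply, mc_apply, ip_Lg_left, inv_inv, ip_symm]

lemma mc_sq_le (w : C(GG, ℝ)) (g : GG) : (mc w g) ^ 2 ≤ (ip w w) ^ 2 := by
  rw [mc_apply]
  refine (ip_cs _ _).trans ?_
  rw [ip_Lg, sq]

/-- H3 : matrix coefficients stay large near the identity. -/
lemma mc_large {w : C(GG, ℝ)} {N : ℕ} (hw : w ∈ VV ^ N) (h1 : ip w w = 1) (g : GG)
    (hg : (N : ℝ) ^ 2 * ‖(g : ℍ[ℝ]) - 1‖ ^ 2 ≤ 1 / 5) : 1 / 2 ≤ mc w g := by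
  obtain ⟨n, hn, s, rfl⟩ := exists_gs g
  obtain ⟨A, hA, hAe⟩ := trig_form_even n hn hw (ip w) (fun s => by
    rw [ip_symm, ← mc_apply, ip_symm, ← mc_apply, gs_neg, mc_inv])
  have hAe' : ∀ s, mc w (gs n hn s) = A.eval (Real.cos (2 * s)) := fun s => by
    rw [← hAe s, mc_apply, ip_symm]
  have hb : ∀ x ∈ Set.Icc (-1 : ℝ) 1, |A.eval x| ≤ 1 := by
    intro x hx
    have h := mc_sq_le w (gs n hn (Real.arccos x / 2))
    rw [hAe', mul_div_cancel₀ _ two_ne_zero, Real.cos_arccos hx.1 hx.2, h1] at h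
    exact abs_le_one_iff_mul_self_le_one.2 (by nlinarith)
  have h11 : A.eval 1 = 1 := by
    have := hAe' 0
    rw [gs_zero, mc_apply, Lg_one, h1] at this
    simpa using this.symm
  have hns := norm_sub_one_sq (gs n hn s)
  have hre : ((gs n hn s : GG) : ℍ[ℝ]).re = Real.cos s := rfl
  rw [hre] at hns
  have hcs := Real.sin_sq_add_cos_sq s
  have e : Real.cos (2 * s) = 1 - 2 * Real.sin s ^ 2 := by rw [Real.cos_two_mul]; linarith
  rw [hAe', e]
  refine markov A N hA hb h11 _ (by positivity) ?_
  have h3 : Real.sin s ^ 2 ≤ 2 - 2 * Real.cos s := by nlinarith [Real.cos_le_one s]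
  rw [hns] at hg
  have : (N:ℝ)^2 * Real.sin s ^ 2 ≤ (N:ℝ)^2 * (2 - 2 * Real.cos s) := by gcongr
  linarith
end

noncomputable section
open scoped Quaternion

lemma pig (k : ℕ) (B : Set GG) {ι : Type} [Fintype ι] (E : ι → Set GG) (F : ι → GG → Fin k → ℝ)
    (hF : ∀ i g j, |F i g j| ≤ 1) (hE : ∀ g, ∃ i, g ∈ E i) (η : ℝ) (h0 : 0 < η) (h1 : η ≤ 1)
    (hB : ∀ i x y, x ∈ E i → y ∈ E i → (∀ j, |F i x j - F i y j| ≤ η) → y⁻¹ * x ∈ B) :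
    1 ≤ Fintype.card ι * (5 / η) ^ k * mu.real B := by
  classical
  set K : ℕ := ⌈1 / η⌉₊ with hK
  let J := ι × (Fin k → Finset.Icc (-(K:ℤ)) K)
  let A : J → Set GG := fun z => {g | g ∈ E z.1 ∧ ∀ j, ⌊F z.1 g j / η⌋ = (z.2 j : ℤ)}
  have hcov : (Set.univ : Set GG) ⊆ ⋃ z, A z := by
    intro g _
    obtain ⟨i, hi⟩ := hE g
    have hmem : ∀ j, ⌊F i g j / η⌋ ∈ Finset.Icc (-(K:ℤ)) K := by
      intro j
      have hb := abs_le.1 (hF i g j)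
      have hKc : 1 / η ≤ K := Nat.le_ceil _
      rw [Finset.mem_Icc]
      constructor
      · rw [Int.le_floor]
        push_cast
        have : -(1 / η) ≤ F i g j / η := by
          rw [← neg_div]; gcongr; exact hb.1
        linarith
      · have : F i g j / η ≤ 1 / η := by gcongr; exact hb.2
        have h3 : (⌊F i g j / η⌋ : ℝ) ≤ K := (Int.floor_le _).trans (this.trans hKc)
        exact_mod_cast h3
    refine Set.mem_iUnion.2 ⟨(i, fun j => ⟨_, hmem j⟩), hi, fun j => rfl⟩
  have hA : ∀ z, mu.real (A z) ≤ mu.real B := by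
    intro z
    by_cases hne : (A z).Nonempty
    · obtain ⟨y, hy⟩ := hne
      have hsub : A z ⊆ (fun x => y⁻¹ * x) ⁻¹' B := by
        intro x hx
        refine hB z.1 x y hx.1 hy.1 fun j => ?_
        have e : ⌊F z.1 x j / η⌋ = ⌊F z.1 y j / η⌋ := (hx.2 j).trans (hy.2 j).symm
        have := Int.abs_sub_lt_one_of_floor_eq_floor e
        rw [← sub_div, abs_div, abs_of_pos h0, div_lt_one h0] at this
        exact this.le
      calc mu.real (A z) ≤ mu.real ((fun x => y⁻¹ * x) ⁻¹' B) := measureReal_mono hsub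
        _ = mu.real B := by
          rw [measureReal_def, measureReal_def, measure_preimage_mul]
    · rw [Set.not_nonempty_iff_eq_empty.1 hne]; simp
  have h3 : (1:ℝ) ≤ ∑ z : J, mu.real (A z) := by
    calc (1:ℝ) = mu.real Set.univ := by simp
      _ ≤ mu.real (⋃ z, A z) := measureReal_mono hcov
      _ ≤ _ := measureReal_iUnion_fintype_le _
  have h4 : ∑ z : J, mu.real (A z) ≤ (Fintype.card J : ℝ) * mu.real B := by
    calc _ ≤ ∑ _z : J, mu.real B := Finset.sum_le_sum fun z _ => hA z
      _ = _ := by simp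
  have h5 : (Fintype.card J : ℝ) ≤ Fintype.card ι * (5 / η) ^ k := by
    have hc : Fintype.card J = Fintype.card ι * (2 * K + 1) ^ k := by
      simp only [J, Fintype.card_prod, Fintype.card_pi, Finset.prod_const, Fintype.card_coe,
        Int.card_Icc, Finset.card_univ, Fintype.card_fin]
      congr 2; omega
    rw [hc]; push_cast
    gcongr
    have : (K:ℝ) < 1 / η + 1 := Nat.ceil_lt_add_one (by positivity)
    have h6 : 1 ≤ 1 / η := by rw [le_div_iff₀ h0]; linarith
    have : 5 / η = 5 * (1 / η) := by ring
    linarith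
  calc (1:ℝ) ≤ _ := h3.trans h4
    _ ≤ _ := by gcongr

lemma coord_cell {η P Q : ℝ} {n : ℕ} (q r : Fin n → ℝ) (hP : 1/2 ≤ P) (hQ : 1/2 ≤ Q)
    (h1 : P ^ 2 + ∑ i, q i ^ 2 = 1) (h2 : Q ^ 2 + ∑ i, r i ^ 2 = 1)
    (hd : ∀ i, |q i - r i| ≤ η) : (P - Q) ^ 2 + ∑ i, (q i - r i) ^ 2 ≤ (4 * n ^ 2 + n) * η ^ 2 := by
  have b : ∀ (P : ℝ) (q : Fin n → ℝ), P ^ 2 + ∑ i, q i ^ 2 = 1 → ∀ i, |q i| ≤ 1 := by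
    intro P q h i
    have : q i ^ 2 ≤ ∑ i, q i ^ 2 := Finset.single_le_sum (fun i _ => sq_nonneg (q i)) (Finset.mem_univ i)
    exact abs_le_one_iff_mul_self_le_one.2 (by nlinarith)
  have e : (P - Q) * (P + Q) = ∑ i, (r i - q i) * (r i + q i) := by
    have : ∑ i, (r i - q i) * (r i + q i) = ∑ i, r i ^ 2 - ∑ i, q i ^ 2 := by
      rw [← Finset.sum_sub_distrib]; exact Finset.sum_congr rfl fun i _ => by ring
    rw [this]; linear_combination h1 - h2
  have h3 : |P - Q| ≤ 2 * n * η := by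
    calc |P - Q| ≤ |P - Q| * |P + Q| := le_mul_of_one_le_right (abs_nonneg _) (by
          rw [abs_of_nonneg (by linarith)]; linarith)
      _ = |∑ i, (r i - q i) * (r i + q i)| := by rw [← abs_mul, e]
      _ ≤ ∑ i, |(r i - q i) * (r i + q i)| := Finset.abs_sum_le_sum_abs _ _
      _ ≤ ∑ _i : Fin n, η * 2 := Finset.sum_le_sum fun i _ => by
          rw [abs_mul]
          refine mul_le_mul (by rw [abs_sub_comm]; exact hd i) ?_ (abs_nonneg _) ((abs_nonneg _).trans (hd i))
          exact (abs_add_le _ _).trans (by linarith [b P q h1 i, b Q r h2 i])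
      _ = _ := by simp; ring
  have h4 : ∑ i, (q i - r i) ^ 2 ≤ n * η ^ 2 := by
    calc _ ≤ ∑ _i : Fin n, η ^ 2 := Finset.sum_le_sum fun i _ => by
          rw [← sq_abs]; exact pow_le_pow_left₀ (abs_nonneg _) (hd i) 2
      _ = _ := by simp
  have h5 : (P - Q) ^ 2 ≤ (2 * n * η) ^ 2 := by
    rw [← sq_abs]; exact pow_le_pow_left₀ (abs_nonneg _) h3 2
  nlinarith

lemma norm_inv_mul_sub_one (x y : GG) : ‖((y⁻¹ * x : GG) : ℍ[ℝ]) - 1‖ = ‖(x : ℍ[ℝ]) - y‖ := by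
  have : (x : ℍ[ℝ]) - y = (y : ℍ[ℝ]) * (((y⁻¹ * x : GG) : ℍ[ℝ]) - 1) := by
    rw [mul_sub, ← coe_mul_GG, mul_inv_cancel_left, mul_one]
  rw [this, norm_mul]; simp

lemma pole_conj (g : GG) (a b : ℍ[ℝ]) :
    ‖(g : ℍ[ℝ]) * a * star (g : ℍ[ℝ]) - (g : ℍ[ℝ]) * b * star (g : ℍ[ℝ])‖ = ‖a - b‖ := by
  rw [← sub_mul, ← mul_sub, norm_mul, norm_mul, norm_star]; simp

lemma norm_pole_inv_mul (x y : GG) : ‖pole (y⁻¹ * x) - pole 1‖ = ‖pole x - pole y‖ := by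
  have h1 : pole x = pole (y * (y⁻¹ * x)) := by rw [mul_inv_cancel_left]
  have h2 : pole y = pole (y * 1) := by rw [mul_one]
  rw [h1, h2, pole_mul y (y⁻¹ * x), pole_mul y 1, pole_conj]

lemma ball_measure (ρ : ℝ) (h0 : 0 < ρ) (h1 : ρ ≤ 1) :
    1 ≤ 8 * (35 / ρ) ^ 3 * mu.real {g : GG | ‖(g : ℍ[ℝ]) - 1‖ ≤ ρ} := by
  let P : Fin 8 → GG → ℝ := ![fun g => (g : ℍ[ℝ]).re, fun g => -(g : ℍ[ℝ]).re,
    fun g => (g : ℍ[ℝ]).imI, fun g => -(g : ℍ[ℝ]).imI,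
    fun g => (g : ℍ[ℝ]).imJ, fun g => -(g : ℍ[ℝ]).imJ,
    fun g => (g : ℍ[ℝ]).imK, fun g => -(g : ℍ[ℝ]).imK]
  let F : Fin 8 → GG → Fin 3 → ℝ :=
    ![fun g => ![(g : ℍ[ℝ]).imI, (g : ℍ[ℝ]).imJ, (g : ℍ[ℝ]).imK],
      fun g => ![(g : ℍ[ℝ]).imI, (g : ℍ[ℝ]).imJ, (g : ℍ[ℝ]).imK],
      fun g => ![(g : ℍ[ℝ]).re, (g : ℍ[ℝ]).imJ, (g : ℍ[ℝ]).imK],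
      fun g => ![(g : ℍ[ℝ]).re, (g : ℍ[ℝ]).imJ, (g : ℍ[ℝ]).imK],
      fun g => ![(g : ℍ[ℝ]).re, (g : ℍ[ℝ]).imI, (g : ℍ[ℝ]).imK],
      fun g => ![(g : ℍ[ℝ]).re, (g : ℍ[ℝ]).imI, (g : ℍ[ℝ]).imK],
      fun g => ![(g : ℍ[ℝ]).re, (g : ℍ[ℝ]).imI, (g : ℍ[ℝ]).imJ],
      fun g => ![(g : ℍ[ℝ]).re, (g : ℍ[ℝ]).imI, (g : ℍ[ℝ]).imJ]]
  have hsum : ∀ i g, P i g ^ 2 + ∑ j, F i g j ^ 2 = 1 := by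
    intro i g
    have := GG_nsq g
    fin_cases i <;> simp [P, F, Fin.sum_univ_three] <;> linarith
  have hdist : ∀ i x y, (P i x - P i y) ^ 2 + ∑ j, (F i x j - F i y j) ^ 2 = ‖(x : ℍ[ℝ]) - y‖ ^ 2 := by
    intro i x y
    rw [sq ‖_‖, ← Quaternion.normSq_eq_norm_mul_self, Quaternion.normSq_def']
    fin_cases i <;> simp [P, F, Fin.sum_univ_three] <;> ring
  have hb : ∀ i g j, |F i g j| ≤ 1 := by
    intro i g j
    have : F i g j ^ 2 ≤ ∑ j, F i g j ^ 2 :=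
      Finset.single_le_sum (fun j _ => sq_nonneg (F i g j)) (Finset.mem_univ j)
    have h2 := hsum i g
    exact abs_le_one_iff_mul_self_le_one.2 (by nlinarith [sq_nonneg (P i g)])
  have := pig 3 {g : GG | ‖(g : ℍ[ℝ]) - 1‖ ≤ ρ} (fun i => {g | 1/2 ≤ P i g}) F hb (fun g => by
    by_contra! hn
    have := GG_nsq g
    have n0 := hn 0
    have n1 := hn 1
    have n2 := hn 2
    have n3 := hn 3
    have n4 := hn 4
    have n5 := hn 5
    have n6 := hn 6
    have n7 := hn 7
    simp [P] at n0 n1 n2 n3 n4 n5 n6 n7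
    nlinarith) (ρ / 7) (by positivity) (by linarith) (fun i x y hx hy hd => by
      have h := coord_cell (F i x) (F i y) hx hy (hsum i x) (hsum i y) hd
      rw [hdist] at h
      show ‖_‖ ≤ ρ
      rw [norm_inv_mul_sub_one]
      refine abs_le_of_sq_le_sq' ?_ h0.le |>.2
      push_cast at h
      nlinarith [sq_nonneg ρ])
  have e : 5 / (ρ / 7) = 35 / ρ := by field_simp; norm_num
  rw [e] at this
  simpa using this

lemma cap_measure (ρ : ℝ) (h0 : 0 < ρ) (h1 : ρ ≤ 1) :
    1 ≤ 6 * (25 / ρ) ^ 2 * mu.real {g : GG | ‖pole g - pole 1‖ ≤ ρ} := by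
  let P : Fin 6 → GG → ℝ := ![fun g => c1 g, fun g => -c1 g, fun g => c2 g, fun g => -c2 g,
    fun g => c3 g, fun g => -c3 g]
  let F : Fin 6 → GG → Fin 2 → ℝ :=
    ![fun g => ![c2 g, c3 g], fun g => ![c2 g, c3 g], fun g => ![c1 g, c3 g],
      fun g => ![c1 g, c3 g], fun g => ![c1 g, c2 g], fun g => ![c1 g, c2 g]]
  have hsum : ∀ i g, P i g ^ 2 + ∑ j, F i g j ^ 2 = 1 := by
    intro i g
    have := cc_sq g
    fin_cases i <;> simp [P, F] <;> linarith
  have hdist : ∀ i x y, (P i x - P i y) ^ 2 + ∑ j, (F i x j - F i y j) ^ 2 = ‖pole x - pole y‖ ^ 2 := by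
    intro i x y
    rw [sq ‖_‖, ← Quaternion.normSq_eq_norm_mul_self, Quaternion.normSq_def']
    fin_cases i <;> simp [P, F, pole] <;> ring
  have hb : ∀ i g j, |F i g j| ≤ 1 := by
    intro i g j
    have : F i g j ^ 2 ≤ ∑ j, F i g j ^ 2 :=
      Finset.single_le_sum (fun j _ => sq_nonneg (F i g j)) (Finset.mem_univ j)
    have h2 := hsum i g
    exact abs_le_one_iff_mul_self_le_one.2 (by nlinarith [sq_nonneg (P i g)])
  have := pig 2 {g : GG | ‖pole g - pole 1‖ ≤ ρ} (fun i => {g | 1/2 ≤ P i g}) F hb (fun g => by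
    by_contra! hn
    have := cc_sq g
    have n0 := hn 0
    have n1 := hn 1
    have n2 := hn 2
    have n3 := hn 3
    have n4 := hn 4
    have n5 := hn 5
    simp [P] at n0 n1 n2 n3 n4 n5
    nlinarith) (ρ / 5) (by positivity) (by linarith) (fun i x y hx hy hd => by
      have h := coord_cell (F i x) (F i y) hx hy (hsum i x) (hsum i y) hd
      rw [hdist] at h
      show ‖_‖ ≤ ρ
      rw [norm_pole_inv_mul]
      refine abs_le_of_sq_le_sq' ?_ h0.le |>.2
      push_cast at h
      nlinarith [sq_nonneg ρ])
  have e : 5 / (ρ / 5) = 25 / ρ := by field_simp; norm_num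
  rw [e] at this
  simpa using this

/-- bump functions -/
lemma bump_int (D : GG → ℝ) (hD : Continuous D) (ρ : ℝ) (h0 : 0 < ρ) :
    mu.real {g | D g ≤ ρ / 2} / 2 ≤ ∫ g, max 0 (1 - D g / ρ) ∂mu := by
  have hm : MeasurableSet {g | D g ≤ ρ / 2} := (isClosed_le hD continuous_const).measurableSet
  have : mu.real {g | D g ≤ ρ / 2} / 2 = ∫ g, ({g | D g ≤ ρ / 2} : Set GG).indicator (fun _ => (1/2 : ℝ)) g ∂mu := by
    rw [integral_indicator hm]; simp; ring
  rw [this]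
  refine integral_mono ((integrable_const _).indicator hm) (intg (by fun_prop)) fun g => ?_
  by_cases hg : g ∈ {g | D g ≤ ρ / 2}
  · rw [Set.indicator_of_mem hg]
    refine le_max_of_le_right ?_
    have : D g / ρ ≤ 1 / 2 := by
      rw [div_le_iff₀ h0]
      have : D g ≤ ρ / 2 := hg
      linarith
    linarith
  · rw [Set.indicator_of_notMem hg]; exact le_max_left _ _
end

noncomputable section
open scoped Quaternion
namespace OO
variable {α β : ℕ}

/-- the real embedding of the order -/
def em (q : OO α β) : ℍ[ℝ] :=
  qmk q.re (√α * q.imI) (√β * q.imJ) (√α * √β * q.imK)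

lemma em_mul (q r : OO α β) : em (q * r) = em q * em r := by
  have ha : √(α:ℝ) ^ 2 = α := Real.sq_sqrt (by positivity)
  have hb : √(β:ℝ) ^ 2 = β := Real.sq_sqrt (by positivity)
  ext
  · simp [em]
    linear_combination ((q.imI:ℝ) * r.imI + √β ^ 2 * q.imK * r.imK) * ha + ((q.imJ:ℝ) * r.imJ + α * q.imK * r.imK) * hb
  · simp [em]
    linear_combination (√α * (-(q.imJ:ℝ) * r.imK + q.imK * r.imJ)) * hb
  · simp [em]
    linear_combination (√β * ((q.imI:ℝ) * r.imK - q.imK * r.imI)) * ha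
  · simp [em]; ring
lemma em_one : em (1 : OO α β) = 1 := by ext <;> simp [em]
lemma em_star (q : OO α β) : em (star q) = star (em q) := by ext <;> simp [em]
lemma em_sub (q r : OO α β) : em (q - r) = em q - em r := by ext <;> simp [em] <;> ring
lemma em_sc (k : ℤ) (q : OO α β) : em (sc k q) = (k : ℝ) • em q := by ext <;> simp [em] <;> ring
lemma em_norm (q : OO α β) : ‖em q‖ ^ 2 = nm q := by
  have ha : √(α:ℝ) ^ 2 = α := Real.sq_sqrt (by positivity)
  have hb : √(β:ℝ) ^ 2 = β := Real.sq_sqrt (by positivity)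
  rw [sq, ← Quaternion.normSq_eq_norm_mul_self, Quaternion.normSq_def']
  simp [em, nm, mul_pow, ha, hb]

/-- the unit quaternion attached to `q` -/
def uu (q : OO α β) : GG :=
  if h : nm q = 0 then 1 else ⟨(‖em q‖)⁻¹ • em q, by
    have h1 : ‖em q‖ ≠ 0 := fun h2 => h (by
      have := em_norm q
      rw [h2, zero_pow two_ne_zero] at this
      exact_mod_cast this.symm)
    rw [mem_sphere_zero_iff_norm, norm_smul, norm_inv, norm_norm, inv_mul_cancel₀ h1]⟩

lemma norm_em_ne {q : OO α β} (h : nm q ≠ 0) : ‖em q‖ ≠ 0 := fun h2 => h (by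
  have := em_norm q
  rw [h2, zero_pow two_ne_zero] at this
  exact_mod_cast this.symm)

lemma uu_coe {q : OO α β} (h : nm q ≠ 0) : (uu q : ℍ[ℝ]) = (‖em q‖)⁻¹ • em q := by
  rw [uu, dif_neg h]

lemma em_eq {q : OO α β} (h : nm q ≠ 0) : em q = ‖em q‖ • (uu q : ℍ[ℝ]) := by
  rw [uu_coe h, smul_smul, mul_inv_cancel₀ (norm_em_ne h), one_smul]

lemma uu_one : uu (1 : OO α β) = 1 := by
  apply Subtype.ext
  rw [uu_coe (by simp [nm_one]), em_one]; simp

lemma uu_mul {q r : OO α β} (hq : nm q ≠ 0) (hr : nm r ≠ 0) : uu (q * r) = uu q * uu r := by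
  apply Subtype.ext
  rw [coe_mul_GG, uu_coe hq, uu_coe hr, uu_coe (by rw [nm_mul]; exact mul_ne_zero hq hr), em_mul, norm_mul]
  simp [smul_smul]

lemma uu_star {q : OO α β} (hq : nm q ≠ 0) : uu (star q) = (uu q)⁻¹ := by
  apply Subtype.ext
  rw [coe_inv_GG, uu_coe (by rwa [nm_star]), uu_coe hq, em_star, norm_star]
  simp

/-- the averaging operator -/
def TT (S : Finset (OO α β)) : C(GG, ℝ) →ₗ[ℝ] C(GG, ℝ) := ∑ q ∈ S, (Lg (uu q)).toLinearMap

lemma TT_apply (S : Finset (OO α β)) (f : C(GG, ℝ)) : TT S f = ∑ q ∈ S, Lg (uu q) f := by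
  simp [TT, LinearMap.sum_apply]

lemma TT_one (S : Finset (OO α β)) : TT S 1 = (S.card : ℝ) • 1 := by
  rw [TT_apply]; simp [map_one, Nat.cast_smul_eq_nsmul]

lemma intC_TT (S : Finset (OO α β)) (f : C(GG, ℝ)) : intC (TT S f) = S.card * intC f := by
  rw [TT_apply, map_sum]; simp [intC_Lg]

lemma TT_VV (S : Finset (OO α β)) {d : ℕ} {f : C(GG, ℝ)} (hf : f ∈ VV ^ d) : TT S f ∈ VV ^ d := by
  rw [TT_apply]; exact Submodule.sum_mem _ fun q _ => VVpow_Lg _ d hf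

lemma TT_pow_WW {S : Finset (OO α β)} {ν : ℤ} (hν : ν ≠ 0) (hS : ∀ q ∈ S, nm q = ν) (r : ℕ)
    (f : C(GG, ℝ)) : ∀ l : C(GG, ℝ) →ₗ[ℝ] ℝ, l ((TT S ^ r) f) = WW S r (fun Q => l (Lg (uu Q) f)) := by
  induction r with
  | zero => intro l; simp [WW, uu_one, Lg_one]
  | succ r ih =>
    intro l
    rw [pow_succ', Module.End.mul_apply, TT_apply, map_sum]
    simp only [WW]
    refine Finset.sum_congr rfl fun q hq => ?_
    have := ih (l.comp (Lg (uu q)).toLinearMap)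
    simp only [LinearMap.comp_apply, AlgHom.toLinearMap_apply] at this
    rw [this]
    refine WW_congr hS r _ _ fun Q hQ => ?_
    rw [uu_mul (by rw [hS q hq]; exact hν) (by rw [hQ]; exact pow_ne_zero _ hν), Lg_mul]

lemma TT_symm {S : Finset (OO α β)} {ν : ℤ} (hν : ν ≠ 0) (hS : ∀ q ∈ S, nm q = ν)
    (hstar : ∀ q ∈ S, star q ∈ S) (f h : C(GG, ℝ)) : ip (TT S f) h = ip f (TT S h) := by
  rw [TT_apply, TT_apply, map_sum, map_sum, LinearMap.sum_apply]
  refine Finset.sum_nbij' star star hstar hstar (by simp) (by simp) fun q hq => ?_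
  rw [ip_Lg_left, uu_star (by rw [hS q hq]; exact hν)]

lemma TT_pow_symm {S : Finset (OO α β)} {ν : ℤ} (hν : ν ≠ 0) (hS : ∀ q ∈ S, nm q = ν)
    (hstar : ∀ q ∈ S, star q ∈ S) (r : ℕ) : ∀ f h : C(GG, ℝ), ip ((TT S ^ r) f) h = ip f ((TT S ^ r) h) := by
  induction r with
  | zero => intro f h; rfl
  | succ r ih =>
    intro f h
    rw [pow_succ', Module.End.mul_apply, TT_symm hν hS hstar, ih, ← pow_succ', pow_succ, Module.End.mul_apply]

/-- the basic `L²` bound for `T^k f`. -/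
lemma TT_norm {S : Finset (OO α β)} {ν : ℤ} (hν : ν ≠ 0) (hS : ∀ q ∈ S, nm q = ν)
    (hstar : ∀ q ∈ S, star q ∈ S) (k : ℕ) (f : C(GG, ℝ)) (h0 : ∀ x, 0 ≤ f x) (h1 : ∀ x, f x ≤ 1)
    (A : Set (OO α β)) (hA : ∀ Q x, nm Q = ν ^ (2 * k) → f x ≠ 0 → f ((uu Q)⁻¹ * x) ≠ 0 → Q ∈ A) :
    ip ((TT S ^ k) f) ((TT S ^ k) f) ≤ intC f * WW S (2 * k) (A.indicator fun _ => 1) := by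
  have e : ip ((TT S ^ k) f) ((TT S ^ k) f) = ip f ((TT S ^ (2 * k)) f) := by
    rw [TT_pow_symm hν hS hstar, ← Module.End.mul_apply, ← pow_add, two_mul]
  rw [e, TT_pow_WW hν hS, ← WW_mul]
  refine WW_mono hS _ _ _ fun Q hQ => ?_
  by_cases hQA : Q ∈ A
  · rw [Set.indicator_of_mem hQA, mul_one, intC_apply, ip_apply]
    refine integral_mono (intg (by fun_prop)) (intg (by fun_prop)) fun x => ?_
    exact mul_le_of_le_one_right (h0 x) (h1 _)
  · rw [Set.indicator_of_notMem hQA, mul_zero, ip_apply]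
    refine le_of_eq (integral_eq_zero_of_ae (Eventually.of_forall fun x => ?_))
    by_contra hne
    have := mul_ne_zero_iff.1 hne
    exact hQA (hA Q x hQ this.1 this.2)

/-- `T` acts on matrix coefficients of eigenfunctions. -/
lemma TT_mc {S : Finset (OO α β)}
    (w : C(GG, ℝ)) (l : ℝ) (hw : TT S w = l • w) : TT S (mc w) = l • mc w := by
  ext g
  rw [TT_apply, ContinuousMap.sum_apply, ContinuousMap.smul_apply, mc_apply]
  have : ∀ q ∈ S, Lg (uu q) (mc w) g = ip (Lg g w) (Lg (uu q) w) := by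
    intro q _
    rw [Lg_apply, mc_apply, Lg_mul, ip_Lg_left, inv_inv]
  rw [Finset.sum_congr rfl this, ← map_sum, ← TT_apply, hw, map_smul]

lemma TT_pow_eig {S : Finset (OO α β)} (w : C(GG, ℝ)) (l : ℝ) (hw : TT S w = l • w) (k : ℕ) :
    (TT S ^ k) w = l ^ k • w := by
  induction k with
  | zero => simp
  | succ k ih => rw [pow_succ, Module.End.mul_apply, hw, map_smul, ih, smul_smul, pow_succ']

end OO
end

noncomputable section
open scoped Quaternion
namespace OO
variable {α β : ℕ}

lemma uu_dist {Q : OO α β} {R : ℝ} (hR : 0 < R) (hQ : (nm Q : ℝ) = R ^ 2) {z : ℤ} (hz : (z : ℝ) = R) :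
    (nm (Q - sc z 1) : ℝ) = R ^ 2 * ‖(uu Q : ℍ[ℝ]) - 1‖ ^ 2 := by
  have h0 : nm Q ≠ 0 := fun h => by rw [h] at hQ; simp at hQ; exact (pow_pos hR 2).ne' hQ.symm
  have hn : ‖em Q‖ = R := by
    have := em_norm Q
    rw [hQ] at this
    exact (pow_left_inj₀ (norm_nonneg _) hR.le two_ne_zero).1 this
  rw [← em_norm, em_sub, em_sc, em_one, em_eq h0, hn, hz, ← smul_sub, norm_smul, mul_pow]
  simp

lemma high_freq_step {S : Finset (OO α β)} {ν : ℤ} (hν : ν ≠ 0) (hS : ∀ q ∈ S, nm q = ν)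
    (hstar : ∀ q ∈ S, star q ∈ S) (k d : ℕ) (w : C(GG, ℝ)) (hw : w ∈ VV ^ (d + 1))
    (ho : ∀ h ∈ VV ^ d, ip w h = 0) (h1 : ip w w = 1) (l : ℝ) (hT : TT S w = l • w) (ρ W : ℝ)
    (hρ0 : 0 < ρ) (hρ1 : ρ ≤ 1) (hρ : ((d + 1 : ℕ) : ℝ) ^ 2 * ρ ^ 2 ≤ 1 / 5)
    (hW : WW S (2 * k) ({Q | ‖(uu Q : ℍ[ℝ]) - 1‖ ≤ 2 * ρ}.indicator fun _ => 1) ≤ W) :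
    l ^ (2 * k) ≤ 64 * (70 / ρ) ^ 3 * W / √((d + 1 : ℕ) : ℝ) := by
  have hD : Continuous fun g : GG => ‖(g : ℍ[ℝ]) - 1‖ := by fun_prop
  let ψ : C(GG, ℝ) := ⟨fun g => max 0 (1 - ‖(g : ℍ[ℝ]) - 1‖ / ρ), by fun_prop⟩
  have hψ : ∀ g, ψ g = max 0 (1 - ‖(g : ℍ[ℝ]) - 1‖ / ρ) := fun g => rfl
  have hψ0 : ∀ g, 0 ≤ ψ g := fun g => le_max_left _ _
  have hψ1 : ∀ g, ψ g ≤ 1 := fun g => max_le zero_le_one (by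
    have : 0 ≤ ‖(g : ℍ[ℝ]) - 1‖ / ρ := by positivity
    linarith)
  have hψs : ∀ g, ψ g ≠ 0 → ‖(g : ℍ[ℝ]) - 1‖ ≤ ρ := by
    intro g hg
    by_contra! hlt
    apply hg
    rw [hψ, max_eq_left]
    rw [sub_nonpos, le_div_iff₀ hρ0]; linarith
  set I := intC ψ with hI
  have hIV : 1 ≤ 16 * (70 / ρ) ^ 3 * I := by
    have a1 := ball_measure (ρ / 2) (by positivity) (by linarith)
    have a2 := bump_int _ hD ρ hρ0
    have a3 : ∫ g, max 0 (1 - ‖(g : ℍ[ℝ]) - 1‖ / ρ) ∂mu = I := by rw [hI, intC_apply]; rfl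
    rw [a3] at a2
    have a4 : 35 / (ρ / 2) = 70 / ρ := by field_simp; norm_num
    rw [a4] at a1
    have : 0 < (70 / ρ) ^ 3 := by positivity
    nlinarith
  have hI0 : 0 < I := by
    by_contra! h
    have : 0 < (70 / ρ) ^ 3 := by positivity
    nlinarith
  set m := mc w with hm
  have hnorm : ip ((TT S ^ k) ψ) ((TT S ^ k) ψ) ≤ I * W := by
    refine (TT_norm hν hS hstar k ψ hψ0 hψ1 _ ?_).trans (mul_le_mul_of_nonneg_left hW hI0.le)
    intro Q x _ hx hx'
    have b1 := hψs _ hx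
    have b2 := hψs _ hx'
    rw [norm_inv_mul_sub_one] at b2
    calc ‖(uu Q : ℍ[ℝ]) - 1‖ = ‖((x : ℍ[ℝ]) - 1) - ((x : ℍ[ℝ]) - uu Q)‖ := by congr 1; abel
      _ ≤ _ := (norm_sub_le _ _).trans (by linarith)
  have hpair : ip ((TT S ^ k) ψ) m = l ^ k * ip ψ m := by
    rw [TT_pow_symm hν hS hstar, TT_pow_eig m l (TT_mc w l hT), map_smul, smul_eq_mul]
  have hlow : I / 2 ≤ ip ψ m := by
    rw [ip_apply, hI, intC_apply, ← integral_div]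
    refine integral_mono (intg (by fun_prop)) (intg (by fun_prop)) fun g => ?_
    by_cases hg : ψ g = 0
    · simp [hg]
    · have := mc_large hw h1 g (le_trans (by gcongr; exact hψs g hg) hρ)
      have := hψ0 g
      simp only; nlinarith
  have hcs := ip_cs ((TT S ^ k) ψ) m
  rw [hpair] at hcs
  have hm0 := ip_nonneg m
  have hsmall := mc_small hw ho h1
  rw [← hm] at hsmall
  have hms : ip m m ≤ 1 / √((d + 1 : ℕ) : ℝ) := by
    rw [le_div_iff₀ (by positivity)]
    have h3 : (ip m m * √((d + 1 : ℕ) : ℝ)) ^ 2 ≤ 1 ^ 2 := by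
      rw [mul_pow, Real.sq_sqrt (by positivity)]
      push_cast
      nlinarith [sq_nonneg (ip m m)]
    exact (abs_le_of_sq_le_sq' h3 zero_le_one).2
  have e2 : l ^ (2 * k) = (l ^ k) ^ 2 := by rw [mul_comm, pow_mul]
  have hW0 : 0 ≤ W := by
    have := (ip_nonneg _).trans hnorm
    exact nonneg_of_mul_nonneg_right this hI0
  have h5 : l ^ (2 * k) * (I / 2) ^ 2 ≤ I * W * ip m m := by
    rw [e2]
    calc (l ^ k) ^ 2 * (I / 2) ^ 2 ≤ (l ^ k) ^ 2 * (ip ψ m) ^ 2 := by gcongr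
      _ = (l ^ k * ip ψ m) ^ 2 := by ring
      _ ≤ _ := hcs
      _ ≤ _ := by gcongr
  have h6 : l ^ (2 * k) * I ≤ 4 * W * ip m m := by
    have : I * (l ^ (2 * k) * I) ≤ I * (4 * W * ip m m) := by nlinarith
    exact le_of_mul_le_mul_left this hI0
  have hl0 : 0 ≤ l ^ (2 * k) := by rw [e2]; positivity
  calc l ^ (2 * k) ≤ l ^ (2 * k) * (16 * (70 / ρ) ^ 3 * I) := le_mul_of_one_le_right hl0 hIV
    _ = 16 * (70 / ρ) ^ 3 * (l ^ (2 * k) * I) := by ring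
    _ ≤ 16 * (70 / ρ) ^ 3 * (4 * W * ip m m) := by gcongr
    _ ≤ 16 * (70 / ρ) ^ 3 * (4 * W * (1 / √((d + 1 : ℕ) : ℝ))) := by gcongr
    _ = _ := by ring

lemma real_calc (P C : ℝ) (hP : 1 < P) (hC : 1 ≤ C) (k : ℕ) (hk : 1 ≤ k) (M l : ℝ) (hM : 0 ≤ M) (N : ℝ) (hN : 1 ≤ N)
    (hM2 : P ^ (35/36 : ℝ) ≤ M)
    (hR1 : N ^ 3 ≤ P ^ k) (hR2 : P ^ k ≤ P * N ^ 3)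
    (hNC : (64 * 210 ^ 3 * 2 * C * P) ^ 24 ≤ N)
    (hl : l ^ (2 * k) ≤ 64 * (210 * N) ^ 3 * (C * (P ^ k) ^ (1 + 1/36 : ℝ) * (1 + (1 / N) ^ 3 * P ^ k)) / √N) :
    |l| ≤ P ^ (-(1/48) : ℝ) * M := by
  have hP0 : 0 < P := by linarith
  have hN0 : 0 < N := by linarith
  set R := P ^ k with hR
  have hR0 : 0 < R := by positivity
  set C5 := 64 * 210 ^ 3 * 2 * C * P with hC5
  have hC50 : 0 ≤ C5 := by positivity
  have s1 : N ^ 3 * (1 + (1 / N) ^ 3 * R) ≤ 2 * R := by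
    have : N ^ 3 * (1 + (1 / N) ^ 3 * R) = N ^ 3 + R := by field_simp
    rw [this]; linarith
  have s2 : 1 / √N ≤ P * R ^ (-(1/6) : ℝ) := by
    have t1 : R ^ (1/6 : ℝ) ≤ P * √N := by
      calc R ^ (1/6 : ℝ) ≤ (P * N ^ 3) ^ (1/6 : ℝ) := by gcongr
        _ = P ^ (1/6 : ℝ) * (N ^ 3) ^ (1/6 : ℝ) := Real.mul_rpow hP0.le (by positivity)
        _ ≤ P * √N := by
          gcongr
          · calc P ^ (1/6 : ℝ) ≤ P ^ (1 : ℝ) := Real.rpow_le_rpow_of_exponent_le hP.le (by norm_num)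
              _ = P := Real.rpow_one P
          · rw [← Real.rpow_natCast, ← Real.rpow_mul hN0.le, Real.sqrt_eq_rpow]
            norm_num
    rw [Real.rpow_neg hR0.le, div_le_iff₀ (by positivity)]
    rw [mul_right_comm, ← div_eq_mul_inv, le_div_iff₀ (by positivity), one_mul]
    exact t1
  have s3 : l ^ (2 * k) ≤ C5 * R ^ (2 + 1/36 - 1/6 : ℝ) := by
    calc l ^ (2 * k) ≤ _ := hl
      _ = 64 * 210 ^ 3 * C * R ^ (1 + 1/36 : ℝ) * (N ^ 3 * (1 + (1 / N) ^ 3 * R)) * (1 / √N) := by ring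
      _ ≤ 64 * 210 ^ 3 * C * R ^ (1 + 1/36 : ℝ) * (2 * R) * (P * R ^ (-(1/6) : ℝ)) := by gcongr
      _ = C5 * (R ^ (1 + 1/36 : ℝ) * R ^ (1 : ℝ) * R ^ (-(1/6) : ℝ)) := by rw [Real.rpow_one, hC5]; ring
      _ = _ := by rw [← Real.rpow_add hR0, ← Real.rpow_add hR0]; norm_num
  have hRN : N ≤ R := le_trans (by nlinarith [sq_nonneg N, mul_nonneg hN0.le (sub_nonneg.2 hN)]) hR1
  have s4 : C5 ≤ R ^ (1/24 : ℝ) := by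
    have : C5 ^ 24 ≤ R := hNC.trans hRN
    calc C5 = (C5 ^ 24) ^ (1/24 : ℝ) := by
          rw [← Real.rpow_natCast, ← Real.rpow_mul hC50]; norm_num
      _ ≤ _ := by gcongr
  have s5 : l ^ (2 * k) ≤ (P ^ (-(1/48) : ℝ) * M) ^ (2 * k) := by
    calc l ^ (2 * k) ≤ _ := s3
      _ ≤ R ^ (1/24 : ℝ) * R ^ (2 + 1/36 - 1/6 : ℝ) := by gcongr
      _ = R ^ (-(1/24) + 2 * (35/36) : ℝ) := by rw [← Real.rpow_add hR0]; norm_num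
      _ = (P ^ (-(1/48) : ℝ) * P ^ (35/36 : ℝ)) ^ (2 * k) := by
          rw [← Real.rpow_add hP0, hR, ← Real.rpow_natCast, ← Real.rpow_mul hP0.le, ← Real.rpow_natCast, ← Real.rpow_mul hP0.le]
          congr 1; push_cast; ring
      _ ≤ _ := by gcongr
  rw [← (even_two_mul k).pow_abs] at s5
  exact le_of_pow_le_pow_left₀ (by omega) (by positivity) s5

theorem high_freq (hα : 0 < α) (hβ : 0 < β) {p : ℕ} [hp : Fact p.Prime] (x y : ℚ_[p]) (h : x^2+α*y^2 = -(β:ℚ_[p])) :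
    ∃ m, 1 ≤ m ∧ 0 < (finite_eq hα hβ ((p:ℤ)^m)).toFinset.card ∧ ∃ θ : ℝ, 0 ≤ θ ∧ θ < 1 ∧ ∃ d0 : ℕ, ∀ d, d0 ≤ d → ∀ (w : C(GG, ℝ)) (l : ℝ),
      w ∈ VV ^ (d + 1) → (∀ h ∈ VV ^ d, ip w h = 0) → w ≠ 0 →
      TT (finite_eq hα hβ ((p:ℤ)^m)).toFinset w = l • w → |l| ≤ θ * (finite_eq hα hβ ((p:ℤ)^m)).toFinset.card := by
  obtain ⟨m, hm, C, hC, hM, hcount⟩ := NTmain hα hβ x y h ⟨0, 1, 0, 0⟩ rfl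
    (by intro h; have := congrArg QuaternionAlgebra.imI h; simp at this) (1/36) (by norm_num)
  have hp1 : (1:ℝ) < p := by exact_mod_cast hp.out.one_lt
  set S := (finite_eq hα hβ ((p:ℤ)^m)).toFinset with hSdef
  have hS : ∀ q ∈ S, nm q = (p:ℤ)^m := fun q hq => by simpa [hSdef] using hq
  have hstar : ∀ q ∈ S, star q ∈ S := fun q hq => by
    have := hS q hq
    simp [hSdef, nm_star, this]
  have hν : (p:ℤ)^m ≠ 0 := pow_ne_zero _ (by exact_mod_cast hp.out.ne_zero)
  set P : ℝ := (p:ℝ)^m with hPdef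
  have hP : 1 < P := one_lt_pow₀ hp1 (by omega)
  have hMP : P ^ (35/36 : ℝ) ≤ S.card := by
    refine le_trans (le_of_eq ?_) hM
    rw [hPdef, ← Real.rpow_natCast, ← Real.rpow_mul (by linarith)]; norm_num
  refine ⟨m, hm, ?_, P ^ (-(1/48) : ℝ), by positivity, Real.rpow_lt_one_of_one_lt_of_neg hP (by norm_num),
    ⌈(64 * 210 ^ 3 * 2 * C * P) ^ 24⌉₊, ?_⟩
  · have : (0:ℝ) < S.card := lt_of_lt_of_le (by positivity) hMP
    exact_mod_cast this
  intro d hd w l hw ho hw0 hT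
  wlog h1 : ip w w = 1 generalizing w
  · have hp := ip_pos hw0
    set c := √(ip w w) with hc
    have hc0 : 0 < c := Real.sqrt_pos.2 hp
    refine this (c⁻¹ • w) (Submodule.smul_mem _ _ hw) (fun h hh => by simp [ho h hh]) (smul_ne_zero (by positivity) hw0)
      (by rw [map_smul, hT, smul_comm]) ?_
    have hcc : c * c = ip w w := Real.mul_self_sqrt hp.le
    simp only [map_smul, LinearMap.smul_apply, smul_eq_mul]
    rw [← hcc]; field_simp
  have hN1 : (1:ℝ) ≤ ((d + 1 : ℕ) : ℝ) := by exact_mod_cast Nat.succ_le_succ (Nat.zero_le d)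
  set N : ℝ := ((d + 1 : ℕ) : ℝ) with hN
  obtain ⟨n, hn1, hn2⟩ := exists_nat_pow_near (one_le_pow₀ hN1 : 1 ≤ N ^ 3) hP
  have hPk : ((p:ℝ) ^ (m * (n + 1))) = P ^ (n + 1) := by rw [pow_mul]
  refine real_calc P C hP hC (n + 1) (by omega) S.card l (by positivity) N hN1 hMP hn2.le (by
    rw [pow_succ']; gcongr) ?_ ?_
  · refine (Nat.le_ceil _).trans ?_
    rw [hN]; exact_mod_cast hd.trans (Nat.le_succ d)
  · have hρ : (70 / (1 / (3 * N))) = 210 * N := by field_simp; norm_num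
    have hθ := (hcount (n + 1) (2 * (1 / (3 * N))) (by positivity) (by
      rw [← mul_div_assoc, div_le_one (by positivity)]; linarith)).1
    rw [← hρ]
    refine high_freq_step hν hS hstar (n + 1) d w hw ho h1 l hT (1 / (3 * N)) _ (by positivity) (by
      rw [div_le_one (by positivity)]; linarith) (by
        rw [← hN]; field_simp; norm_num) ?_
    rw [hPk] at hθ
    refine le_trans ?_ (hθ.trans ?_)
    · refine WW_mono hS _ _ _ fun Q hQ => ?_
      by_cases hq : ‖(uu Q : ℍ[ℝ]) - 1‖ ≤ 2 * (1 / (3 * N))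
      · rw [Set.indicator_of_mem, Set.indicator_of_mem]
        · have hQ' : (nm Q : ℝ) = (P ^ (n + 1)) ^ 2 := by
            rw [hQ]; push_cast; rw [← pow_mul, hPdef]; ring
          show (nm _ : ℝ) ≤ _
          rw [uu_dist (R := P ^ (n + 1)) (by positivity) hQ' (by push_cast; rw [hPk]), mul_comm]
          gcongr
        · exact hq
      · rw [Set.indicator_of_notMem]
        · exact Set.indicator_nonneg (fun _ _ => zero_le_one) _
        · exact hq
    · have hh : 2 * (1 / (3 * N)) ≤ 1 / N := by
        rw [mul_one_div, div_le_div_iff₀ (by positivity) (by positivity)]; linarith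
      gcongr
end OO
end

noncomputable section
open scoped Quaternion
namespace OO
variable {α β : ℕ}

lemma low_of_eig {S : Finset (OO α β)} {ν : ℤ} (hν : ν ≠ 0) (hS : ∀ q ∈ S, nm q = ν)
    (hstar : ∀ q ∈ S, star q ∈ S) (c : ℝ) (d0 : ℕ)
    (H : ∀ d, d0 ≤ d → ∀ (w : C(GG, ℝ)) (l : ℝ), w ∈ VV ^ (d + 1) → (∀ h ∈ VV ^ d, ip w h = 0) → w ≠ 0 →
      TT S w = l • w → |l| ≤ c) (D : ℕ) : ∀ (f : C(GG, ℝ)) (l : ℝ), f ∈ VV ^ D → TT S f = l • f → c < |l| → f ∈ VV ^ d0 := by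
  induction D with
  | zero => intro f l hf _ _; exact VV_mono (Nat.zero_le d0) hf
  | succ d ih =>
    intro f l hf hT hl
    by_cases hd : d + 1 ≤ d0
    · exact VV_mono hd hf
    obtain ⟨g, hg, ho⟩ := proj_exists (VV ^ d) f
    have hg' : g ∈ VV ^ (d + 1) := VV_mono (Nat.le_succ d) hg
    have hw : f - g ∈ VV ^ (d + 1) := Submodule.sub_mem _ hf hg'
    have hTw : TT S (f - g) - l • (f - g) = l • g - TT S g := by
      rw [map_sub, hT]; module
    have hmem : TT S (f - g) - l • (f - g) ∈ VV ^ d := by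
      rw [hTw]; exact Submodule.sub_mem _ (Submodule.smul_mem _ _ hg) (TT_VV S hg)
    have horth : ∀ h ∈ VV ^ d, ip (TT S (f - g) - l • (f - g)) h = 0 := by
      intro h hh
      rw [map_sub, LinearMap.sub_apply, TT_symm hν hS hstar, map_smul, LinearMap.smul_apply, ho _ (TT_VV S hh), ho _ hh]
      simp
    have hz := ip_eq_zero (horth _ hmem)
    by_cases hw0 : f - g = 0
    · rw [sub_eq_zero] at hw0
      rw [← hw0] at hg
      exact ih f l hg hT hl
    · exact absurd (H d (by omega) _ l hw ho hw0 (sub_eq_zero.1 hz)) (not_le.2 hl)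

lemma const_of_poly (f : C(GG, ℝ)) (P : Polynomial ℝ) (hP : P ≠ 0) (h : Polynomial.aeval f P = 0) (x y : GG) : f x = f y := by
  have hroot : ∀ z, f z ∈ (P.roots.toFinset : Set ℝ) := by
    intro z
    have h1 : (Polynomial.aeval f P) z = P.eval (f z) := by
      clear h hP
      induction P using Polynomial.induction_on' with
      | add p q hp hq => simp [hp, hq]
      | monomial n a => simp [Polynomial.aeval_monomial, Polynomial.eval_monomial]
    rw [h] at h1
    simp [hP]
    simpa using h1.symm
  have hconn : IsPreconnected (Set.univ : Set GG) := by
    have := (isConnected_sphere (E := ℍ[ℝ]) (by rw [Quaternion.rank_eq_four]; norm_num) 0 zero_le_one).isPreconnected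
    exact (isPreconnected_iff_preconnectedSpace.1 this).isPreconnected_univ
  have hc2 := hconn.image f f.continuous.continuousOn
  have hs : (f '' Set.univ).Finite := Set.Finite.subset (P.roots.toFinset.finite_toSet) (by
    rintro _ ⟨z, _, rfl⟩; exact hroot z)
  exact hs.countable.isTotallyDisconnected _ subset_rfl hc2 ⟨x, trivial, rfl⟩ ⟨y, trivial, rfl⟩

lemma extremal {S : Finset (OO α β)} {ν : ℤ} (hν : ν ≠ 0) (hS : ∀ q ∈ S, nm q = ν)
    (hstar : ∀ q ∈ S, star q ∈ S) (d0 : ℕ) (hM : 0 < S.card)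
    (H : ∀ D, ∀ (f : C(GG, ℝ)) (l : ℝ), f ∈ VV ^ D → TT S f = l • f → |l| = S.card → f ∈ VV ^ d0)
    (f : C(GG, ℝ)) (l : ℝ) (D : ℕ) (hf : f ∈ VV ^ D) (hi : intC f = 0) (hT : TT S f = l • f) (hl : (S.card : ℝ) ≤ |l|) : f = 0 := by
  set M : ℝ := (S.card : ℝ) with hMdef
  have hM0 : 0 < M := Nat.cast_pos.2 hM
  have hT2 : ∀ h, TT S (TT S h) = ∑ q ∈ S, ∑ r ∈ S, Lg (uu q * uu r) h := by
    intro h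
    rw [TT_apply S (TT S h)]
    refine Finset.sum_congr rfl fun q _ => ?_
    rw [TT_apply, map_sum]
    exact Finset.sum_congr rfl fun r _ => (Lg_mul _ _ _).symm
  have hterm : ∀ g : GG, ip (Lg g f - f) (Lg g f - f) = 2 * ip f f - 2 * ip (Lg g f) f := by
    intro g
    simp only [map_sub, LinearMap.sub_apply]
    rw [ip_Lg, ip_symm f (Lg g f)]; ring
  have hsum : ∑ q ∈ S, ∑ r ∈ S, ip (Lg (uu q * uu r) f - f) (Lg (uu q * uu r) f - f) ≤ 0 := by
    simp only [hterm, Finset.sum_sub_distrib, Finset.sum_const, ← Finset.mul_sum, nsmul_eq_mul]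
    have e : ∑ q ∈ S, ∑ r ∈ S, ip (Lg (uu q * uu r) f) f = l ^ 2 * ip f f := by
      have : ip (TT S (TT S f)) f = l ^ 2 * ip f f := by
        rw [hT, map_smul, hT]; simp; ring
      rw [← this, hT2]
      simp [map_sum, LinearMap.sum_apply]
    rw [e]
    have h2 : M ^ 2 ≤ l ^ 2 := by
      rw [← sq_abs l]; gcongr
    have := ip_nonneg f
    nlinarith
  have hfix : ∀ q ∈ S, ∀ r ∈ S, Lg (uu q * uu r) f = f := by
    intro q hq r hr
    have hnn : ∀ q ∈ S, 0 ≤ ∑ r ∈ S, ip (Lg (uu q * uu r) f - f) (Lg (uu q * uu r) f - f) :=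
      fun q _ => Finset.sum_nonneg fun r _ => ip_nonneg _
    have h0 := le_antisymm hsum (Finset.sum_nonneg hnn)
    have h1 := (Finset.sum_eq_zero_iff_of_nonneg hnn).1 h0 q hq
    have h2 := (Finset.sum_eq_zero_iff_of_nonneg (fun r _ => ip_nonneg _)).1 h1 r hr
    exact sub_eq_zero.1 (ip_eq_zero h2)
  have hT2f : ∀ j : ℕ, TT S (TT S (f ^ j)) = (M * M) • f ^ j := by
    intro j
    rw [hT2]
    have : ∀ q ∈ S, ∑ r ∈ S, Lg (uu q * uu r) (f ^ j) = M • f ^ j := by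
      intro q hq
      rw [Finset.sum_congr rfl fun r hr => by rw [map_pow, hfix q hq r hr], Finset.sum_const, hMdef, Nat.cast_smul_eq_nsmul]
    rw [Finset.sum_congr rfl this, Finset.sum_const, ← Nat.cast_smul_eq_nsmul ℝ, smul_smul]
  have hpow : ∀ j : ℕ, f ^ j ∈ VV ^ d0 := by
    intro j
    have hfj : f ^ j ∈ VV ^ (D * j) := by rw [pow_mul]; exact Submodule.pow_mem_pow _ hf j
    have k1 := H (D * j) (TT S (f ^ j) + M • f ^ j) M (Submodule.add_mem _ (TT_VV S hfj) (Submodule.smul_mem _ _ hfj)) (by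
      rw [map_add, map_smul, hT2f]; module) (abs_of_pos hM0)
    have k2 := H (D * j) (TT S (f ^ j) - M • f ^ j) (-M) (Submodule.sub_mem _ (TT_VV S hfj) (Submodule.smul_mem _ _ hfj)) (by
      rw [map_sub, map_smul, hT2f]; module) (by rw [abs_neg]; exact abs_of_pos hM0)
    have k3 : f ^ j = (1 / (2 * M)) • ((TT S (f ^ j) + M • f ^ j) - (TT S (f ^ j) - M • f ^ j)) := by
      have : (TT S (f ^ j) + M • f ^ j) - (TT S (f ^ j) - M • f ^ j) = (2 * M) • f ^ j := by module
      rw [this, smul_smul, one_div_mul_cancel (by positivity), one_smul]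
    rw [k3]
    exact Submodule.smul_mem _ _ (Submodule.sub_mem _ k1 k2)
  have hmem : ∀ P : Polynomial ℝ, (Polynomial.aeval f).toLinearMap P ∈ VV ^ d0 := by
    intro P
    rw [AlgHom.toLinearMap_apply, Polynomial.aeval_eq_sum_range]
    exact Submodule.sum_mem _ fun i _ => Submodule.smul_mem _ _ (hpow i)
  have hninj : ¬ Function.Injective ((Polynomial.aeval f).toLinearMap.codRestrict (VV ^ d0) hmem) := by
    intro hinj
    exact Polynomial.not_finite (R := ℝ) (Module.Finite.of_injective _ hinj)
  rw [← LinearMap.ker_eq_bot, LinearMap.ker_eq_bot'] at hninj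
  push Not at hninj
  obtain ⟨P, hP, hP0⟩ := hninj
  have hPf : Polynomial.aeval f P = 0 := congrArg Subtype.val hP
  have hconst := const_of_poly f P hP0 hPf
  have hf1 : f = f 1 • (1 : C(GG, ℝ)) := by
    ext x; simp [hconst x 1]
  have : intC f = f 1 := by
    rw [hf1, map_smul, intC_apply]; simp
  rw [hf1, ← this, hi, zero_smul]

lemma finite_sup (s : Finset ℝ) (M c0 : ℝ) (h0 : c0 < M) (hs : ∀ l ∈ s, |l| < M) :
    ∃ c, c0 ≤ c ∧ c < M ∧ ∀ l ∈ s, |l| ≤ c := by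
  induction s using Finset.induction_on with
  | empty => exact ⟨c0, le_rfl, h0, by simp⟩
  | insert a s _ ih =>
    obtain ⟨c, h1, h2, h3⟩ := ih fun l hl => hs l (Finset.mem_insert_of_mem hl)
    refine ⟨max c |a|, h1.trans (le_max_left _ _), max_lt h2 (hs a (Finset.mem_insert_self _ _)), fun l hl => ?_⟩
    rcases Finset.mem_insert.1 hl with rfl | hl
    · exact le_max_right _ _
    · exact (h3 l hl).trans (le_max_left _ _)

/-- trigonometric-type functions of degree `≤ D` with mean zero -/
def VZ (D : ℕ) : Submodule ℝ C(GG, ℝ) := VV ^ D ⊓ LinearMap.ker intC.toLinearMap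

lemma mem_VZ {D : ℕ} {f : C(GG, ℝ)} : f ∈ VZ D ↔ f ∈ VV ^ D ∧ intC f = 0 := by
  simp [VZ]

instance instVZ (D : ℕ) : FiniteDimensional ℝ (VZ D) :=
  Submodule.finiteDimensional_of_le (inf_le_left : VZ D ≤ VV ^ D)

lemma VZ_TT (S : Finset (OO α β)) (D : ℕ) : ∀ f ∈ VZ D, TT S f ∈ VZ D := by
  intro f hf
  rw [mem_VZ] at hf ⊢
  exact ⟨TT_VV S hf.1, by rw [intC_TT, hf.2, mul_zero]⟩

lemma gap_poly {S : Finset (OO α β)} {ν : ℤ} (hν : ν ≠ 0) (hS : ∀ q ∈ S, nm q = ν)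
    (hstar : ∀ q ∈ S, star q ∈ S) (hM : 0 < S.card) (θ0 : ℝ) (h1 : θ0 < 1) (d0 : ℕ)
    (H : ∀ d, d0 ≤ d → ∀ (w : C(GG, ℝ)) (l : ℝ), w ∈ VV ^ (d + 1) → (∀ h ∈ VV ^ d, ip w h = 0) → w ≠ 0 →
      TT S w = l • w → |l| ≤ θ0 * S.card) :
    ∃ θ : ℝ, 0 < θ ∧ θ < 1 ∧ ∀ D, ∀ f ∈ VV ^ D, intC f = 0 → ip (TT S f) (TT S f) ≤ (θ * S.card) ^ 2 * ip f f := by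
  set M : ℝ := (S.card : ℝ) with hMdef
  have hM0 : 0 < M := Nat.cast_pos.2 hM
  have hlow := low_of_eig hν hS hstar _ d0 H
  have hext := extremal hν hS hstar d0 hM fun D f l hf hT hl => hlow D f l hf hT (by rw [hl]; nlinarith)
  let T0 : Module.End ℝ (VZ d0) := (TT S).restrict (VZ_TT S d0)
  have hfin : {l | T0.HasEigenvalue l}.Finite := Module.End.finite_hasEigenvalue T0
  obtain ⟨c, hc0, hcM, hc⟩ := finite_sup hfin.toFinset M (max θ0 (1/2) * M) (by
    have : max θ0 (1/2) < 1 := max_lt h1 (by norm_num)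
    nlinarith) (by
    intro l hl
    have hl' : T0.HasEigenvalue l := by simpa using hl
    obtain ⟨v, hv⟩ := hl'.exists_hasEigenvector
    by_contra! hlt
    have hv2 := (mem_VZ.1 v.2)
    have hTv : TT S v = l • (v : C(GG, ℝ)) := congrArg Subtype.val hv.apply_eq_smul
    exact hv.2 (Subtype.ext (hext v l d0 hv2.1 hv2.2 hTv hlt)))
  have hcpos : 0 < c := lt_of_lt_of_le (by positivity) hc0
  refine ⟨c / M, by positivity, by rwa [div_lt_one hM0], fun D f hf hi => ?_⟩
  rw [div_mul_cancel₀ _ hM0.ne']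
  let T1 : Module.End ℝ (VZ D) := (TT S).restrict (VZ_TT S D)
  let B : LinearMap.BilinForm ℝ (VZ D) := ip.compl₁₂ (VZ D).subtype (VZ D).subtype
  refine eig_bound B (fun f h => ip_symm _ _) (fun f hf => ip_pos fun h => hf (Subtype.ext h)) T1
    (fun f h => TT_symm hν hS hstar _ _) c ?_ ⟨f, mem_VZ.2 ⟨hf, hi⟩⟩
  intro l v hv hT
  have hTv : TT S v = l • (v : C(GG, ℝ)) := congrArg Subtype.val hT
  have hv2 := mem_VZ.1 v.2
  by_cases hl : |l| ≤ θ0 * M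
  · exact hl.trans (le_trans (by gcongr; exact le_max_left _ _) hc0)
  · push Not at hl
    have hv3 := hlow D v l hv2.1 hTv hl
    refine hc l ?_
    rw [Set.Finite.mem_toFinset]
    refine Module.End.hasEigenvalue_of_hasEigenvector (x := (⟨v, mem_VZ.2 ⟨hv3, hv2.2⟩⟩ : VZ d0)) ?_
    rw [Module.End.hasEigenvector_iff]
    refine ⟨Module.End.mem_eigenspace_iff.2 (Subtype.ext hTv), fun h => hv (Subtype.ext (show (v : C(GG, ℝ)) = 0 from congrArg (fun z : VZ d0 => (z : C(GG, ℝ))) h))⟩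

end OO
end

noncomputable section
open scoped Quaternion

lemma Lg_cont (g : GG) : Continuous (Lg g) := ContinuousMap.continuous_precomp _

/-- closure of the polynomial functions on the 2-sphere -/
def CL : Submodule ℝ C(GG, ℝ) := (⨆ D : ℕ, (VV ^ D : Submodule ℝ C(GG, ℝ))).topologicalClosure

lemma mem_VVsup {f : C(GG, ℝ)} : f ∈ (⨆ D : ℕ, (VV ^ D : Submodule ℝ C(GG, ℝ))) ↔ ∃ D : ℕ, f ∈ VV ^ D :=
  Submodule.mem_iSup_of_directed _ VV_mono.directed_le

lemma VV_CL {f : C(GG, ℝ)} {D : ℕ} (h : f ∈ VV ^ D) : f ∈ CL :=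
  Submodule.le_topologicalClosure _ (mem_VVsup.2 ⟨D, h⟩)

lemma CL_closed : IsClosed (CL : Set C(GG, ℝ)) := Submodule.isClosed_topologicalClosure _

lemma CL_ind (P : C(GG, ℝ) → Prop) (hc : IsClosed {f | P f}) (h : ∀ (D : ℕ), ∀ f ∈ VV ^ D, P f) :
    ∀ f ∈ CL, P f := by
  intro f hf
  have : closure ((⨆ D : ℕ, (VV ^ D : Submodule ℝ C(GG, ℝ)) : Submodule ℝ C(GG, ℝ)) : Set C(GG, ℝ)) ⊆ {f | P f} :=
    closure_minimal (fun f hf => by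
      obtain ⟨D, hD⟩ := mem_VVsup.1 hf
      exact h D f hD) hc
  exact this hf

lemma CL_Lg (g : GG) : ∀ f ∈ CL, Lg g f ∈ CL :=
  CL_ind _ (CL_closed.preimage (Lg_cont g)) fun D _ hf => VV_CL (VVpow_Lg g D hf)

lemma one_CL : (1 : C(GG, ℝ)) ∈ CL := VV_CL (D := 0) (by simp)

lemma ip_intC (f h : C(GG, ℝ)) : ip f h = intC (f * h) := by
  rw [ip_apply, intC_apply]; rfl

lemma ip_cont {F H : C(GG, ℝ) → C(GG, ℝ)} (hF : Continuous F) (hH : Continuous H) :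
    Continuous fun f => ip (F f) (H f) := by
  simp only [ip_intC]; exact intC.continuous.comp (hF.mul hH)

lemma c1_Icc (g : GG) : c1 g ∈ Set.Icc (-1 : ℝ) 1 := by
  have := cc_sq g
  constructor <;> nlinarith [sq_nonneg (c2 g), sq_nonneg (c3 g)]

lemma CL_comp_c1 (φ : ℝ → ℝ) (hφ : Continuous φ) (f : C(GG, ℝ)) (hf : ∀ g, f g = φ (c1 g)) : f ∈ CL := by
  have : f ∈ closure (CL : Set C(GG, ℝ)) := by
    rw [Metric.mem_closure_iff]
    intro ε hε
    obtain ⟨P, hP⟩ := exists_polynomial_near_of_continuousOn (-1) 1 φ hφ.continuousOn ε hε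
    refine ⟨pc P, VV_CL (pc_mem Polynomial.degree_le_natDegree), ?_⟩
    rw [ContinuousMap.dist_lt_iff hε]
    intro g
    rw [hf, pc_apply, dist_comm, Real.dist_eq]
    exact hP _ (c1_Icc g)
  rwa [CL_closed.closure_eq] at this

lemma norm_pole_sub_one (g : GG) : ‖pole g - pole 1‖ = √(2 - 2 * c1 g) := by
  have h1 : ‖pole g - pole 1‖ ^ 2 = 2 - 2 * c1 g := by
    rw [sq, ← Quaternion.normSq_eq_norm_mul_self, Quaternion.normSq_def']
    have h := cc_sq g
    have e1 : c1 (1 : GG) = 1 := by simp [c1]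
    have e2 : c2 (1 : GG) = 0 := by simp [c2]
    have e3 : c3 (1 : GG) = 0 := by simp [c3]
    simp only [pole, Quaternion.re_sub, Quaternion.imI_sub, Quaternion.imJ_sub, Quaternion.imK_sub, qmk_re, qmk_imI, qmk_imJ, qmk_imK, e1, e2, e3]
    linear_combination h
  rw [← h1, Real.sqrt_sq (norm_nonneg _)]

lemma pole_cont : Continuous pole := by
  have : pole = fun g : GG => (g : ℍ[ℝ]) * (qmk 0 1 0 0) * star (g : ℍ[ℝ]) := funext pole_eq
  rw [this]; fun_prop

/-- the bump function around `pole g0` -/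
def bmp (g0 : GG) (ε : ℝ) : C(GG, ℝ) := ⟨fun g => max 0 (1 - ‖pole g - pole g0‖ / ε), by
  have := pole_cont; fun_prop⟩

lemma bmp_apply (g0 : GG) (ε : ℝ) (g : GG) : bmp g0 ε g = max 0 (1 - ‖pole g - pole g0‖ / ε) := rfl

lemma bmp_eq (g0 : GG) (ε : ℝ) : bmp g0 ε = Lg g0 (bmp 1 ε) := by
  ext g; rw [Lg_apply, bmp_apply, bmp_apply, norm_pole_inv_mul]

lemma bmp_CL (g0 : GG) (ε : ℝ) : bmp g0 ε ∈ CL := by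
  rw [bmp_eq]
  refine CL_Lg _ _ (CL_comp_c1 (fun t => max 0 (1 - √(2 - 2 * t) / ε)) (by fun_prop) _ fun g => ?_)
  rw [bmp_apply, norm_pole_sub_one]

lemma bmp_nonneg (g0 : GG) (ε : ℝ) (g : GG) : 0 ≤ bmp g0 ε g := le_max_left _ _
lemma bmp_le_one (g0 : GG) {ε : ℝ} (h : 0 < ε) (g : GG) : bmp g0 ε g ≤ 1 := max_le zero_le_one (by
    have : 0 ≤ ‖pole g - pole g0‖ / ε := by positivity
    linarith)
lemma bmp_supp {g0 : GG} {ε : ℝ} (h : 0 < ε) {g : GG} (hg : bmp g0 ε g ≠ 0) : ‖pole g - pole g0‖ < ε := by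
  by_contra! hlt
  apply hg
  rw [bmp_apply, max_eq_left]
  rw [sub_nonpos, le_div_iff₀ h]; linarith

lemma bmp_int (g0 : GG) {ε : ℝ} (h : 0 < ε) (h1 : ε ≤ 1) : ε ^ 2 / 30000 ≤ intC (bmp g0 ε) := by
  rw [bmp_eq, intC_Lg, intC_apply]
  have a1 := cap_measure (ε / 2) (by positivity) (by linarith)
  have a2 := bump_int (fun g => ‖pole g - pole 1‖) (by have := pole_cont; fun_prop) ε h
  have a3 : ∫ g, max 0 (1 - ‖pole g - pole 1‖ / ε) ∂mu = ∫ g, bmp 1 ε g ∂mu := rfl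
  rw [a3] at a2
  refine le_trans ?_ a2
  have a4 : 6 * (25 / (ε / 2)) ^ 2 = 15000 / ε ^ 2 := by field_simp; norm_num
  rw [a4, div_mul_eq_mul_div, le_div_iff₀ (by positivity)] at a1
  linarith

lemma pole_surj (u v w : ℝ) (h : u ^ 2 + v ^ 2 + w ^ 2 = 1) : ∃ g : GG, pole g = qmk 0 u v w := by
  have hb1 : -1 ≤ u := by nlinarith [sq_nonneg v, sq_nonneg w]
  have hb2 : u ≤ 1 := by nlinarith [sq_nonneg v, sq_nonneg w]
  set θ := Real.arccos u with hθ
  have hc : Real.cos θ = u := Real.cos_arccos hb1 hb2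
  have hs0 : 0 ≤ Real.sin θ := Real.sin_nonneg_of_nonneg_of_le_pi (Real.arccos_nonneg _) (Real.arccos_le_pi _)
  have hcs := Real.cos_sq_add_sin_sq θ
  obtain ⟨φ, h1, h2⟩ := exists_angle v w (Real.sin θ) hs0 (by rw [hc] at hcs; linarith)
  refine ⟨hh (φ / 2) * gs nk hnk (θ / 2), ?_⟩
  have e1 : Real.cos θ = Real.cos (θ/2) ^ 2 - Real.sin (θ/2) ^ 2 := by
    rw [← Real.cos_two_mul', mul_div_cancel₀ _ two_ne_zero]
  have e2 : Real.sin θ = 2 * Real.sin (θ/2) * Real.cos (θ/2) := by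
    rw [← Real.sin_two_mul, mul_div_cancel₀ _ two_ne_zero]
  have e3 : Real.cos φ = Real.cos (φ/2) ^ 2 - Real.sin (φ/2) ^ 2 := by
    rw [← Real.cos_two_mul', mul_div_cancel₀ _ two_ne_zero]
  have e4 : Real.sin φ = 2 * Real.sin (φ/2) * Real.cos (φ/2) := by
    rw [← Real.sin_two_mul, mul_div_cancel₀ _ two_ne_zero]
  have e6 := Real.cos_sq_add_sin_sq (φ/2)
  rw [h1, h2, ← hc, e1, e2, e3, e4, pole_mul]
  ext <;> simp [pole, c1, c2, c3, hh, gs, mkG, nk]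
  all_goals first
    | ring1
    | linear_combination (Real.cos (θ / 2) ^ 2 - Real.sin (θ / 2) ^ 2) * e6

namespace OO
variable {α β : ℕ}
lemma TT_cont (S : Finset (OO α β)) : Continuous (TT S) := by
  have : (TT S : C(GG, ℝ) → C(GG, ℝ)) = fun f => ∑ q ∈ S, Lg (uu q) f := funext (TT_apply S)
  rw [this]
  exact continuous_finsetSum _ fun q _ => Lg_cont _

lemma CL_TT (S : Finset (OO α β)) : ∀ f ∈ CL, TT S f ∈ CL := by
  intro f hf
  rw [TT_apply]; exact Submodule.sum_mem _ fun q _ => CL_Lg _ _ hf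

lemma CL_TT_pow (S : Finset (OO α β)) (k : ℕ) : ∀ f ∈ CL, (TT S ^ k) f ∈ CL := by
  induction k with
  | zero => intro f hf; simpa
  | succ k ih => intro f hf; rw [pow_succ', Module.End.mul_apply]; exact CL_TT S _ (ih f hf)

lemma intC_TT_pow (S : Finset (OO α β)) (k : ℕ) (f : C(GG, ℝ)) : intC ((TT S ^ k) f) = S.card ^ k * intC f := by
  induction k with
  | zero => simp
  | succ k ih => rw [pow_succ', Module.End.mul_apply, intC_TT, ih]; ring

lemma intC_one : intC 1 = 1 := by rw [intC_apply]; simp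

lemma gap_CL {S : Finset (OO α β)} (c : ℝ)
    (H : ∀ D, ∀ f ∈ VV ^ D, intC f = 0 → ip (TT S f) (TT S f) ≤ c ^ 2 * ip f f) :
    ∀ f ∈ CL, intC f = 0 → ip (TT S f) (TT S f) ≤ c ^ 2 * ip f f := by
  have key : ∀ f ∈ CL, ip (TT S (f - intC f • 1)) (TT S (f - intC f • 1)) ≤ c ^ 2 * ip (f - intC f • 1) (f - intC f • 1) := by
    have hc : Continuous fun f : C(GG, ℝ) => f - intC f • (1 : C(GG, ℝ)) :=
      continuous_id.sub (intC.continuous.smul continuous_const)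
    have hT : Continuous fun f : C(GG, ℝ) => TT S (f - intC f • (1 : C(GG, ℝ))) := (TT_cont S).comp hc
    refine CL_ind _ (isClosed_le (ip_cont hT hT) (continuous_const.mul (ip_cont hc hc))) fun D f hf => ?_
    refine H D _ (Submodule.sub_mem _ hf (Submodule.smul_mem _ _ (VV_mono (Nat.zero_le D) (by simp)))) ?_
    rw [map_sub, map_smul, intC_one]; simp
  intro f hf h0
  have := key f hf
  rwa [h0, zero_smul, sub_zero] at this

lemma gap_pow {S : Finset (OO α β)} (c : ℝ)
    (H : ∀ f ∈ CL, intC f = 0 → ip (TT S f) (TT S f) ≤ c ^ 2 * ip f f) (l : ℕ) (f : C(GG, ℝ)) (hf : f ∈ CL) (h0 : intC f = 0) :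
    ip ((TT S ^ l) f) ((TT S ^ l) f) ≤ (c ^ 2) ^ l * ip f f := by
  induction l with
  | zero => simp
  | succ l ih =>
    rw [pow_succ' (TT S), Module.End.mul_apply]
    refine (H _ (CL_TT_pow S l f hf) (by rw [intC_TT_pow, h0, mul_zero])).trans ?_
    rw [pow_succ' (c ^ 2), mul_assoc]
    exact mul_le_mul_of_nonneg_left ih (sq_nonneg c)

/-- from non-vanishing of `T^k f` at `g` to a quaternion -/
lemma TT_pow_ne {S : Finset (OO α β)} {ν : ℤ} (hν : ν ≠ 0) (hS : ∀ q ∈ S, nm q = ν) (k : ℕ)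
    (f : C(GG, ℝ)) (g : GG) (h : (TT S ^ k) f g ≠ 0) : ∃ Q : OO α β, nm Q = ν ^ k ∧ f ((uu Q)⁻¹ * g) ≠ 0 := by
  by_contra! hn
  apply h
  have h1 := TT_pow_WW hν hS k f (evl g)
  have h2 : evl g ((TT S ^ k) f) = (TT S ^ k) f g := rfl
  rw [← h2, h1]
  exact (WW_congr hS k _ (fun _ => 0) (fun Q hQ => hn Q hQ)).trans (WW_zero S k)

end OO
end

noncomputable section
open scoped Quaternion
namespace OO
variable {α β : ℕ}

lemma uu_comm {Q U : OO α β} {g0 : GG} (hU : em U = ‖em U‖ • pole g0) (hQ : nm Q ≠ 0) (ε : ℝ)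
    (h : ‖(uu Q : ℍ[ℝ]) * pole g0 * star (uu Q : ℍ[ℝ]) - pole g0‖ ≤ 2 * ε) :
    (nm (Q * U - U * Q) : ℝ) ≤ (2 * ε) ^ 2 * nm Q * nm U := by
  have huu : star (uu Q : ℍ[ℝ]) * (uu Q : ℍ[ℝ]) = 1 := by
    rw [← coe_inv_GG, ← coe_mul_GG, inv_mul_cancel]; rfl
  have h1 : (uu Q : ℍ[ℝ]) * pole g0 - pole g0 * uu Q = ((uu Q : ℍ[ℝ]) * pole g0 * star (uu Q : ℍ[ℝ]) - pole g0) * uu Q := by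
    rw [sub_mul, mul_assoc _ (star (uu Q : ℍ[ℝ])), huu, mul_one]
  have h2 : em (Q * U - U * Q) = (‖em Q‖ * ‖em U‖) • ((uu Q : ℍ[ℝ]) * pole g0 - pole g0 * uu Q) := by
    rw [em_sub, em_mul, em_mul]
    conv_lhs => rw [em_eq hQ, hU]
    rw [smul_mul_smul_comm, smul_mul_smul_comm, smul_sub, mul_comm ‖em U‖ ‖em Q‖]
  have h3 : ‖em (Q * U - U * Q)‖ ≤ ‖em Q‖ * ‖em U‖ * (2 * ε) := by
    have : ‖(uu Q : ℍ[ℝ])‖ = 1 := by simp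
    rw [h2, norm_smul, h1, norm_mul _ (uu Q : ℍ[ℝ]), this, mul_one, Real.norm_of_nonneg (by positivity)]
    gcongr
  rw [← em_norm, ← em_norm, ← em_norm]
  calc ‖em (Q * U - U * Q)‖ ^ 2 ≤ (‖em Q‖ * ‖em U‖ * (2 * ε)) ^ 2 := by gcongr
    _ = _ := by ring

lemma uu_conj_dist (Q : OO α β) (g g0 : GG) :
    ‖pole ((uu Q)⁻¹ * g) - pole g0‖ = ‖pole g - (uu Q : ℍ[ℝ]) * pole g0 * star (uu Q : ℍ[ℝ])‖ := by
  have h1 : pole g = (uu Q : ℍ[ℝ]) * pole ((uu Q)⁻¹ * g) * star (uu Q : ℍ[ℝ]) := by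
    rw [← pole_mul, mul_inv_cancel_left]
  conv_rhs => rw [h1]
  rw [pole_conj]

/-- Chebyshev -/
lemma cheb (f : C(GG, ℝ)) (a : ℝ) (Z : Set GG) (hZ : MeasurableSet Z) (h : ∀ g ∈ Z, f g = a) : a ^ 2 * mu.real Z ≤ ip f f := by
  have : a ^ 2 * mu.real Z = ∫ g, Z.indicator (fun _ => a ^ 2) g ∂mu := by
    rw [integral_indicator hZ]; simp; ring
  rw [this, ip_apply]
  refine integral_mono ((integrable_const _).indicator hZ) (intg (by fun_prop)) fun g => ?_
  by_cases hg : g ∈ Z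
  · rw [Set.indicator_of_mem hg, ← h g hg]; simp [sq]
  · rw [Set.indicator_of_notMem hg]; exact mul_self_nonneg _

lemma L2_step {S1 S2 : Finset (OO α β)} {ν1 ν2 : ℤ} (hν1 : ν1 ≠ 0) (hS1 : ∀ q ∈ S1, nm q = ν1)
    (hν2 : ν2 ≠ 0) (hS2 : ∀ q ∈ S2, nm q = ν2) (hstar2 : ∀ q ∈ S2, star q ∈ S2) (hM1 : 0 < S1.card) (hM2 : 0 < S2.card)
    (θ : ℝ) (hgap : ∀ f ∈ CL, intC f = 0 → ip (TT S1 f) (TT S1 f) ≤ (θ * S1.card) ^ 2 * ip f f)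
    (U : OO α β) (g0 : GG) (hU : em U = ‖em U‖ • pole g0) (ε : ℝ) (h0 : 0 < ε) (h1 : ε ≤ 1) (k l : ℕ) (W : ℝ)
    (hW : WW S2 (2 * k) ({Q : OO α β | (nm (Q * U - U * Q) : ℝ) ≤ (2 * ε) ^ 2 * (ν2 : ℝ) ^ (2 * k) * nm U}.indicator fun _ => 1) ≤ W) :
    ∃ Z : Set GG, MeasurableSet Z ∧ mu.real Z ≤ θ ^ (2 * l) * W / ((S2.card : ℝ) ^ (2 * k) * (ε ^ 2 / 30000)) ∧
      ∀ g ∉ Z, ∃ Q : OO α β, nm Q = ν1 ^ l * ν2 ^ k ∧ ‖pole g - (uu Q : ℍ[ℝ]) * pole g0 * star (uu Q : ℍ[ℝ])‖ < ε := by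
  set b := bmp g0 ε with hb
  set c0 := intC b with hc0
  have hc : ε ^ 2 / 30000 ≤ c0 := bmp_int g0 h0 h1
  have hcpos : 0 < c0 := lt_of_lt_of_le (by positivity) hc
  have hM10 : (0:ℝ) < S1.card := Nat.cast_pos.2 hM1
  have hM20 : (0:ℝ) < S2.card := Nat.cast_pos.2 hM2
  have hnorm : ip ((TT S2 ^ k) b) ((TT S2 ^ k) b) ≤ c0 * W := by
    refine (TT_norm hν2 hS2 hstar2 k b (bmp_nonneg _ _) (bmp_le_one g0 h0) _ ?_).trans (mul_le_mul_of_nonneg_left hW hcpos.le)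
    intro Q x hQ hx hx'
    have b1 := bmp_supp h0 hx
    have b2 := bmp_supp h0 hx'
    have hQ0 : nm Q ≠ 0 := by rw [hQ]; exact pow_ne_zero _ hν2
    rw [uu_conj_dist] at b2
    have := uu_comm hU hQ0 ε (by
      calc _ = ‖(pole x - pole g0) - (pole x - (uu Q : ℍ[ℝ]) * pole g0 * star (uu Q : ℍ[ℝ]))‖ := by congr 1; abel
        _ ≤ _ := (norm_sub_le _ _).trans (by linarith))
    rw [hQ] at this
    push_cast at this
    exact this
  set f := (TT S2 ^ k) b with hf
  set a : ℝ := (S2.card : ℝ) ^ k * c0 with ha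
  have hfi : intC f = a := intC_TT_pow S2 k b
  have hfC : f - a • (1 : C(GG, ℝ)) ∈ CL := CL.sub_mem (CL_TT_pow S2 k b (bmp_CL g0 ε)) (CL.smul_mem _ one_CL)
  have hIntg : intC (f - a • (1 : C(GG, ℝ))) = 0 := by rw [map_sub, map_smul, hfi, intC_one]; simp
  have hii : ip (f - a • (1 : C(GG, ℝ))) (f - a • (1 : C(GG, ℝ))) ≤ c0 * W := by
    refine le_trans ?_ hnorm
    have e1 : ip 1 f = a := by rw [ip_one, ← intC_apply, hfi]
    have e2 : ip f 1 = a := by rw [ip_symm, e1]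
    have e3 : ip (1 : C(GG, ℝ)) 1 = 1 := ip_one_one
    simp only [map_sub, map_smul, LinearMap.sub_apply, LinearMap.smul_apply, smul_eq_mul, e1, e2, e3]
    nlinarith [sq_nonneg a]
  have hgp := gap_pow _ hgap l _ hfC hIntg
  have hT1 : (TT S1 ^ l) (1 : C(GG, ℝ)) = ((S1.card : ℝ) ^ l) • 1 := TT_pow_eig _ _ (TT_one S1) l
  rw [map_sub, map_smul, hT1, smul_smul] at hgp
  let Z : Set GG := {g | (TT S1 ^ l) f g = 0}
  have hZ : MeasurableSet Z := (isClosed_eq ((TT S1 ^ l) f).continuous continuous_const).measurableSet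
  refine ⟨Z, hZ, ?_, ?_⟩
  · have hch := cheb _ (-(a * (S1.card : ℝ) ^ l)) Z hZ (fun g hg => by
      have hg' : (TT S1 ^ l) f g = 0 := hg
      show ((TT S1 ^ l) f) g - _ = _
      rw [hg']; simp) |>.trans hgp
    have h5 : a ^ 2 * (S1.card : ℝ) ^ (2 * l) * mu.real Z ≤ (S1.card : ℝ) ^ (2 * l) * (θ ^ (2 * l) * (c0 * W)) := by
      calc _ = (-(a * (S1.card : ℝ) ^ l)) ^ 2 * mu.real Z := by ring
        _ ≤ _ := hch
        _ ≤ ((θ * S1.card) ^ 2) ^ l * (c0 * W) := by gcongr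
        _ = _ := by rw [← pow_mul, mul_pow]; ring
    have h6 : a ^ 2 * mu.real Z ≤ θ ^ (2 * l) * (c0 * W) := by
      refine le_of_mul_le_mul_left ?_ (show (0:ℝ) < (S1.card : ℝ) ^ (2 * l) by positivity)
      linarith
    have h7 : (S2.card : ℝ) ^ (2 * k) * c0 * mu.real Z ≤ θ ^ (2 * l) * W := by
      refine le_of_mul_le_mul_left ?_ hcpos
      calc c0 * ((S2.card : ℝ) ^ (2 * k) * c0 * mu.real Z) = a ^ 2 * mu.real Z := by rw [ha]; ring
        _ ≤ _ := h6
        _ = _ := by ring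
    rw [le_div_iff₀ (by positivity)]
    refine le_trans ?_ h7
    rw [mul_comm]
    gcongr
  · intro g hg
    obtain ⟨Q1, hQ1, hn1⟩ := TT_pow_ne hν1 hS1 l f g hg
    obtain ⟨Q2, hQ2, hn2⟩ := TT_pow_ne hν2 hS2 k b _ hn1
    have z1 : nm Q1 ≠ 0 := by rw [hQ1]; exact pow_ne_zero _ hν1
    have z2 : nm Q2 ≠ 0 := by rw [hQ2]; exact pow_ne_zero _ hν2
    refine ⟨Q1 * Q2, by rw [nm_mul, hQ1, hQ2], ?_⟩
    have := bmp_supp h0 hn2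
    rw [← mul_assoc, ← mul_inv_rev, ← uu_mul z1 z2, uu_conj_dist] at this
    exact this

lemma real_final (P1 P2 θ t δ C σ : ℝ) (hP1 : 1 < P1) (hP2 : 1 < P2) (hθ0 : 0 < θ)
    (ht0 : 0 < t) (hδ : 0 < δ) (hC : 1 ≤ C) (hθt : θ = P1 ^ (-t)) (hδσ : δ = t * σ / 6)
    (M2 : ℝ) (hM2 : P2 ^ (1 - δ) ≤ M2) (ε : ℝ) (h0 : 0 < ε) (k l : ℕ)
    (hk1 : ε ^ (-2 : ℝ) ≤ P2 ^ k) (hk2 : P2 ^ k ≤ P2 * ε ^ (-2 : ℝ)) (hl2 : ε ^ (-σ) ≤ P1 ^ (l + 1)) :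
    θ ^ (2 * l) * (C * (P2 ^ k) ^ (1 + δ) * (1 + (2 * ε) ^ 2 * P2 ^ k)) / (M2 ^ (2 * k) * (ε ^ 2 / 30000)) ≤
      (150000 * C * P2 ^ (3 * δ) * θ ^ (-2 : ℝ)) * ε ^ (t * σ) := by
  set R := P2 ^ k with hR
  have hP20 : 0 < P2 := by linarith
  have hR0 : 0 < R := by positivity
  have e0 : ε ^ (-2 : ℝ) = (ε ^ 2)⁻¹ := by rw [Real.rpow_neg h0.le]; norm_num
  have s1 : θ ^ (2 * l) ≤ θ ^ (-2 : ℝ) * ε ^ (2 * (t * σ)) := by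
    have : θ ^ (2 * l) = θ ^ (-2 : ℝ) * (P1 ^ (l + 1)) ^ (-(2 * t)) := by
      have e : (P1 ^ (l + 1)) ^ (-(2 * t)) = θ ^ (((2 * l + 2 : ℕ) : ℝ)) := by
        rw [hθt, ← Real.rpow_natCast, ← Real.rpow_mul (by linarith), ← Real.rpow_mul (by linarith)]
        congr 1; push_cast; ring
      rw [e, ← Real.rpow_add hθ0, ← Real.rpow_natCast]
      congr 1; push_cast; ring
    rw [this]
    gcongr
    calc (P1 ^ (l + 1)) ^ (-(2 * t)) ≤ (ε ^ (-σ)) ^ (-(2 * t)) :=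
          Real.rpow_le_rpow_of_nonpos (by positivity) hl2 (by linarith)
      _ = _ := by rw [← Real.rpow_mul h0.le]; congr 1; ring
  have s2 : R ^ (2 - 2 * δ) ≤ M2 ^ (2 * k) := by
    calc R ^ (2 - 2 * δ) = (P2 ^ (1 - δ)) ^ (2 * k) := by
          rw [hR, ← Real.rpow_natCast, ← Real.rpow_natCast, ← Real.rpow_mul hP20.le, ← Real.rpow_mul hP20.le]
          congr 1; push_cast; ring
      _ ≤ _ := by gcongr
  have s3 : (1 + (2 * ε) ^ 2 * R) ≤ 5 * R * ε ^ 2 := by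
    rw [e0, inv_le_iff_one_le_mul₀ (by positivity)] at hk1
    nlinarith
  have s4 : R ^ (3 * δ) ≤ P2 ^ (3 * δ) * ε ^ (-(t * σ)) := by
    calc R ^ (3 * δ) ≤ (P2 * ε ^ (-2 : ℝ)) ^ (3 * δ) := by gcongr
      _ = _ := by
        rw [Real.mul_rpow hP20.le (by positivity), ← Real.rpow_mul h0.le, hδσ]
        congr 2; ring
  have s5 : R ^ (1 + δ) * R / R ^ (2 - 2 * δ) = R ^ (3 * δ) := by
    rw [div_eq_iff (by positivity), ← Real.rpow_add hR0]
    nth_rewrite 2 [← Real.rpow_one R]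
    rw [← Real.rpow_add hR0]; congr 1; ring
  calc θ ^ (2 * l) * (C * R ^ (1 + δ) * (1 + (2 * ε) ^ 2 * R)) / (M2 ^ (2 * k) * (ε ^ 2 / 30000))
      ≤ (θ ^ (-2 : ℝ) * ε ^ (2 * (t * σ))) * (C * R ^ (1 + δ) * (5 * R * ε ^ 2)) / (R ^ (2 - 2 * δ) * (ε ^ 2 / 30000)) := by gcongr
    _ = 150000 * C * θ ^ (-2 : ℝ) * ε ^ (2 * (t * σ)) * (R ^ (1 + δ) * R / R ^ (2 - 2 * δ)) := by field_simp; ring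
    _ ≤ 150000 * C * θ ^ (-2 : ℝ) * ε ^ (2 * (t * σ)) * (P2 ^ (3 * δ) * ε ^ (-(t * σ))) := by rw [s5]; gcongr
    _ = (150000 * C * P2 ^ (3 * δ) * θ ^ (-2 : ℝ)) * (ε ^ (2 * (t * σ)) * ε ^ (-(t * σ))) := by ring
    _ = _ := by rw [← Real.rpow_add h0]; congr 2; ring

theorem final_est (hα : 0 < α) (hβ : 0 < β) {p : ℕ} [hp : Fact p.Prime] (x y : ℚ_[p]) (h : x^2+α*y^2 = -(β:ℚ_[p]))
    (U : OO α β) (hU : U.re = 0) (hU0 : U ≠ 0) (g0 : GG) (hg0 : em U = ‖em U‖ • pole g0) (σ : ℝ) (hσ : 0 < σ) :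
    ∃ C η : ℝ, 0 < C ∧ 0 < η ∧ ∀ ε : ℝ, 0 < ε → ε ≤ 1/2 → ∃ Z : Set GG, MeasurableSet Z ∧ mu.real Z ≤ C * ε ^ η ∧
      ∀ g ∉ Z, ∃ (Q : OO α β) (n : ℕ), nm Q = (p:ℤ) ^ n ∧ (p:ℝ) ^ n ≤ C * ε ^ (-(2 + σ)) ∧
        ‖pole g - (uu Q : ℍ[ℝ]) * pole g0 * star (uu Q : ℍ[ℝ])‖ < ε := by
  have hp1 : (1:ℝ) < p := by exact_mod_cast hp.out.one_lt
  have hp0 : (p:ℤ) ≠ 0 := by exact_mod_cast hp.out.ne_zero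
  have hSS : ∀ m, ∀ q ∈ (finite_eq hα hβ ((p:ℤ)^m)).toFinset, nm q = (p:ℤ)^m := fun m q hq => by simpa using hq
  have hst : ∀ m, ∀ q ∈ (finite_eq hα hβ ((p:ℤ)^m)).toFinset, star q ∈ (finite_eq hα hβ ((p:ℤ)^m)).toFinset := fun m q hq => by
    have := hSS m q hq
    simp [nm_star, this]
  obtain ⟨m1, hm1, hM1, θ0, _, hθ01, d0, H⟩ := high_freq hα hβ x y h
  obtain ⟨θ, hθ0, hθ1, hgap⟩ := gap_poly (pow_ne_zero m1 hp0) (hSS m1) (hst m1) hM1 θ0 hθ01 d0 H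
  have hgap' := gap_CL _ hgap
  set P1 : ℝ := (p:ℝ)^m1 with hP1d
  have hP1 : 1 < P1 := one_lt_pow₀ hp1 (by omega)
  set t : ℝ := -Real.log θ / Real.log P1 with ht
  have hlP : 0 < Real.log P1 := Real.log_pos hP1
  have ht0 : 0 < t := div_pos (by have := Real.log_neg hθ0 hθ1; linarith) hlP
  have hθt : θ = P1 ^ (-t) := by
    rw [Real.rpow_def_of_pos (by linarith), ht]
    have : Real.log P1 * -(-Real.log θ / Real.log P1) = Real.log θ := by field_simp
    rw [this, Real.exp_log hθ0]
  obtain ⟨m2, hm2, C, hC, hM2, hcount⟩ := NTmain hα hβ x y h U hU hU0 (t * σ / 6) (by positivity)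
  set P2 : ℝ := (p:ℝ)^m2 with hP2d
  have hP2 : 1 < P2 := one_lt_pow₀ hp1 (by omega)
  have hM2' : P2 ^ (1 - t * σ / 6) ≤ ((finite_eq hα hβ ((p:ℤ)^m2)).toFinset.card : ℝ) := by
    refine le_trans (le_of_eq ?_) hM2
    rw [hP2d, ← Real.rpow_natCast, ← Real.rpow_mul (by linarith)]
  have hM2pos : 0 < (finite_eq hα hβ ((p:ℤ)^m2)).toFinset.card := by
    have : (0:ℝ) < ((finite_eq hα hβ ((p:ℤ)^m2)).toFinset.card : ℝ) := lt_of_lt_of_le (by positivity) hM2'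
    exact_mod_cast this
  set K := 150000 * C * P2 ^ (3 * (t * σ / 6)) * θ ^ (-2 : ℝ) with hK
  have hK0 : 0 < K := by positivity
  refine ⟨max K P2, t * σ, lt_max_of_lt_left hK0, by positivity, fun ε h0 h1 => ?_⟩
  have hge : ∀ s : ℝ, 0 ≤ s → 1 ≤ ε ^ (-s) := fun s hs => Real.one_le_rpow_of_pos_of_le_one_of_nonpos h0 (by linarith) (by linarith)
  obtain ⟨n, hn1, hn2⟩ := exists_nat_pow_near (hge 2 (by norm_num)) hP2
  obtain ⟨l, hl1, hl2⟩ := exists_nat_pow_near (hge σ hσ.le) hP1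
  have hPk : ((p:ℝ) ^ (m2 * (n + 1))) = P2 ^ (n + 1) := by rw [pow_mul]
  have hkk : P2 ^ (n + 1) ≤ P2 * ε ^ (-2 : ℝ) := by rw [pow_succ']; gcongr
  have hW := (hcount (n + 1) (2 * ε) (by positivity) (by linarith)).2
  rw [hPk] at hW
  obtain ⟨Z, hZ, hZm, hZg⟩ := L2_step (pow_ne_zero m1 hp0) (hSS m1) (pow_ne_zero m2 hp0) (hSS m2) (hst m2) hM1 hM2pos θ hgap'
    U g0 hg0 ε h0 (by linarith) (n + 1) l _ (by
      refine le_trans (le_of_eq ?_) hW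
      congr 2
      ext Q
      rw [Set.mem_ofPred_eq, Set.mem_ofPred_eq]
      push_cast
      rw [← hP2d, mul_comm 2 (n+1), pow_mul (P2)])
  refine ⟨Z, hZ, ?_, fun g hg => ?_⟩
  · refine (hZm.trans (real_final P1 P2 θ t _ C σ hP1 hP2 hθ0 ht0 (by positivity) hC hθt rfl _ hM2' ε h0 (n + 1) l hn2.le hkk hl2.le)).trans ?_
    gcongr
    exact le_max_left _ _
  · obtain ⟨Q, hQ, hd⟩ := hZg g hg
    refine ⟨Q, m1 * l + m2 * (n + 1), by rw [hQ, pow_add (p : ℤ), pow_mul, pow_mul], ?_, hd⟩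
    rw [pow_add, hPk, pow_mul, ← hP1d]
    calc P1 ^ l * P2 ^ (n + 1) ≤ ε ^ (-σ) * (P2 * ε ^ (-2 : ℝ)) := by gcongr
      _ = P2 * (ε ^ (-σ) * ε ^ (-2 : ℝ)) := by ring
      _ = P2 * ε ^ (-(2 + σ)) := by rw [← Real.rpow_add h0]; congr 2; ring
      _ ≤ _ := by gcongr; exact le_max_right _ _

end OO
end

noncomputable section
open scoped Quaternion

lemma cap_trans (g0 : GG) (ε : ℝ) (h0 : 0 < ε) (h1 : ε ≤ 1) :
    ε ^ 2 ≤ 3750 * mu.real {g : GG | ‖pole g - pole g0‖ ≤ ε} := by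
  have h := cap_measure ε h0 h1
  have e : {g : GG | ‖pole g - pole g0‖ ≤ ε} = (fun g => g0⁻¹ * g) ⁻¹' {g : GG | ‖pole g - pole 1‖ ≤ ε} := by
    ext g
    change _ ↔ ‖pole (g0⁻¹ * g) - pole 1‖ ≤ ε
    rw [norm_pole_inv_mul]; rfl
  have e2 : mu.real {g : GG | ‖pole g - pole g0‖ ≤ ε} = mu.real {g : GG | ‖pole g - pole 1‖ ≤ ε} := by
    rw [e, measureReal_def, measure_preimage_mul, measureReal_def]
  rw [e2]
  have : 6 * (25 / ε) ^ 2 = 3750 / ε ^ 2 := by field_simp; norm_num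
  rw [this] at h
  have h3 : (0:ℝ) < ε ^ 2 := by positivity
  calc ε ^ 2 = ε ^ 2 * 1 := by ring
    _ ≤ ε ^ 2 * (3750 / ε ^ 2 * mu.real {g : GG | ‖pole g - pole 1‖ ≤ ε}) := by gcongr
    _ = _ := by field_simp

lemma sep_card (Z B : Set GG) (ε : ℝ) (h0 : 0 < ε) (h1 : ε ≤ 1)
    (hB : ∀ g ∈ B, ∀ g' : GG, ‖pole g' - pole g‖ ≤ ε → g' ∈ Z) (s : Finset GG) (hs : (s : Set GG) ⊆ B)
    (hsep : (s : Set GG).Pairwise fun g g' => 2 * ε < ‖pole g - pole g'‖) :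
    s.card * ε ^ 2 ≤ 3750 * mu.real Z := by
  have hm : ∀ g0 : GG, MeasurableSet {g : GG | ‖pole g - pole g0‖ ≤ ε} := fun g0 => by
    refine (isClosed_le ?_ continuous_const).measurableSet
    have := pole_cont; fun_prop
  have hd : (s : Set GG).PairwiseDisjoint (fun g0 => {g : GG | ‖pole g - pole g0‖ ≤ ε}) := by
    intro g hg g' hg' hne
    refine Set.disjoint_left.2 fun x hx hx' => ?_
    have h3 := hsep hg hg' hne
    change ‖pole x - pole g‖ ≤ ε at hx
    change ‖pole x - pole g'‖ ≤ ε at hx'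
    have : ‖pole g - pole g'‖ ≤ ‖pole x - pole g‖ + ‖pole x - pole g'‖ := by
      rw [norm_sub_rev (pole x) (pole g)]; exact norm_sub_le_norm_sub_add_norm_sub _ _ _
    linarith
  have h2 : mu.real (⋃ g0 ∈ s, {g : GG | ‖pole g - pole g0‖ ≤ ε}) ≤ mu.real Z := by
    refine measureReal_mono ?_
    intro x hx
    simp only [Set.mem_iUnion] at hx
    obtain ⟨g0, hg0, hx⟩ := hx
    exact hB g0 (hs hg0) x hx
  rw [measureReal_biUnion_finset hd (fun g _ => hm g)] at h2
  have h4 : ∑ g0 ∈ s, ε ^ 2 ≤ ∑ g0 ∈ s, 3750 * mu.real {g : GG | ‖pole g - pole g0‖ ≤ ε} :=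
    Finset.sum_le_sum fun g _ => cap_trans g ε h0 h1
  rw [← Finset.mul_sum, Finset.sum_const, nsmul_eq_mul] at h4
  linarith

lemma cover_lemma (Z B : Set GG) (ε : ℝ) (h0 : 0 < ε) (h1 : ε ≤ 1)
    (hB : ∀ g ∈ B, ∀ g' : GG, ‖pole g' - pole g‖ ≤ ε → g' ∈ Z) :
    ∃ s : Finset GG, s.card * ε ^ 2 ≤ 3750 * mu.real Z ∧
      ∀ g ∈ B, ∃ g' ∈ s, ‖pole g - pole g'‖ ≤ 2 * ε := by
  classical
  let T : Set ℕ := {n | ∃ s : Finset GG, (s : Set GG) ⊆ B ∧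
    (s : Set GG).Pairwise (fun g g' => 2 * ε < ‖pole g - pole g'‖) ∧ s.card = n}
  have hT0 : T.Nonempty := ⟨0, ∅, by simp, by simp, rfl⟩
  have hTb : BddAbove T := by
    refine ⟨⌈3750 * mu.real Z / ε ^ 2⌉₊, ?_⟩
    rintro n ⟨s, hs, hsep, rfl⟩
    have := sep_card Z B ε h0 h1 hB s hs hsep
    have h3 : (0:ℝ) < ε ^ 2 := by positivity
    rw [← le_div_iff₀ h3] at this
    exact_mod_cast this.trans (Nat.le_ceil _)
  obtain ⟨s, hs, hsep, hc⟩ := Nat.sSup_mem hT0 hTb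
  refine ⟨s, sep_card Z B ε h0 h1 hB s hs hsep, fun g hg => ?_⟩
  by_contra! hcon
  have hgs : g ∉ s := fun h => by
    have := hcon g h
    simp at this; linarith
  have hmem : (insert g s).card ∈ T := by
    refine ⟨insert g s, ?_, ?_, rfl⟩
    · rw [Finset.coe_insert]; exact Set.insert_subset hg hs
    · rw [Finset.coe_insert]
      refine hsep.insert fun g' hg' _ => ⟨hcon g' hg', ?_⟩
      rw [norm_sub_rev]; exact hcon g' hg'
  have := le_csSup hTb hmem
  rw [Finset.card_insert_of_notMem hgs] at this
  omega

open scoped Topology in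
lemma hausdorff_BC {E : Type*} [MetricSpace E] [MeasurableSpace E] [BorelSpace E]
    (B : ℕ → Set E) (ι : ℕ → Type) [∀ j, Fintype (ι j)] (t : ∀ j, ι j → Set E) (r w : ℕ → ENNReal)
    (hB : ∀ j, B j ⊆ ⋃ i, t j i) (hr : Antitone r) (hr0 : Tendsto r atTop (𝓝 0))
    (ht : ∀ j i, Metric.ediam (t j i) ≤ r j)
    (hw : ∀ j, ∑ i, Metric.ediam (t j i) ^ (2:ℝ) ≤ w j) (hws : ∑' j, w j ≠ ⊤) :
    (μH[(2:ℝ)] : Measure E) {x | ∃ᶠ j in atTop, x ∈ B j} = 0 := by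
  have key := MeasureTheory.Measure.hausdorffMeasure_le_liminf_tsum (X := E) (β := ℕ) (ι := fun J => Σ j, ι (j + J)) 2
    {x | ∃ᶠ j in atTop, x ∈ B j} (l := atTop) r hr0 (fun J ji => t (ji.1 + J) ji.2)
    (Eventually.of_forall fun J ji => (ht _ _).trans (hr (Nat.le_add_left _ _)))
    (Eventually.of_forall fun J x hx => by
      obtain ⟨j, hj, hx⟩ := (frequently_atTop.1 hx) J
      obtain ⟨k, rfl⟩ := Nat.exists_eq_add_of_le' hj
      obtain ⟨i, hi⟩ := Set.mem_iUnion.1 (hB _ hx)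
      exact Set.mem_iUnion.2 ⟨⟨k, i⟩, hi⟩)
  have h2 : Tendsto (fun J => ∑' ji : (Σ j, ι (j + J)), Metric.ediam (t (ji.1 + J) ji.2) ^ (2:ℝ)) atTop (𝓝 0) := by
    refine tendsto_of_tendsto_of_tendsto_of_le_of_le tendsto_const_nhds (ENNReal.tendsto_sum_nat_add w hws)
      (fun _ => zero_le) (fun J => ?_)
    simp only
    rw [ENNReal.tsum_sigma (fun j (i : ι (j + J)) => Metric.ediam (t (j + J) i) ^ (2:ℝ))]
    refine ENNReal.tsum_le_tsum fun j => ?_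
    rw [tsum_fintype]
    exact hw _
  rw [h2.liminf_eq] at key
  exact le_antisymm key zero_le
end

noncomputable section
open scoped Quaternion

/-- the linear map taking the ellipsoid to a round sphere of pure quaternions -/
def YY (a b c : ℕ) (x : Fin 3 → ℝ) : ℍ[ℝ] := qmk 0 (√a * x 0) (√b * x 1) (√c * x 2)

lemma qmk_norm_sq (w x y z : ℝ) : ‖qmk w x y z‖ ^ 2 = w ^ 2 + x ^ 2 + y ^ 2 + z ^ 2 := by
  rw [sq, ← Quaternion.normSq_eq_norm_mul_self, Quaternion.normSq_def']; simp

lemma YY_norm_sq (a b c : ℕ) (x : Fin 3 → ℝ) :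
    ‖YY a b c x‖ ^ 2 = a * x 0 ^ 2 + b * x 1 ^ 2 + c * x 2 ^ 2 := by
  rw [YY, qmk_norm_sq, mul_pow, mul_pow, mul_pow, Real.sq_sqrt (by positivity), Real.sq_sqrt (by positivity),
    Real.sq_sqrt (by positivity)]
  ring

lemma YY_sub (a b c : ℕ) (x y : Fin 3 → ℝ) : YY a b c (x - y) = YY a b c x - YY a b c y := by
  ext <;> simp [YY] <;> ring

lemma YY_smul (a b c : ℕ) (k : ℝ) (x : Fin 3 → ℝ) : YY a b c (k • x) = k • YY a b c x := by
  ext <;> simp [YY] <;> ring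

lemma norm_le_YY {a b c : ℕ} (ha : 0 < a) (hb : 0 < b) (hc : 0 < c) (x : Fin 3 → ℝ) :
    ‖x‖ ≤ ‖YY a b c x‖ := by
  have h := YY_norm_sq a b c x
  have ha' : (1:ℝ) ≤ a := by exact_mod_cast ha
  have hb' : (1:ℝ) ≤ b := by exact_mod_cast hb
  have hc' : (1:ℝ) ≤ c := by exact_mod_cast hc
  have A := mul_le_mul_of_nonneg_right ha' (sq_nonneg (x 0))
  have B := mul_le_mul_of_nonneg_right hb' (sq_nonneg (x 1))
  have C := mul_le_mul_of_nonneg_right hc' (sq_nonneg (x 2))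
  have s0 := sq_nonneg (x 0)
  have s1 := sq_nonneg (x 1)
  have s2 := sq_nonneg (x 2)
  refine (pi_norm_le_iff_of_nonneg (norm_nonneg _)).2 fun i => ?_
  refine abs_le_of_sq_le_sq ?_ (norm_nonneg _)
  rw [h]
  fin_cases i <;> simp <;> linarith

lemma YY_surj {a b c d : ℕ} (hd : 0 < d) (x : Fin 3 → ℝ) (hx : x ∈ ellipsoid a b c d) :
    ∃ g : GG, YY a b c x = √(d:ℝ) • pole g := by
  have hd' : (0:ℝ) < d := by exact_mod_cast hd
  have hs : √(d:ℝ) ≠ 0 := (Real.sqrt_pos.2 hd').ne'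
  have hs2 : √(d:ℝ) ^ 2 = d := Real.sq_sqrt hd'.le
  have h := YY_norm_sq a b c x
  rw [show (a : ℝ) * x 0 ^ 2 + (b : ℝ) * x 1 ^ 2 + (c : ℝ) * x 2 ^ 2 = (d : ℝ) from hx, YY, qmk_norm_sq] at h
  obtain ⟨g, hg⟩ := pole_surj (√a * x 0 / √(d:ℝ)) (√b * x 1 / √(d:ℝ)) (√c * x 2 / √(d:ℝ)) (by
    rw [div_pow, div_pow, div_pow, hs2, ← add_div, ← add_div, div_eq_one_iff_eq hd'.ne', ← h]; ring)
  refine ⟨g, ?_⟩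
  rw [hg]
  ext <;> simp [YY] <;> field_simp

/-- integral pure quaternion attached to an integer vector -/
def JJ (a b c : ℕ) (v : Fin 3 → ℤ) : OO (b * c) (c * a) := ⟨0, a * v 0, b * v 1, v 2⟩

/-- the conjugation action on integer vectors -/
def act (a b c : ℕ) (q : OO (b * c) (c * a)) (v : Fin 3 → ℤ) : Fin 3 → ℤ :=
  ![(q.re^2 + b*c*q.imI^2 - c*a*q.imJ^2 - b*c*(c*a)*q.imK^2) * v 0 + 2*c*b*(q.imI*q.imJ - q.re*q.imK)*v 1
      + 2*c*(b*c*q.imI*q.imK + q.re*q.imJ)*v 2,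
    2*c*a*(q.imI*q.imJ + q.re*q.imK)*v 0 + (q.re^2 - b*c*q.imI^2 + c*a*q.imJ^2 - b*c*(c*a)*q.imK^2)*v 1
      + 2*c*(c*a*q.imJ*q.imK - q.re*q.imI)*v 2,
    2*a*(b*c*q.imI*q.imK - q.re*q.imJ)*v 0 + 2*b*(c*a*q.imJ*q.imK + q.re*q.imI)*v 1
      + (q.re^2 - b*c*q.imI^2 - c*a*q.imJ^2 + b*c*(c*a)*q.imK^2)*v 2]

lemma JJ_act (a b c : ℕ) (q : OO (b * c) (c * a)) (v : Fin 3 → ℤ) :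
    JJ a b c (act a b c q v) = q * JJ a b c v * star q := by
  ext <;> simp [JJ, act] <;> ring

lemma em_JJ (a b c : ℕ) (v : Fin 3 → ℤ) :
    OO.em (JJ a b c v) = (√a * √b * √c) • YY a b c (fun i => (v i : ℝ)) := by
  have ha : √(a:ℝ) * √a = a := Real.mul_self_sqrt (by positivity)
  have hb : √(b:ℝ) * √b = b := Real.mul_self_sqrt (by positivity)
  have hc : √(c:ℝ) * √c = c := Real.mul_self_sqrt (by positivity)
  have h1 : √((b * c : ℕ) : ℝ) = √b * √c := by push_cast; rw [Real.sqrt_mul (by positivity)]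
  have h2 : √((c * a : ℕ) : ℝ) = √c * √a := by push_cast; rw [Real.sqrt_mul (by positivity)]
  ext
  · simp [OO.em, JJ, YY]
  · simp only [OO.em, JJ, YY, h1, h2, qmk_imI, Quaternion.imI_smul, smul_eq_mul]
    push_cast
    linear_combination (-√b * √c * v 0) * ha
  · simp only [OO.em, JJ, YY, h1, h2, qmk_imJ, Quaternion.imJ_smul, smul_eq_mul]
    push_cast
    linear_combination (-√a * √c * v 1) * hb
  · simp only [OO.em, JJ, YY, h1, h2, qmk_imK, Quaternion.imK_smul, smul_eq_mul]
    ring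

lemma norm_conj_pole (g g0 : GG) : ‖(g : ℍ[ℝ]) * pole g0 * star (g : ℍ[ℝ])‖ = 1 := by
  rw [← pole_mul]
  have := cc_sq (g * g0)
  have h2 := qmk_norm_sq 0 (c1 (g * g0)) (c2 (g * g0)) (c3 (g * g0))
  change ‖pole (g * g0)‖ ^ 2 = _ at h2
  have h3 : ‖pole (g * g0)‖ ^ 2 = 1 := by rw [h2]; linarith
  exact (pow_eq_one_iff_of_nonneg (norm_nonneg _) two_ne_zero).1 h3

lemma orbit_point {a b c d p : ℕ} (ha : 0 < a) (hb : 0 < b) (hc : 0 < c) (hd : 0 < d) [hp : Fact p.Prime]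
    (r0 : Fin 3 → ℝ) (K : ℕ) (v : Fin 3 → ℤ) (hv : ∀ i, (p:ℝ) ^ K * r0 i = v i)
    (g0 : GG) (hg0 : YY a b c r0 = √(d:ℝ) • pole g0) (Q : OO (b * c) (c * a)) (n : ℕ) (hQ : OO.nm Q = (p:ℤ) ^ n) :
    ∃ r ∈ ellipsoidZinvp a b c d p, YY a b c r = √(d:ℝ) • ((OO.uu Q : ℍ[ℝ]) * pole g0 * star (OO.uu Q : ℍ[ℝ])) ∧
      ∀ R : ℝ, (p:ℝ) ^ (K + n) ≤ R → DenomLe r R := by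
  have hp0 : (0:ℝ) < p := by exact_mod_cast hp.out.pos
  have hd' : (0:ℝ) < d := by exact_mod_cast hd
  have hP : (p:ℝ) ^ (K + n) ≠ 0 := (pow_pos hp0 _).ne'
  have hnz : OO.nm Q ≠ 0 := by rw [hQ]; exact pow_ne_zero _ (by exact_mod_cast hp.out.ne_zero)
  have hA : √(a:ℝ) * √b * √c ≠ 0 := by
    have : 0 < √(a:ℝ) * √b * √c := by
      have ha' : (0:ℝ) < a := by exact_mod_cast ha
      have hb' : (0:ℝ) < b := by exact_mod_cast hb
      have hc' : (0:ℝ) < c := by exact_mod_cast hc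
      positivity
    exact this.ne'
  have hn : ‖OO.em Q‖ * ‖OO.em Q‖ = (p:ℝ) ^ n := by
    rw [← sq, OO.em_norm, hQ]; push_cast; rfl
  have hvr : (fun i => (v i : ℝ)) = (p:ℝ) ^ K • r0 := by
    funext i; rw [← hv i]; rfl
  set s := act a b c Q v with hs
  have e1 : OO.em (JJ a b c s) = OO.em Q * OO.em (JJ a b c v) * star (OO.em Q) := by
    rw [hs, JJ_act, OO.em_mul, OO.em_mul, OO.em_star]
  rw [em_JJ, em_JJ, hvr, YY_smul, hg0, OO.em_eq hnz] at e1
  have e2 : (√(a:ℝ) * √b * √c) • YY a b c (fun i => (s i : ℝ)) = (√(a:ℝ) * √b * √c) •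
      ((p:ℝ) ^ (K + n) • √(d:ℝ) • ((OO.uu Q : ℍ[ℝ]) * pole g0 * star (OO.uu Q : ℍ[ℝ]))) := by
    rw [e1, Quaternion.star_smul]
    simp only [smul_mul_assoc, mul_smul_comm, smul_smul]
    congr 1
    rw [pow_add, ← hn]; ring
  have e3 := smul_right_injective _ hA e2
  refine ⟨((p:ℝ) ^ (K + n))⁻¹ • (fun i => (s i : ℝ)), ⟨?_, fun i => ⟨s i, K + n, ?_⟩⟩, ?_, fun R hR => ⟨p ^ (K + n), ?_, ?_, fun i => ⟨s i, ?_⟩⟩⟩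
  · have h := YY_norm_sq a b c (((p:ℝ) ^ (K + n))⁻¹ • (fun i => (s i : ℝ)))
    rw [YY_smul, e3, smul_smul, inv_mul_cancel₀ hP, one_smul, norm_smul, norm_conj_pole, mul_one, Real.norm_eq_abs,
      sq_abs, Real.sq_sqrt hd'.le] at h
    exact h.symm
  · simp [div_eq_inv_mul]
  · rw [YY_smul, e3, smul_smul, inv_mul_cancel₀ hP, one_smul]
  · exact pow_pos hp.out.pos _
  · push_cast; exact hR
  · push_cast
    simp only [Pi.smul_apply, smul_eq_mul]
    rw [mul_inv_cancel_left₀ hP]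
end

noncomputable section
open scoped Quaternion

/-- base data: an integral point with its radial pole -/
lemma base_point {a b c d p : ℕ} (ha : 0 < a) (hb : 0 < b) (hc : 0 < c) (hd : 0 < d) [hp : Fact p.Prime]
    (r0 : Fin 3 → ℝ) (hr0 : r0 ∈ ellipsoidZinvp a b c d p) :
    ∃ (K : ℕ) (v : Fin 3 → ℤ) (g0 : GG), (∀ i, (p:ℝ) ^ K * r0 i = v i) ∧ YY a b c r0 = √(d:ℝ) • pole g0 ∧
      JJ a b c v ≠ 0 ∧ OO.em (JJ a b c v) = ‖OO.em (JJ a b c v)‖ • pole g0 := by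
  have hp0 : (0:ℝ) < p := by exact_mod_cast hp.out.pos
  have hd' : (0:ℝ) < d := by exact_mod_cast hd
  have ha' : (0:ℝ) < a := by exact_mod_cast ha
  have hb' : (0:ℝ) < b := by exact_mod_cast hb
  have hc' : (0:ℝ) < c := by exact_mod_cast hc
  obtain ⟨hX, hz⟩ := hr0
  choose z k hz using hz
  obtain ⟨g0, hg0⟩ := YY_surj hd r0 hX
  let K := k 0 + k 1 + k 2
  have hk : ∀ i, k i ≤ K := by intro i; fin_cases i <;> simp [K] <;> omega
  let v : Fin 3 → ℤ := fun i => z i * (p:ℤ) ^ (K - k i)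
  have hv : ∀ i, (p:ℝ) ^ K * r0 i = v i := by
    intro i
    have : (p:ℝ) ^ K = (p:ℝ) ^ (K - k i) * (p:ℝ) ^ k i := by rw [← pow_add, Nat.sub_add_cancel (hk i)]
    have h0 : (p:ℝ) ^ k i ≠ 0 := (pow_pos hp0 _).ne'
    rw [hz i, this]; simp only [v]; push_cast; field_simp
  have hvr : (fun i => (v i : ℝ)) = (p:ℝ) ^ K • r0 := by
    funext i; rw [← hv i]; rfl
  have hem : OO.em (JJ a b c v) = (√(a:ℝ) * √b * √c * (p:ℝ) ^ K * √(d:ℝ)) • pole g0 := by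
    rw [em_JJ, hvr, YY_smul, hg0, smul_smul, smul_smul]
  have hpos : 0 < √(a:ℝ) * √b * √c * (p:ℝ) ^ K * √(d:ℝ) := by positivity
  have hn1 : ‖pole g0‖ = 1 := by
    have := norm_conj_pole 1 g0
    rwa [← pole_mul, one_mul] at this
  have hnorm : ‖OO.em (JJ a b c v)‖ = √(a:ℝ) * √b * √c * (p:ℝ) ^ K * √(d:ℝ) := by
    rw [hem, norm_smul, hn1, mul_one, Real.norm_eq_abs, abs_of_pos hpos]
  refine ⟨K, v, g0, hv, hg0, ?_, ?_⟩
  · intro h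
    rw [h] at hnorm
    have : OO.em (0 : OO (b * c) (c * a)) = 0 := by ext <;> simp [OO.em]
    rw [this, norm_zero] at hnorm
    linarith
  · rw [hnorm]; exact hem

/-- points that are badly approximable at a given scale -/
def BadSet (a b c d p : ℕ) (C σ ε : ℝ) : Set (Fin 3 → ℝ) :=
  {x ∈ ellipsoid a b c d | ∀ r ∈ ellipsoidZinvp a b c d p, ‖x - r‖ ≤ 2 * √(d:ℝ) * ε → ¬ DenomLe r (C * ε ^ (-(2 + σ)))}

lemma bad_cover {a b c d p : ℕ} (ha : 0 < a) (hb : 0 < b) (hc : 0 < c) (hd : 0 < d) [hp : Fact p.Prime]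
    (hnd : ¬ DiscreteTopology ↥(ellipsoidZinvp a b c d p)) (σ : ℝ) (hσ : 0 < σ) :
    ∃ C η D : ℝ, 0 < C ∧ 0 < η ∧ 0 < D ∧ ∀ ε : ℝ, 0 < ε → ε ≤ 1/2 →
      ∃ (s : Finset GG), s.card * ε ^ 2 ≤ D * ε ^ η ∧
        BadSet a b c d p C σ ε ⊆ ⋃ g : s, {x | ‖YY a b c x - √(d:ℝ) • pole (g : GG)‖ ≤ 2 * √(d:ℝ) * ε} := by
  have hp0 : (0:ℝ) < p := by exact_mod_cast hp.out.pos
  have hd' : (0:ℝ) < d := by exact_mod_cast hd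
  obtain ⟨x, y, hxy⟩ := isotropy a b c d hb hc p hnd
  have hne : (ellipsoidZinvp a b c d p).Nonempty := by
    by_contra h
    rw [Set.not_nonempty_iff_eq_empty] at h
    apply hnd
    rw [h]
    infer_instance
  obtain ⟨r0, hr0⟩ := hne
  obtain ⟨K, v, g0, hv, hg0, hU0, hem⟩ := base_point ha hb hc hd r0 hr0
  obtain ⟨C, η, hC, hη, H⟩ := OO.final_est (Nat.mul_pos hb hc) (Nat.mul_pos hc ha) x y hxy (JJ a b c v) rfl hU0 g0 hem σ hσ
  refine ⟨(p:ℝ) ^ K * C, η, 3750 * C, by positivity, hη, by positivity, fun ε h0 h1 => ?_⟩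
  obtain ⟨Z, -, hZ, HZ⟩ := H ε h0 h1
  obtain ⟨s, hs, hcov⟩ := cover_lemma Z {g | ∃ x ∈ BadSet a b c d p ((p:ℝ) ^ K * C) σ ε, YY a b c x = √(d:ℝ) • pole g} ε h0
    (by linarith) (by
      rintro g ⟨x, hx, hxg⟩ g' hg'
      by_contra hcon
      obtain ⟨Q, n, hQ, hn, hclose⟩ := HZ g' hcon
      obtain ⟨r, hr, hYr, hden⟩ := orbit_point ha hb hc hd r0 K v hv g0 hg0 Q n hQ
      refine hx.2 r hr ?_ (hden _ ?_)
      · refine (norm_le_YY ha hb hc _).trans ?_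
        rw [YY_sub, hxg, hYr, ← smul_sub, norm_smul, Real.norm_eq_abs, abs_of_nonneg (Real.sqrt_nonneg _)]
        have : ‖pole g - (OO.uu Q : ℍ[ℝ]) * pole g0 * star (OO.uu Q : ℍ[ℝ])‖ ≤ 2 * ε := by
          have := norm_sub_le_norm_sub_add_norm_sub (pole g) (pole g') ((OO.uu Q : ℍ[ℝ]) * pole g0 * star (OO.uu Q : ℍ[ℝ]))
          rw [norm_sub_rev (pole g) (pole g')] at this
          linarith
        calc _ ≤ √(d:ℝ) * (2 * ε) := by gcongr
          _ = _ := by ring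
      · rw [pow_add, mul_assoc]
        gcongr)
  refine ⟨s, ?_, fun x hx => ?_⟩
  · calc _ ≤ _ := hs
      _ ≤ 3750 * (C * ε ^ η) := by gcongr
      _ = _ := by ring
  · obtain ⟨g, hg⟩ := YY_surj hd x hx.1
    obtain ⟨g', hg', hgg⟩ := hcov g ⟨x, hx, hg⟩
    refine Set.mem_iUnion.2 ⟨⟨g', hg'⟩, ?_⟩
    change ‖YY a b c x - √(d:ℝ) • pole g'‖ ≤ _
    rw [hg, ← smul_sub, norm_smul, Real.norm_eq_abs, abs_of_nonneg (Real.sqrt_nonneg _)]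
    calc _ ≤ √(d:ℝ) * (2 * ε) := by gcongr
      _ = _ := by ring

lemma cap_ediam {a b c : ℕ} (ha : 0 < a) (hb : 0 < b) (hc : 0 < c) (w : ℍ[ℝ]) (ρ : ℝ) :
    Metric.ediam {x | ‖YY a b c x - w‖ ≤ ρ} ≤ ENNReal.ofReal (2 * ρ) := by
  refine Metric.ediam_le fun x hx y hy => ?_
  rw [edist_dist]
  refine ENNReal.ofReal_le_ofReal ?_
  rw [dist_eq_norm]
  refine (norm_le_YY ha hb hc _).trans ?_
  rw [YY_sub]
  have := norm_sub_le_norm_sub_add_norm_sub (YY a b c x) w (YY a b c y)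
  rw [norm_sub_rev w] at this
  change ‖YY a b c x - w‖ ≤ ρ at hx
  change ‖YY a b c y - w‖ ≤ ρ at hy
  linarith

open scoped Topology in
lemma bad_null {a b c d p : ℕ} (ha : 0 < a) (hb : 0 < b) (hc : 0 < c) (hd : 0 < d) [hp : Fact p.Prime]
    (hnd : ¬ DiscreteTopology ↥(ellipsoidZinvp a b c d p)) (σ : ℝ) (hσ : 0 < σ) :
    ∃ C : ℝ, 0 < C ∧
      (μH[(2:ℝ)] : Measure (Fin 3 → ℝ)) {x | ∃ᶠ j : ℕ in atTop, x ∈ BadSet a b c d p C σ ((1/2:ℝ) ^ (j + 1))} = 0 := by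
  have hd' : (0:ℝ) < d := by exact_mod_cast hd
  obtain ⟨C, η, D, hC, hη, hD, H⟩ := bad_cover ha hb hc hd hnd σ hσ
  refine ⟨C, hC, ?_⟩
  have he : ∀ j : ℕ, (0:ℝ) < (1/2:ℝ) ^ (j + 1) := fun j => by positivity
  have he2 : ∀ j : ℕ, (1/2:ℝ) ^ (j + 1) ≤ 1/2 := fun j => by
    rw [pow_succ]
    have : (1/2:ℝ) ^ j ≤ 1 := pow_le_one₀ (by norm_num) (by norm_num)
    linarith
  choose s hs hcov using fun j : ℕ => H ((1/2:ℝ) ^ (j + 1)) (he j) (he2 j)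
  have hsum : Summable fun j : ℕ => 16 * (d:ℝ) * (D * ((1/2:ℝ) ^ (j + 1)) ^ η) := by
    have e : ∀ j : ℕ, 16 * (d:ℝ) * (D * ((1/2:ℝ) ^ (j + 1)) ^ η) = 16 * (d:ℝ) * D * ((1/2:ℝ) ^ η) * ((1/2:ℝ) ^ η) ^ j := by
      intro j
      have : ((1/2:ℝ) ^ (j + 1)) ^ η = ((1/2:ℝ) ^ η) ^ (j + 1) := by
        rw [← Real.rpow_natCast, ← Real.rpow_mul (by norm_num), mul_comm, Real.rpow_mul (by norm_num), Real.rpow_natCast]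
      rw [this, pow_succ]; ring
    simp_rw [e]
    refine (summable_geometric_of_lt_one (by positivity) ?_).mul_left _
    exact Real.rpow_lt_one (by norm_num) (by norm_num) hη
  refine hausdorff_BC _ (fun j => ↥(s j)) (fun j g => {x | ‖YY a b c x - √(d:ℝ) • pole (g : GG)‖ ≤ 2 * √(d:ℝ) * (1/2:ℝ) ^ (j + 1)})
    (fun j => ENNReal.ofReal (2 * (2 * √(d:ℝ) * (1/2:ℝ) ^ (j + 1)))) (fun j => ENNReal.ofReal (16 * (d:ℝ) * (D * ((1/2:ℝ) ^ (j + 1)) ^ η)))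
    hcov ?_ ?_ (fun j g => cap_ediam ha hb hc _ _) ?_ ?_
  · intro i j hij
    refine ENNReal.ofReal_le_ofReal ?_
    have : (1/2:ℝ) ^ (j + 1) ≤ (1/2:ℝ) ^ (i + 1) := pow_le_pow_of_le_one (by norm_num) (by norm_num) (by omega)
    gcongr
  · have h1 : Tendsto (fun j : ℕ => 2 * (2 * √(d:ℝ) * (1/2:ℝ) ^ (j + 1))) atTop (𝓝 (2 * (2 * √(d:ℝ) * 0))) :=
      (((tendsto_pow_atTop_nhds_zero_of_lt_one (by norm_num) (by norm_num)).comp (tendsto_add_atTop_nat 1)).const_mul _).const_mul _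
    have := ENNReal.tendsto_ofReal h1
    simpa using this
  · intro j
    have h1 : ∀ g ∈ (Finset.univ : Finset ↥(s j)), Metric.ediam {x | ‖YY a b c x - √(d:ℝ) • pole (g : GG)‖ ≤ 2 * √(d:ℝ) * (1/2:ℝ) ^ (j + 1)} ^ (2:ℝ)
        ≤ ENNReal.ofReal (16 * d * ((1/2:ℝ) ^ (j + 1)) ^ 2) := by
      intro g _
      refine (ENNReal.rpow_le_rpow (cap_ediam ha hb hc _ _) (by norm_num)).trans ?_
      rw [ENNReal.ofReal_rpow_of_nonneg (by positivity) (by norm_num)]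
      refine ENNReal.ofReal_le_ofReal (le_of_eq ?_)
      rw [Real.rpow_two, mul_pow, mul_pow, mul_pow, Real.sq_sqrt hd'.le]
      ring
    refine (Finset.sum_le_sum h1).trans ?_
    rw [Finset.sum_const, Finset.card_univ, Fintype.card_coe, nsmul_eq_mul, ← ENNReal.ofReal_natCast,
      ← ENNReal.ofReal_mul (by positivity)]
    refine ENNReal.ofReal_le_ofReal ?_
    calc ((s j).card : ℝ) * (16 * d * ((1/2:ℝ) ^ (j + 1)) ^ 2) = 16 * d * ((s j).card * ((1/2:ℝ) ^ (j + 1)) ^ 2) := by ring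
      _ ≤ _ := mul_le_mul_of_nonneg_left (hs j) (by positivity)
  · rw [← ENNReal.ofReal_tsum_of_nonneg (fun j => by positivity) hsum]
    exact ENNReal.ofReal_ne_top
end

noncomputable section
open scoped Quaternion

lemma DenomLe.mono {r : Fin 3 → ℝ} {R R' : ℝ} (h : DenomLe r R) (hR : R ≤ R') : DenomLe r R' := by
  obtain ⟨N, h0, h1, h2⟩ := h
  exact ⟨N, h0, h1.trans hR, h2⟩

lemma ellipsoid_meas (a b c d : ℕ) : MeasurableSet (ellipsoid a b c d) := by
  have : IsClosed (ellipsoid a b c d) := by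
    unfold ellipsoid
    exact isClosed_eq (by fun_prop) continuous_const
  exact this.measurableSet

lemma good_point {a b c d p : ℕ} (hd : 0 < d) {C σ κ : ℝ} (hC : 0 < C) (hσ : 0 < σ) (hκ : 2 + σ < κ)
    (x : Fin 3 → ℝ) (hx : x ∈ ellipsoid a b c d)
    (hb : ¬ ∃ᶠ j : ℕ in atTop, x ∈ BadSet a b c d p C σ ((1/2:ℝ) ^ (j + 1))) :
    ∃ ε₀ : ℝ, 0 < ε₀ ∧ ∀ ε : ℝ, 0 < ε → ε < ε₀ →
        ∃ r ∈ ellipsoidZinvp a b c d p, ‖x - r‖ ≤ ε ∧ DenomLe r (ε ^ (-κ)) := by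
  have hd' : (0:ℝ) < d := by exact_mod_cast hd
  have hs : 0 < √(d:ℝ) := Real.sqrt_pos.2 hd'
  rw [not_frequently, eventually_atTop] at hb
  obtain ⟨J, hJ⟩ := hb
  set C2 : ℝ := C * (4 * √(d:ℝ)) ^ (2 + σ) with hC2
  have hC2p : 0 < C2 := by positivity
  set t : ℝ := κ - (2 + σ) with ht
  have htp : 0 < t := by linarith
  refine ⟨min (2 * √(d:ℝ) * (1/2:ℝ) ^ (J + 1)) (C2⁻¹ ^ t⁻¹), by positivity, fun ε h0 h1 => ?_⟩
  obtain ⟨h1, h2⟩ := lt_min_iff.1 h1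
  have hx0 : 0 < ε / (2 * √(d:ℝ)) := by positivity
  have hxJ : ε / (2 * √(d:ℝ)) < (1/2:ℝ) ^ (J + 1) := by rw [div_lt_iff₀ (by positivity)]; linarith
  have hx1 : ε / (2 * √(d:ℝ)) ≤ 1 := hxJ.le.trans (pow_le_one₀ (by norm_num) (by norm_num))
  obtain ⟨j, hj1, hj2⟩ := exists_nat_pow_near_of_lt_one hx0 hx1 (by norm_num : (0:ℝ) < 1/2) (by norm_num)
  have hjJ : J ≤ j := by
    have := (pow_lt_pow_iff_right_of_lt_one₀ (by norm_num : (0:ℝ) < 1/2) (by norm_num)).1 (hj1.trans hxJ)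
    omega
  have hbad := hJ j hjJ
  have hgood : ∃ r ∈ ellipsoidZinvp a b c d p, ‖x - r‖ ≤ 2 * √(d:ℝ) * (1/2:ℝ) ^ (j + 1) ∧
      DenomLe r (C * ((1/2:ℝ) ^ (j + 1)) ^ (-(2 + σ))) := by
    by_contra hcon
    push Not at hcon
    exact hbad ⟨hx, hcon⟩
  obtain ⟨r, hr, hr1, hr2⟩ := hgood
  refine ⟨r, hr, hr1.trans ?_, hr2.mono ?_⟩
  · rw [lt_div_iff₀ (by positivity)] at hj1; linarith
  · have h3 : ε / (4 * √(d:ℝ)) ≤ (1/2:ℝ) ^ (j + 1) := by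
      rw [div_le_iff₀ (by positivity)] at hj2 ⊢
      rw [pow_succ]; linarith
    have h4 : ((1/2:ℝ) ^ (j + 1)) ^ (-(2 + σ)) ≤ (ε / (4 * √(d:ℝ))) ^ (-(2 + σ)) :=
      Real.rpow_le_rpow_of_nonpos (by positivity) h3 (by linarith)
    have h5 : (ε / (4 * √(d:ℝ))) ^ (-(2 + σ)) = (4 * √(d:ℝ)) ^ (2 + σ) * ε ^ (-(2 + σ)) := by
      rw [Real.div_rpow h0.le (by positivity), Real.rpow_neg (by positivity : 0 ≤ 4 * √(d:ℝ)), div_inv_eq_mul, mul_comm]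
    have h6 : ε ^ t ≤ C2⁻¹ := by
      have := Real.rpow_le_rpow h0.le h2.le htp.le
      rwa [← Real.rpow_mul (by positivity), inv_mul_cancel₀ htp.ne', Real.rpow_one] at this
    have h7 : ε ^ (-(2 + σ)) = ε ^ (-κ) * ε ^ t := by
      rw [← Real.rpow_add h0]; congr 1; rw [ht]; ring
    calc C * ((1/2:ℝ) ^ (j + 1)) ^ (-(2 + σ)) ≤ C * ((4 * √(d:ℝ)) ^ (2 + σ) * ε ^ (-(2 + σ))) := by
          rw [← h5]; gcongr
      _ = C2 * (ε ^ (-κ) * ε ^ t) := by rw [hC2, h7]; ring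
      _ ≤ C2 * (ε ^ (-κ) * C2⁻¹) := by gcongr
      _ = ε ^ (-κ) := by field_simp

end

/-- **Almost-everywhere intrinsic Diophantine approximation on rational ellipsoids.**
Let X be a rational ellipsoid with X(ℤ[1/p]) not discrete in X.  For almost every x ∈ X
(w.r.t. the 2-dimensional Hausdorff measure on X) and every κ > 2 there is
ε₀ = ε₀(x,κ) > 0 such that for every ε ∈ (0,ε₀) the system
‖x − r‖ ≤ ε, D(r) ≤ ε^{−κ} has a solution r ∈ X(ℤ[1/p]). -/
theorem diophantine_approximation_ellipsoid_ae
    (a b c d : ℕ) (ha : 0 < a) (hb : 0 < b) (hc : 0 < c) (hd : 0 < d)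
    (p : ℕ) (hp : p.Prime)
    (hnd : ¬ DiscreteTopology ↥(ellipsoidZinvp a b c d p)) :
    ∀ᵐ x ∂((μH[(2 : ℝ)] : Measure (Fin 3 → ℝ)).restrict (ellipsoid a b c d)),
      ∀ κ : ℝ, 2 < κ → ∃ ε₀ : ℝ, 0 < ε₀ ∧ ∀ ε : ℝ, 0 < ε → ε < ε₀ →
        ∃ r ∈ ellipsoidZinvp a b c d p, ‖x - r‖ ≤ ε ∧ DenomLe r (ε ^ (-κ)) := by
  have : Fact p.Prime := ⟨hp⟩
  rw [ae_restrict_iff' (ellipsoid_meas a b c d)]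
  choose C hC hnull using fun N : ℕ => bad_null ha hb hc hd hnd (1 / ((N:ℝ) + 1)) (by positivity)
  have hall : ∀ᵐ x ∂(μH[(2 : ℝ)] : Measure (Fin 3 → ℝ)), ∀ N : ℕ,
      ¬ ∃ᶠ j : ℕ in atTop, x ∈ BadSet a b c d p (C N) (1 / ((N:ℝ) + 1)) ((1/2:ℝ) ^ (j + 1)) := by
    rw [ae_all_iff]
    intro N
    rw [ae_iff]
    simpa only [not_not] using hnull N
  filter_upwards [hall] with x hx hxX κ hκ
  obtain ⟨N, hN⟩ := exists_nat_one_div_lt (sub_pos.2 hκ)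
  exact good_point hd (hC N) (by positivity) (by linarith) x hxX (hx N)

end
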